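/- Let b ∈ [0,1) and ρ > 0, and define η(x) = log( 2(1−b)ρ cos(πb/2) / ( |x|^{2(1−b)} + 2ρ|x|^{1−b} sin(πb/2) + ρ² ) ) for x ∈ ℝ, and κ_b = 2π(1−b). Then for every smooth compactly supported function v : ℝ → ℝ one has the generalized Onofri inequality: log( (1/κ_b) ∫_ℝ e^{v(x)} e^{η(x)} |x|^{−b} dx ) ≤ (1/(4π κ_b)) ∫_ℝ∫_ℝ (v(x)−v(y))²/(x−y)² dx dy + (1/κ_b) ∫_ℝ v(x) e^{η(x)} |x|^{−b} dx. -/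

import Mathlib

open MeasureTheory Real


namespace Onofri

open Set Filter Topology

lemma tonelli_int {α β : Type*} [MeasurableSpace α] [MeasurableSpace β] {μ : Measure α}
    {ν : Measure β} [SFinite μ] [SFinite ν] {F : α → β → ℝ}
    (hm : AEStronglyMeasurable (fun p : α × β => F p.1 p.2) (μ.prod ν))
    (h0 : ∀ᵐ t ∂ν, ∀ᵐ s ∂μ, 0 ≤ F s t)
    (h1 : ∀ᵐ t ∂ν, Integrable (fun s => F s t) μ)
    (h2 : Integrable (fun t => ∫ s, F s t ∂μ) ν) :
    Integrable (fun p : α × β => F p.1 p.2) (μ.prod ν) := by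
  rw [integrable_prod_iff' hm]
  refine ⟨h1, h2.congr ?_⟩
  filter_upwards [h0] with t ht
  refine integral_congr_ae ?_
  filter_upwards [ht] with s hs
  rw [Real.norm_of_nonneg hs]

/-- Laplace transform of cosine. -/
lemma laplace_cos (t x : ℝ) (ht : 0 < t) :
    IntegrableOn (fun s => Real.exp (-t * s) * Real.cos (x * s)) (Ioi 0) ∧
    ∫ s in Ioi (0:ℝ), Real.exp (-t * s) * Real.cos (x * s) = t / (t ^ 2 + x ^ 2) := by
  have hre : ((-t + x * Complex.I : ℂ)).re < 0 := by simpa using ht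
  have hi := integrableOn_exp_mul_complex_Ioi hre 0
  have he := integral_exp_mul_complex_Ioi hre 0
  have key : ∀ s : ℝ, (Complex.exp ((-t + x * Complex.I : ℂ) * s)).re
      = Real.exp (-t * s) * Real.cos (x * s) := by
    intro s
    rw [Complex.exp_re]; simp
  constructor
  · have := hi.re
    refine this.congr (Eventually.of_forall fun s => ?_)
    simpa using key s
  · have h3 : ∫ s in Ioi (0:ℝ), (Complex.exp ((-t + x * Complex.I : ℂ) * s)).re =
        (∫ s in Ioi (0:ℝ), Complex.exp ((-t + x * Complex.I : ℂ) * s)).re := by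
      have := integral_re hi
      simpa using this
    rw [he] at h3
    simp_rw [key] at h3
    rw [h3]
    have : (t ^ 2 + x ^ 2 : ℝ) ≠ 0 := by positivity
    simp [Complex.div_re, Complex.normSq_apply]
    field_simp

lemma laplace_one_sub_cos (t x : ℝ) (ht : 0 < t) :
    IntegrableOn (fun s => Real.exp (-t * s) * (1 - Real.cos (x * s))) (Ioi 0) ∧
    ∫ s in Ioi (0:ℝ), Real.exp (-t * s) * (1 - Real.cos (x * s)) =
      1 / t - t / (t ^ 2 + x ^ 2) := by
  have h1 := laplace_cos t x ht
  have h0 := laplace_cos t 0 ht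
  simp only [zero_mul, Real.cos_zero, mul_one] at h0
  simp only [mul_sub, mul_one]
  refine ⟨h0.1.sub h1.1, ?_⟩
  rw [integral_sub h0.1 h1.1, h0.2, h1.2]
  congr 1
  field_simp; simp

lemma int_exp_Ioi (s c : ℝ) (hs : 0 < s) :
    IntegrableOn (fun t => Real.exp (-t * s)) (Ioi c) ∧
    ∫ t in Ioi c, Real.exp (-t * s) = Real.exp (-c * s) / s := by
  have h : ∀ t : ℝ, Real.exp (-t * s) = Real.exp (-s * t) := fun t => by ring_nf
  simp_rw [h]
  refine ⟨integrableOn_exp_mul_Ioi (by linarith) c, ?_⟩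
  rw [integral_exp_mul_Ioi (by linarith) c]
  field_simp

lemma int_t_exp_Ioi (s : ℝ) (hs : 0 < s) :
    ∫ t in Ioi (0:ℝ), t * Real.exp (-t * s) = 1 / s ^ 2 := by
  have := Real.integral_rpow_mul_exp_neg_mul_Ioi (a := 2) (r := s) (by norm_num) hs
  have h2 : ∀ t : ℝ, t ^ ((2:ℝ) - 1) * Real.exp (-(s * t)) = t * Real.exp (-t * s) := by
    intro t
    rw [show (2:ℝ) - 1 = 1 by norm_num, Real.rpow_one]; ring_nf
  simp_rw [h2] at this
  rw [this, Real.Gamma_two]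
  simp

/-- Frullani-type integral. -/
lemma frullani (ε x : ℝ) (hε : 0 < ε) :
    IntegrableOn (fun s => (1 - Real.cos (x * s)) * (Real.exp (-ε * s) / s)) (Ioi 0) ∧
    ∫ s in Ioi (0:ℝ), (1 - Real.cos (x * s)) * (Real.exp (-ε * s) / s) =
      (1/2) * Real.log (x ^ 2 + ε ^ 2) - Real.log ε := by
  set F : ℝ → ℝ → ℝ := fun s t => Real.exp (-t * s) * (1 - Real.cos (x * s)) with hF
  have hG : IntegrableOn (fun t => 1 / t - t / (t ^ 2 + x ^ 2)) (Ioi ε) ∧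
      ∫ t in Ioi ε, (1 / t - t / (t ^ 2 + x ^ 2)) =
        0 - (Real.log ε - (1/2) * Real.log (ε ^ 2 + x ^ 2)) := by
    have hd : ∀ t ∈ Ici ε, HasDerivAt (fun t => Real.log t - (1/2) * Real.log (t ^ 2 + x ^ 2))
        (1 / t - t / (t ^ 2 + x ^ 2)) t := by
      intro t ht
      have ht0 : 0 < t := lt_of_lt_of_le hε ht
      have h2 : t ^ 2 + x ^ 2 ≠ 0 := by positivity
      have := (Real.hasDerivAt_log ht0.ne').sub
        ((((hasDerivAt_pow 2 t).add_const (x ^ 2)).log h2).const_mul (1/2))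
      refine this.congr_deriv ?_
      field_simp
      push_cast
      ring
    have hl : Tendsto (fun t => Real.log t - (1/2) * Real.log (t ^ 2 + x ^ 2)) atTop (𝓝 0) := by
      have h1 : Tendsto (fun t : ℝ => -(1/2) * Real.log (1 + (x / t) ^ 2)) atTop (𝓝 0) := by
        have : Tendsto (fun t : ℝ => 1 + (x / t) ^ 2) atTop (𝓝 (1 + 0 ^ 2)) :=
          ((tendsto_const_nhds.div_atTop tendsto_id).pow 2).const_add 1
        have := (this.log (by norm_num)).const_mul (-(1/2))
        simpa using this
      refine h1.congr' ?_
      filter_upwards [eventually_gt_atTop 0] with t ht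
      have : 1 + (x / t) ^ 2 = (t ^ 2 + x ^ 2) / t ^ 2 := by field_simp
      rw [this, Real.log_div (by positivity) (by positivity), Real.log_pow]
      push_cast; ring
    have hpos : ∀ t ∈ Ioi ε, 0 ≤ 1 / t - t / (t ^ 2 + x ^ 2) := by
      intro t ht
      have ht0 : 0 < t := lt_trans hε ht
      have : 1 / t - t / (t ^ 2 + x ^ 2) = x ^ 2 / (t * (t ^ 2 + x ^ 2)) := by
        field_simp; ring
      rw [this]; positivity
    have hi := integrableOn_Ioi_deriv_of_nonneg' hd hpos hl
    exact ⟨hi, integral_Ioi_of_hasDerivAt_of_tendsto' hd hi hl⟩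
  have hI : Integrable (fun p : ℝ × ℝ => F p.1 p.2)
      ((volume.restrict (Ioi 0)).prod (volume.restrict (Ioi ε))) := by
    apply tonelli_int
    · apply Continuous.aestronglyMeasurable
      simp only [hF]; fun_prop
    · refine Eventually.of_forall fun t => Eventually.of_forall fun s => ?_
      have := Real.cos_le_one (x * s)
      exact mul_nonneg (Real.exp_pos _).le (by linarith)
    · filter_upwards [ae_restrict_mem measurableSet_Ioi] with t ht
      exact (laplace_one_sub_cos t x (lt_trans hε ht)).1
    · refine hG.1.congr ?_
      filter_upwards [ae_restrict_mem measurableSet_Ioi] with t ht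
      exact ((laplace_one_sub_cos t x (lt_trans hε ht)).2).symm
  have hin : ∀ s ∈ Ioi (0:ℝ), ∫ t in Ioi ε, F s t =
      (1 - Real.cos (x * s)) * (Real.exp (-ε * s) / s) := by
    intro s hs
    simp only [hF]
    rw [integral_mul_const, (int_exp_Ioi s ε hs).2]; ring
  constructor
  · refine hI.integral_prod_left.congr ?_
    filter_upwards [ae_restrict_mem measurableSet_Ioi] with s hs
    exact hin s hs
  · rw [← setIntegral_congr_fun measurableSet_Ioi hin, integral_integral_swap hI]
    rw [setIntegral_congr_fun measurableSet_Ioi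
      (fun t ht => (laplace_one_sub_cos t x (lt_trans hε ht)).2), hG.2]
    rw [add_comm (ε ^ 2)]; ring

lemma int_one_sub_cos_half :
    IntegrableOn (fun s => (1 - Real.cos s) / s ^ 2) (Ioi 0) ∧
    ∫ s in Ioi (0:ℝ), (1 - Real.cos s) / s ^ 2 = π / 2 := by
  set F : ℝ → ℝ → ℝ := fun s t => t * (Real.exp (-t * s) * (1 - Real.cos (1 * s))) with hF
  have hFt : ∀ t ∈ Ioi (0:ℝ), ∫ s in Ioi (0:ℝ), F s t = (1 + t ^ 2)⁻¹ := by
    intro t ht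
    have ht' : 0 < t := ht
    simp only [hF]
    rw [integral_const_mul, (laplace_one_sub_cos t 1 ht).2]
    field_simp; ring
  have hI : Integrable (fun p : ℝ × ℝ => F p.1 p.2)
      ((volume.restrict (Ioi 0)).prod (volume.restrict (Ioi 0))) := by
    apply tonelli_int
    · apply Continuous.aestronglyMeasurable
      simp only [hF]; fun_prop
    · filter_upwards [ae_restrict_mem measurableSet_Ioi] with t ht
      refine Eventually.of_forall fun s => ?_
      have := Real.cos_le_one (1 * s)
      exact mul_nonneg (le_of_lt ht) (mul_nonneg (Real.exp_pos _).le (by linarith))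
    · filter_upwards [ae_restrict_mem measurableSet_Ioi] with t ht
      exact (laplace_one_sub_cos t 1 ht).1.const_mul t
    · refine (integrable_inv_one_add_sq.integrableOn).congr ?_
      filter_upwards [ae_restrict_mem measurableSet_Ioi] with t ht
      exact (hFt t ht).symm
  have hin : ∀ s ∈ Ioi (0:ℝ), ∫ t in Ioi 0, F s t = (1 - Real.cos s) / s ^ 2 := by
    intro s hs
    simp only [hF, one_mul, ← mul_assoc]
    rw [integral_mul_const, int_t_exp_Ioi s hs]; ring
  constructor
  · refine hI.integral_prod_left.congr ?_
    filter_upwards [ae_restrict_mem measurableSet_Ioi] with s hs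
    exact hin s hs
  · rw [← setIntegral_congr_fun measurableSet_Ioi hin, integral_integral_swap hI,
      setIntegral_congr_fun measurableSet_Ioi hFt, integral_Ioi_inv_one_add_sq]
    simp

lemma int_split {E : Type*} [NormedAddCommGroup E] [NormedSpace ℝ E] {f : ℝ → E}
    (h1 : IntegrableOn f (Ioi 0)) (h2 : IntegrableOn (fun x => f (-x)) (Ioi 0)) :
    Integrable f ∧ ∫ x, f x = (∫ x in Ioi (0:ℝ), f x) + ∫ x in Ioi (0:ℝ), f (-x) := by
  have h3 : IntegrableOn f (Iio 0) := by
    have := (Measure.measurePreserving_neg (volume : Measure ℝ)).integrableOn_comp_preimage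
      (Homeomorph.neg ℝ).measurableEmbedding (f := f) (s := Iio 0)
    rw [← this]
    have hs : (Neg.neg ⁻¹' (Iio (0:ℝ)) : Set ℝ) = Ioi 0 := by ext x; simp
    rw [hs]; exact h2
  have h4 : IntegrableOn f (Iic 0) := (integrableOn_Iic_iff_integrableOn_Iio (by simp)).2 h3
  have hu : Integrable f := by
    rw [← integrableOn_univ, ← Iic_union_Ioi (a := (0:ℝ))]
    exact h4.union h1
  refine ⟨hu, ?_⟩
  rw [← intervalIntegral.integral_Iic_add_Ioi h4 h1]
  have := integral_comp_neg_Ioi (0:ℝ) f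
  rw [this, neg_zero]; abel

lemma int_one_sub_cos :
    Integrable (fun s : ℝ => (1 - Real.cos s) / s ^ 2) ∧
    ∫ s : ℝ, (1 - Real.cos s) / s ^ 2 = π := by
  have h := int_one_sub_cos_half
  have he : ∀ s : ℝ, (1 - Real.cos (-s)) / (-s) ^ 2 = (1 - Real.cos s) / s ^ 2 := by
    intro s; simp
  have := int_split (f := fun s : ℝ => (1 - Real.cos s) / s ^ 2) h.1 (by simpa only [he] using h.1)
  simp only [he] at this
  refine ⟨this.1, ?_⟩
  rw [this.2, h.2]; ring

lemma int_one_sub_cos_scale (c : ℝ) :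
    Integrable (fun s : ℝ => (1 - Real.cos (c * s)) / s ^ 2) ∧
    ∫ s : ℝ, (1 - Real.cos (c * s)) / s ^ 2 = π * |c| := by
  rcases eq_or_ne c 0 with rfl | hc
  · simp
  have he : ∀ s : ℝ, (1 - Real.cos (c * s)) / s ^ 2 =
      c ^ 2 * ((fun r : ℝ => (1 - Real.cos r) / r ^ 2) (c * s)) := by
    intro s
    rcases eq_or_ne s 0 with rfl | hs
    · simp
    simp only; field_simp
  simp_rw [he]
  constructor
  · exact (int_one_sub_cos.1.comp_mul_left' hc).const_mul _
  · rw [integral_const_mul, Measure.integral_comp_mul_left (fun r : ℝ => (1 - Real.cos r) / r ^ 2),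
      int_one_sub_cos.2]
    rw [abs_inv, smul_eq_mul, ← sq_abs c]
    have : |c| ≠ 0 := by positivity
    field_simp

end Onofri


namespace Onofri

open Set Filter Topology
open scoped FourierTransform SchwartzMap

/-- Fourier representation of a test function. -/
lemma fourier_rep (v : ℝ → ℝ) (hv : ContDiff ℝ (⊤ : ℕ∞) v) (hvs : HasCompactSupport v) :
    ∃ φ : ℝ → ℂ, Continuous φ ∧ Integrable φ ∧ Integrable (fun ξ => ‖φ ξ‖ ^ 2) ∧
      Integrable (fun ξ => |ξ| * ‖φ ξ‖ ^ 2) ∧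
      (∀ x, (v x : ℂ) = ∫ ξ, φ ξ * Complex.exp (↑(2 * π * x * ξ) * Complex.I)) ∧
      (∀ h, ∫ x, (v (x + h) - v x) ^ 2 = ∫ ξ, ‖φ ξ‖ ^ 2 * (2 - 2 * Real.cos (2 * π * ξ * h))) := by
  have hc : HasCompactSupport (fun x => (v x : ℂ)) :=
    hvs.comp_left (g := fun t : ℝ => (t : ℂ)) (by simp)
  have hs : ContDiff ℝ (⊤ : ℕ∞) (fun x => (v x : ℂ)) := Complex.ofRealCLM.contDiff.comp hv
  set V : 𝓢(ℝ, ℂ) := hc.toSchwartzMap hs with hV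
  have hVx : ∀ x, V x = (v x : ℂ) := fun x => rfl
  set Φ : 𝓢(ℝ, ℂ) := 𝓕 V with hΦ
  obtain ⟨C, hC0, hC⟩ : ∃ C : ℝ, 0 ≤ C ∧ ∀ ξ, ‖Φ ξ‖ ≤ C := by
    obtain ⟨C, hC⟩ := Φ.decay 0 0
    refine ⟨C, hC.1.le, fun ξ => ?_⟩
    simpa using hC.2 ξ
  have hi : Integrable Φ := Φ.integrable
  have hi1 : Integrable (fun ξ : ℝ => |ξ| * ‖Φ ξ‖) := by
    simpa using Φ.integrable_pow_mul volume 1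
  have hmeas : AEStronglyMeasurable Φ volume := Φ.continuous.aestronglyMeasurable
  refine ⟨Φ, Φ.continuous, hi, ?_, ?_, ?_, ?_⟩
  · refine (hi.norm.const_mul C).mono' (by fun_prop) (Eventually.of_forall fun ξ => ?_)
    rw [Real.norm_of_nonneg (by positivity), sq]
    exact mul_le_mul_of_nonneg_right (hC ξ) (norm_nonneg _)
  · refine (hi1.const_mul C).mono' (by fun_prop) (Eventually.of_forall fun ξ => ?_)
    rw [Real.norm_of_nonneg (by positivity), sq]
    have := mul_le_mul_of_nonneg_right (hC ξ) (norm_nonneg (Φ ξ))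
    have := mul_le_mul_of_nonneg_left this (abs_nonneg ξ)
    linarith
  · intro x
    have h1 : 𝓕⁻ Φ = V := by rw [hΦ]; exact FourierTransform.fourierInv_fourier_eq V
    rw [← hVx, ← h1, SchwartzMap.fourierInv_coe, Real.fourierInv_eq']
    refine integral_congr_ae (Eventually.of_forall fun ξ => ?_)
    simp only [smul_eq_mul]
    rw [mul_comm]
    congr 3
    simp [inner]; ring
  · intro h
    have hvs' : HasCompactSupport (fun x => v (x + h)) :=
      hvs.comp_homeomorph (Homeomorph.addRight h)
    have hu : HasCompactSupport (fun x => v (x + h) - v x) := hvs'.sub hvs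
    have hus : ContDiff ℝ (⊤ : ℕ∞) (fun x => v (x + h) - v x) :=
      (hv.comp (contDiff_id.add contDiff_const)).sub hv
    have hc' : HasCompactSupport (fun x => ((v (x + h) - v x : ℝ) : ℂ)) :=
      hu.comp_left (g := fun t : ℝ => (t : ℂ)) (by simp)
    have hs' : ContDiff ℝ (⊤ : ℕ∞) (fun x => ((v (x + h) - v x : ℝ) : ℂ)) :=
      Complex.ofRealCLM.contDiff.comp hus
    set U : 𝓢(ℝ, ℂ) := hc'.toSchwartzMap hs' with hU
    have hUx : ∀ x, U x = ((v (x + h) - v x : ℝ) : ℂ) := fun x => rfl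
    have key := SchwartzMap.integral_norm_sq_fourier U
    have e1 : ∀ x, ‖U x‖ ^ 2 = (v (x + h) - v x) ^ 2 := by
      intro x; rw [hUx, Complex.norm_real, Real.norm_eq_abs, sq_abs]
    have hintg : ∀ ξ : ℝ, Integrable (fun x : ℝ => Complex.exp (↑(-2 * π * x * ξ) * Complex.I) * (v x : ℂ)) := by
      intro ξ
      have : Integrable (fun x : ℝ => (v x : ℂ)) := V.integrable
      refine this.bdd_mul (c := 1) (by fun_prop) (Eventually.of_forall fun x => ?_)
      rw [Complex.norm_exp_ofReal_mul_I]
    have e2 : ∀ ξ, (𝓕 U) ξ = (Complex.exp (↑(2 * π * ξ * h) * Complex.I) - 1) * Φ ξ := by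
      intro ξ
      rw [hΦ, SchwartzMap.fourier_coe, SchwartzMap.fourier_coe, Real.fourier_real_eq_integral_exp_smul,
        Real.fourier_real_eq_integral_exp_smul]
      simp only [smul_eq_mul, hUx, hVx]
      have hsh := (hintg ξ).comp_add_right h
      have := integral_add_right_eq_self (μ := (volume : Measure ℝ))
        (fun x : ℝ => Complex.exp (↑(-2 * π * x * ξ) * Complex.I) * (v x : ℂ)) h
      rw [sub_mul, one_mul]
      nth_rewrite 1 [← this]
      rw [← integral_const_mul, ← integral_sub (hsh.const_mul _) (hintg ξ)]
      refine integral_congr_ae (Eventually.of_forall fun x => ?_)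
      simp only
      rw [← mul_assoc, ← Complex.exp_add]
      have : (↑(2 * π * ξ * h) * Complex.I + ↑(-2 * π * (x + h) * ξ) * Complex.I : ℂ)
        = ↑(-2 * π * x * ξ) * Complex.I := by push_cast; ring
      rw [this]; push_cast; ring
    have e3 : ∀ t : ℝ, ‖Complex.exp (t * Complex.I) - 1‖ ^ 2 = 2 - 2 * Real.cos t := by
      intro t
      rw [Complex.exp_mul_I, ← Complex.ofReal_cos, ← Complex.ofReal_sin, Complex.sq_norm,
        Complex.normSq_apply]
      simp
      rw [Complex.cos_ofReal_re, Complex.sin_ofReal_re]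
      nlinarith [Real.sin_sq_add_cos_sq t]
    simp_rw [e1] at key
    rw [← key]
    refine integral_congr_ae (Eventually.of_forall fun ξ => ?_)
    simp only
    rw [e2, norm_mul, mul_pow, e3]; ring

/-- The Gagliardo form in Fourier variables. -/
lemma gagliardo_fourier (v : ℝ → ℝ) (hv : ContDiff ℝ (⊤ : ℕ∞) v) (hvs : HasCompactSupport v) :
    ∃ φ : ℝ → ℂ, Continuous φ ∧ Integrable φ ∧ 
      Integrable (fun ξ => |ξ| * ‖φ ξ‖ ^ 2) ∧
      (∀ x, (v x : ℂ) = ∫ ξ, φ ξ * Complex.exp (↑(2 * π * x * ξ) * Complex.I)) ∧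
      (∫ x : ℝ, ∫ y : ℝ, (v x - v y) ^ 2 / (x - y) ^ 2) = 4 * π ^ 2 * ∫ ξ, |ξ| * ‖φ ξ‖ ^ 2 := by
  obtain ⟨φ, h1, h2, h3, h4, h5, h6⟩ := fourier_rep v hv hvs
  refine ⟨φ, h1, h2, h4, h5, ?_⟩
  have hs : ∀ x, ∫ y, (v x - v y) ^ 2 / (x - y) ^ 2 = ∫ h, (v (x + h) - v x) ^ 2 / h ^ 2 := by
    intro x
    rw [← integral_add_left_eq_self (fun y => (v x - v y) ^ 2 / (x - y) ^ 2) x]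
    refine integral_congr_ae (Eventually.of_forall fun h => ?_)
    simp only
    congr 1 <;> ring
  simp_rw [hs]
  have hc : ∀ ξ : ℝ, Integrable (fun h : ℝ => ‖φ ξ‖ ^ 2 * (2 - 2 * Real.cos (2 * π * ξ * h)) / h ^ 2) ∧
      ∫ h : ℝ, ‖φ ξ‖ ^ 2 * (2 - 2 * Real.cos (2 * π * ξ * h)) / h ^ 2 =
        4 * π ^ 2 * (|ξ| * ‖φ ξ‖ ^ 2) := by
    intro ξ
    have := int_one_sub_cos_scale (2 * π * ξ)
    have he : ∀ h : ℝ, ‖φ ξ‖ ^ 2 * (2 - 2 * Real.cos (2 * π * ξ * h)) / h ^ 2 =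
      (2 * ‖φ ξ‖ ^ 2) * ((1 - Real.cos (2 * π * ξ * h)) / h ^ 2) := fun h => by ring
    simp_rw [he]
    refine ⟨this.1.const_mul _, ?_⟩
    rw [integral_const_mul, this.2, abs_mul, abs_of_pos (by positivity : 0 < 2 * π)]; ring
  have hF : Integrable (fun p : ℝ × ℝ =>
      ‖φ p.2‖ ^ 2 * (2 - 2 * Real.cos (2 * π * p.2 * p.1)) / p.1 ^ 2) (volume.prod volume) := by
    refine tonelli_int (F := fun h ξ : ℝ => ‖φ ξ‖ ^ 2 * (2 - 2 * Real.cos (2 * π * ξ * h)) / h ^ 2)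
      ?_ ?_ ?_ ?_
    · refine Measurable.aestronglyMeasurable ?_
      have := h1.measurable
      fun_prop
    · refine Eventually.of_forall fun ξ => Eventually.of_forall fun h => ?_
      have := Real.cos_le_one (2 * π * ξ * h)
      have : 0 ≤ 2 - 2 * Real.cos (2 * π * ξ * h) := by linarith
      positivity
    · exact Eventually.of_forall fun ξ => (hc ξ).1
    · simp_rw [fun ξ => (hc ξ).2]
      exact h4.const_mul _
  have hx : ∀ h : ℝ, ∫ x, (v (x + h) - v x) ^ 2 / h ^ 2 =
      ∫ ξ, ‖φ ξ‖ ^ 2 * (2 - 2 * Real.cos (2 * π * ξ * h)) / h ^ 2 := by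
    intro h
    rw [integral_div, integral_div, h6]
  have hcont := hv.continuous
  have hG : Integrable (fun p : ℝ × ℝ => (v (p.1 + p.2) - v p.1) ^ 2 / p.2 ^ 2)
      (volume.prod volume) := by
    refine tonelli_int (F := fun x h : ℝ => (v (x + h) - v x) ^ 2 / h ^ 2) ?_ ?_ ?_ ?_
    · refine Measurable.aestronglyMeasurable ?_
      have := hcont.measurable
      fun_prop
    · exact Eventually.of_forall fun ξ => Eventually.of_forall fun h => by positivity
    · refine Eventually.of_forall fun h => Integrable.div_const ?_ _
      have hu : HasCompactSupport (fun x => v (x + h) - v x) :=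
        (hvs.comp_homeomorph (Homeomorph.addRight h)).sub hvs
      exact Continuous.integrable_of_hasCompactSupport (by fun_prop)
        (hu.comp_left (g := fun t : ℝ => t ^ 2) (by simp))
    · simp_rw [hx]
      exact hF.integral_prod_left
  rw [integral_integral_swap hG]
  simp_rw [hx]
  rw [integral_integral_swap hF]
  simp_rw [fun ξ => (hc ξ).2]
  rw [integral_const_mul]

end Onofri


namespace Onofri

open Set Filter Topology

lemma integral_add_sub' {α : Type*} [MeasurableSpace α] {μ : Measure α} {f g h : α → ℝ}
    (hf : Integrable f μ) (hg : Integrable g μ) (hh : Integrable h μ) :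
    ∫ x, (f x + g x - h x) ∂μ = (∫ x, f x ∂μ) + (∫ x, g x ∂μ) - ∫ x, h x ∂μ := by
  have h1 : Integrable (fun x => f x + g x) μ := hf.add hg
  rw [integral_sub h1 hh, integral_add hf hg]

/-- Characteristic function of the density `σ`. -/
noncomputable def chf (σ : ℝ → ℝ) (s : ℝ) : ℂ := ∫ x, (σ x : ℂ) * Complex.exp (↑(x * s) * Complex.I)

lemma chf_integrable {σ : ℝ → ℝ} (h : Integrable σ) (s : ℝ) :
    Integrable (fun x => (σ x : ℂ) * Complex.exp (↑(x * s) * Complex.I)) := by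
  refine h.ofReal.mul_bdd (c := 1) (by fun_prop) (Eventually.of_forall fun x => ?_)
  rw [Complex.norm_exp_ofReal_mul_I]

lemma chf_continuous {σ : ℝ → ℝ} (h : Integrable σ) : Continuous (chf σ) := by
  unfold chf
  refine continuous_of_dominated (bound := fun x => ‖σ x‖) ?_ ?_ h.norm ?_
  · intro s; exact (chf_integrable h s).aestronglyMeasurable
  · intro s; refine Eventually.of_forall fun x => ?_
    rw [norm_mul, Complex.norm_exp_ofReal_mul_I]; simp
  · refine Eventually.of_forall fun x => ?_
    fun_prop

lemma chf_norm_le {σ : ℝ → ℝ} (s : ℝ) : ‖chf σ s‖ ≤ ∫ x, ‖σ x‖ := by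
  unfold chf
  refine (norm_integral_le_integral_norm _).trans (le_of_eq ?_)
  congr 1; ext x
  rw [norm_mul, Complex.norm_exp_ofReal_mul_I]; simp

lemma chf_normSq {σ : ℝ → ℝ} (h : Integrable σ) (s : ℝ) :
    ‖chf σ s‖ ^ 2 = ∫ p : ℝ × ℝ, σ p.1 * σ p.2 * Real.cos ((p.1 - p.2) * s) := by
  have hi := chf_integrable h s
  have hc : Integrable (fun x => σ x * Real.cos (x * s)) := by
    refine h.mul_bdd (c := 1) (by fun_prop) (Eventually.of_forall fun x => ?_)
    exact Real.abs_cos_le_one _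
  have hsn : Integrable (fun x => σ x * Real.sin (x * s)) := by
    refine h.mul_bdd (c := 1) (by fun_prop) (Eventually.of_forall fun x => ?_)
    exact Real.abs_sin_le_one _
  have hre : (chf σ s).re = ∫ x, σ x * Real.cos (x * s) := by
    have := integral_re hi
    simp only [RCLike.re_to_complex] at this
    unfold chf
    rw [← this]
    congr 1; ext x
    rw [Complex.re_ofReal_mul, Complex.exp_ofReal_mul_I_re]
  have him : (chf σ s).im = ∫ x, σ x * Real.sin (x * s) := by
    have := integral_im hi
    simp only [RCLike.im_to_complex] at this
    unfold chf
    rw [← this]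
    congr 1; ext x
    rw [Complex.im_ofReal_mul, Complex.exp_ofReal_mul_I_im]
  rw [Complex.sq_norm, Complex.normSq_apply, hre, him]
  rw [← integral_prod_mul, ← integral_prod_mul, ← integral_add (hc.mul_prod hc) (hsn.mul_prod hsn)]
  congr 1; ext p
  rw [sub_mul, Real.cos_sub]; ring

lemma ell_bound (ε x : ℝ) (hε : 0 < ε) :
    0 ≤ (1/2) * Real.log (x ^ 2 + ε ^ 2) - Real.log ε ∧
    (1/2) * Real.log (x ^ 2 + ε ^ 2) - Real.log ε ≤
      (1/2) * Real.log (1 + x ^ 2) + (1/2) * Real.log (1 + 1 / ε ^ 2) := by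
  have h : (1/2) * Real.log (x ^ 2 + ε ^ 2) - Real.log ε = (1/2) * Real.log (1 + x ^ 2 / ε ^ 2) := by
    have : 1 + x ^ 2 / ε ^ 2 = (x ^ 2 + ε ^ 2) / ε ^ 2 := by field_simp; ring
    rw [this, Real.log_div (by positivity) (by positivity), Real.log_pow]; push_cast; ring
  rw [h]
  constructor
  · have : 0 ≤ x ^ 2 / ε ^ 2 := by positivity
    have := Real.log_nonneg (show 1 ≤ 1 + x ^ 2 / ε ^ 2 by linarith)
    positivity
  · rw [← mul_add, ← Real.log_mul (by positivity) (by positivity)]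
    refine mul_le_mul_of_nonneg_left (Real.log_le_log (by positivity) ?_) (by norm_num)
    have : (1 + x ^ 2) * (1 + 1 / ε ^ 2) = 1 + x ^ 2 / ε ^ 2 + (x ^ 2 + 1 / ε ^ 2) := by
      field_simp; ring
    rw [this]
    have : 0 ≤ x ^ 2 + 1 / ε ^ 2 := by positivity
    linarith

lemma sig_energy {σ : ℝ → ℝ} (h : Integrable σ) (h0 : ∫ x, σ x = 0)
    (hl : Integrable (fun x => σ x * Real.log (1 + x ^ 2))) (ε : ℝ) (hε : 0 < ε) :
    IntegrableOn (fun s => ‖chf σ s‖ ^ 2 * (Real.exp (-ε * s) / s)) (Ioi 0) ∧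
    ∫ s in Ioi (0:ℝ), ‖chf σ s‖ ^ 2 * (Real.exp (-ε * s) / s) =
      - ∫ p : ℝ × ℝ, σ p.1 * σ p.2 * ((1/2) * Real.log ((p.1 - p.2) ^ 2 + ε ^ 2)) := by
  set ℓ : ℝ → ℝ := fun x => (1/2) * Real.log (x ^ 2 + ε ^ 2) - Real.log ε with hℓ
  have hℓm : Measurable ℓ := by simp only [hℓ]; fun_prop
  have hσℓ : Integrable (fun x => σ x * ℓ x) := by
    refine ((hl.norm.const_mul (1/2)).add (h.norm.const_mul ((1/2) * Real.log (1 + 1 / ε ^ 2)))).mono'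
      (h.aestronglyMeasurable.mul hℓm.aestronglyMeasurable) (Eventually.of_forall fun x => ?_)
    have hb := ell_bound ε x hε
    have h1 : 0 ≤ Real.log (1 + x ^ 2) := Real.log_nonneg (by nlinarith)
    simp only [Pi.add_apply, norm_mul, Real.norm_eq_abs]
    rw [abs_of_nonneg h1, abs_of_nonneg hb.1]
    have := mul_le_mul_of_nonneg_left hb.2 (abs_nonneg (σ x))
    linarith
  set E : ℝ → ℝ := fun s => Real.exp (-ε * s) / s with hE
  have hEpos : ∀ s ∈ Ioi (0:ℝ), 0 ≤ E s := by
    intro s hs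
    have hs' : 0 < s := hs
    simp only [hE]; positivity
  set μ : Measure ℝ := volume.restrict (Ioi (0:ℝ)) with hμ
  set ν : Measure (ℝ × ℝ) := volume with hν
  have hσm : AEStronglyMeasurable σ volume := h.aestronglyMeasurable
  have hσ1 : AEStronglyMeasurable (fun p : ℝ × ℝ => σ p.1) ν := hσm.comp_fst
  have hσ2 : AEStronglyMeasurable (fun p : ℝ × ℝ => σ p.2) ν := hσm.comp_snd
  have hσσ : AEStronglyMeasurable (fun q : ℝ × (ℝ × ℝ) => σ q.2.1 * σ q.2.2) (μ.prod ν) :=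
    (hσ1.mul hσ2).comp_snd
  have hdom : Integrable (fun q : ℝ × (ℝ × ℝ) => (|σ q.2.1 * σ q.2.2|) *
      (((1 - Real.cos (q.2.1 * q.1)) * E q.1) + ((1 - Real.cos (q.2.2 * q.1)) * E q.1))) (μ.prod ν) := by
    refine tonelli_int (F := fun s (p : ℝ × ℝ) => (|σ p.1 * σ p.2|) *
      (((1 - Real.cos (p.1 * s)) * E s) + ((1 - Real.cos (p.2 * s)) * E s))) ?_ ?_ ?_ ?_
    · refine hσσ.norm.mul (Measurable.aestronglyMeasurable ?_)
      simp only [hE]; fun_prop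
    · refine Eventually.of_forall fun p => ?_
      filter_upwards [ae_restrict_mem measurableSet_Ioi] with s hs
      have h1 := Real.cos_le_one (p.1 * s)
      have h2 := Real.cos_le_one (p.2 * s)
      have h3 := hEpos s hs
      have := mul_nonneg (sub_nonneg.2 h1) h3
      have := mul_nonneg (sub_nonneg.2 h2) h3
      positivity
    · exact Eventually.of_forall fun p =>
        (((frullani ε p.1 hε).1.add (frullani ε p.2 hε).1).const_mul _)
    · have : ∀ p : ℝ × ℝ, ∫ s, (|σ p.1 * σ p.2|) *
          (((1 - Real.cos (p.1 * s)) * E s) + ((1 - Real.cos (p.2 * s)) * E s)) ∂μ =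
          |σ p.1 * ℓ p.1| * |σ p.2| + |σ p.1| * |σ p.2 * ℓ p.2| := by
        intro p
        rw [integral_const_mul, integral_add (frullani ε p.1 hε).1 (frullani ε p.2 hε).1,
          (frullani ε p.1 hε).2, (frullani ε p.2 hε).2]
        simp only [abs_mul]
        rw [abs_of_nonneg (ell_bound ε p.1 hε).1, abs_of_nonneg (ell_bound ε p.2 hε).1]
        ring
      simp_rw [this]
      exact (hσℓ.abs.mul_prod h.abs).add (h.abs.mul_prod hσℓ.abs)
  set k : ℝ → ℝ × ℝ → ℝ := fun s p => (1 - Real.cos (p.1 * s)) * E s + (1 - Real.cos (p.2 * s)) * E s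
    - (1 - Real.cos ((p.1 - p.2) * s)) * E s with hk
  have hintg : Integrable (fun q : ℝ × (ℝ × ℝ) => σ q.2.1 * σ q.2.2 * k q.1 q.2) (μ.prod ν) := by
    refine hdom.mono' (hσσ.mul (Measurable.aestronglyMeasurable ?_)) ?_
    · simp only [hk, hE]; fun_prop
    · have : ∀ᵐ q ∂(μ.prod ν), q.1 ∈ Ioi (0:ℝ) := by
        have h1 : ∀ᵐ s ∂μ, s ∈ Ioi (0:ℝ) := ae_restrict_mem measurableSet_Ioi
        exact Measure.quasiMeasurePreserving_fst.ae h1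
      filter_upwards [this] with q hq
      rw [norm_mul, Real.norm_eq_abs]
      refine mul_le_mul_of_nonneg_left ?_ (abs_nonneg _)
      have h3 := hEpos q.1 hq
      simp only [hk]
      rw [← add_mul, ← sub_mul, norm_mul, Real.norm_of_nonneg h3]
      refine mul_le_mul_of_nonneg_right ?_ h3
      rw [sub_mul, Real.cos_sub, Real.norm_eq_abs, abs_le]
      have e1 := Real.sin_sq_add_cos_sq (q.2.1 * q.1)
      have e2 := Real.sin_sq_add_cos_sq (q.2.2 * q.1)
      set c1 := Real.cos (q.2.1 * q.1)
      set c2 := Real.cos (q.2.2 * q.1)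
      set s1 := Real.sin (q.2.1 * q.1)
      set s2 := Real.sin (q.2.2 * q.1)
      constructor
      · nlinarith [sq_nonneg (s1 + s2), sq_nonneg ((1 - c1) + (1 - c2))]
      · nlinarith [sq_nonneg (s1 - s2), sq_nonneg ((1 - c1) - (1 - c2))]
  have hcosint : ∀ g : ℝ × ℝ → ℝ, Continuous g →
      Integrable (fun p : ℝ × ℝ => σ p.1 * σ p.2 * Real.cos (g p)) ν := by
    intro g hg
    refine (h.mul_prod h).mul_bdd (c := 1) (by fun_prop) (Eventually.of_forall fun x => ?_)
    exact Real.abs_cos_le_one _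
  have hinner1 : ∀ s, ∫ p, σ p.1 * σ p.2 * k s p ∂ν = ‖chf σ s‖ ^ 2 * E s := by
    intro s
    have e : ∀ p : ℝ × ℝ, σ p.1 * σ p.2 * k s p =
      (σ p.1 * σ p.2 * Real.cos ((p.1 - p.2) * s)
        + (σ p.1 * (1 - Real.cos (p.1 * s)) * σ p.2 - σ p.1 * (σ p.2 * Real.cos (p.2 * s)))) * E s := by
      intro p; simp only [hk]; ring
    have hcs : Integrable (fun x => σ x * Real.cos (x * s)) := by
      refine h.mul_bdd (c := 1) (by fun_prop) (Eventually.of_forall fun x => ?_)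
      exact Real.abs_cos_le_one _
    have hcs' : Integrable (fun x => σ x * (1 - Real.cos (x * s))) := by
      have := h.sub hcs
      refine this.congr (Eventually.of_forall fun x => ?_)
      simp; ring
    simp_rw [e]
    rw [integral_mul_const, integral_add (hcosint _ (by fun_prop)), ← chf_normSq h]
    · rw [integral_sub, hν, Measure.volume_eq_prod]
      · rw [integral_prod_mul (fun x => σ x * (1 - Real.cos (x * s))) σ,
          integral_prod_mul σ (fun x => σ x * Real.cos (x * s)), h0]; ring
      · exact hcs'.mul_prod h
      · exact h.mul_prod hcs
    · exact (hcs'.mul_prod h).sub (h.mul_prod hcs)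
  have hinner2 : ∀ p : ℝ × ℝ, ∫ s, σ p.1 * σ p.2 * k s p ∂μ =
      σ p.1 * ℓ p.1 * σ p.2 + σ p.1 * (σ p.2 * ℓ p.2) - σ p.1 * σ p.2 * ℓ (p.1 - p.2) := by
    intro p
    have i1 := frullani ε p.1 hε
    have i2 := frullani ε p.2 hε
    have i3 := frullani ε (p.1 - p.2) hε
    rw [integral_const_mul]
    simp only [hk]
    have := integral_add_sub' i1.1 i2.1 i3.1
    rw [i1.2, i2.2, i3.2] at this
    rw [this]
    simp only [hℓ]; ring
  constructor
  · refine hintg.integral_prod_left.congr (Eventually.of_forall fun s => ?_)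
    exact hinner1 s
  · have hsw := integral_integral_swap (f := fun s p => σ p.1 * σ p.2 * k s p) hintg
    simp only [hinner1] at hsw
    rw [hsw]
    have hI := hintg.integral_prod_right
    simp only [hinner2] at hI ⊢
    have j1 : Integrable (fun p : ℝ × ℝ => σ p.1 * ℓ p.1 * σ p.2) ν := hσℓ.mul_prod h
    have j2 : Integrable (fun p : ℝ × ℝ => σ p.1 * (σ p.2 * ℓ p.2)) ν := h.mul_prod hσℓ
    have j3 : Integrable (fun p : ℝ × ℝ => σ p.1 * σ p.2 * ℓ (p.1 - p.2)) ν := by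
      refine ((j1.add j2).sub hI).congr (Eventually.of_forall fun p => ?_)
      simp
    have j4 : Integrable (fun p : ℝ × ℝ => σ p.1 * σ p.2) ν := h.mul_prod h
    have z : ∫ p : ℝ × ℝ, σ p.1 * σ p.2 ∂ν = 0 := by
      rw [hν, Measure.volume_eq_prod, integral_prod_mul σ σ, h0]; ring
    rw [integral_add_sub' j1 j2 j3]
    have z1 : ∫ p : ℝ × ℝ, σ p.1 * ℓ p.1 * σ p.2 ∂ν = 0 := by
      rw [hν, Measure.volume_eq_prod, integral_prod_mul (fun x => σ x * ℓ x) σ, h0]; ring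
    have z2 : ∫ p : ℝ × ℝ, σ p.1 * (σ p.2 * ℓ p.2) ∂ν = 0 := by
      rw [hν, Measure.volume_eq_prod, integral_prod_mul σ (fun x => σ x * ℓ x), h0]; ring
    rw [z1, z2]
    have : ∀ p : ℝ × ℝ, σ p.1 * σ p.2 * ((1/2) * Real.log ((p.1 - p.2) ^ 2 + ε ^ 2)) =
      σ p.1 * σ p.2 * ℓ (p.1 - p.2) + (σ p.1 * σ p.2) * Real.log ε := by
      intro p; simp only [hℓ]; ring
    simp_rw [this]
    rw [integral_add j3 (j4.mul_const _), integral_mul_const, z]; ring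

end Onofri


namespace Onofri

open Set Filter Topology

lemma chf_neg {σ : ℝ → ℝ} (s : ℝ) : ‖chf σ (-s)‖ = ‖chf σ s‖ := by
  have : chf σ (-s) = (starRingEnd ℂ) (chf σ s) := by
    unfold chf
    rw [← integral_conj]
    congr 1; ext x
    rw [map_mul, Complex.conj_ofReal, ← Complex.exp_conj, map_mul, Complex.conj_ofReal, Complex.conj_I]
    push_cast; ring_nf
  rw [this, Complex.norm_conj]

/-- Weak duality between the `H^{1/2}` seminorm and the logarithmic energy. -/
theorem factA (a : ℝ) (ha : 0 < a) (v : ℝ → ℝ) (hv : ContDiff ℝ (⊤ : ℕ∞) v)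
    (hvs : HasCompactSupport v) (σ : ℝ → ℝ) (h : Integrable σ) (h0 : ∫ x, σ x = 0)
    (hl : Integrable (fun x => σ x * Real.log (1 + x ^ 2)))
    (hL : Integrable (fun p : ℝ × ℝ => σ p.1 * σ p.2 * Real.log |p.1 - p.2|)) :
    ∫ x, v x * σ x ≤ (1 / (8 * π ^ 2 * a)) * (∫ x : ℝ, ∫ y : ℝ, (v x - v y) ^ 2 / (x - y) ^ 2)
      - a * ∫ p : ℝ × ℝ, σ p.1 * σ p.2 * Real.log |p.1 - p.2| := by
  obtain ⟨φ, hφc, hφi, hφ2, hrep, hD⟩ := gagliardo_fourier v hv hvs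
  rw [hD]
  have hcc := chf_continuous h
  have hpar : ((∫ x, v x * σ x : ℝ) : ℂ) = ∫ ξ, φ ξ * chf σ (2 * π * ξ) := by
    have hp : Integrable (fun p : ℝ × ℝ => (σ p.1 : ℂ) * (φ p.2 *
        Complex.exp (↑(2 * π * p.1 * p.2) * Complex.I))) (volume.prod volume) := by
      have := ((h.ofReal (𝕜 := ℂ)).mul_prod hφi).mul_bdd (c := 1)
        (g := fun p : ℝ × ℝ => Complex.exp (↑(2 * π * p.1 * p.2) * Complex.I))
        (by fun_prop) (Eventually.of_forall fun p => by rw [Complex.norm_exp_ofReal_mul_I])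
      refine this.congr (Eventually.of_forall fun p => ?_)
      simp only; rw [mul_assoc]; rfl
    have hsw := integral_integral_swap (f := fun x ξ => (σ x : ℂ) * (φ ξ *
        Complex.exp (↑(2 * π * x * ξ) * Complex.I))) hp
    rw [← integral_complex_ofReal]
    have e1 : ∀ x, ((v x * σ x : ℝ) : ℂ) = ∫ ξ, (σ x : ℂ) * (φ ξ *
        Complex.exp (↑(2 * π * x * ξ) * Complex.I)) := by
      intro x; rw [integral_const_mul, ← hrep]; push_cast; ring
    simp_rw [e1]
    rw [hsw]
    congr 1; ext ξ
    unfold chf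
    rw [← integral_const_mul]
    congr 1; ext x
    have : (2 * π * x * ξ : ℝ) = x * (2 * π * ξ) := by ring
    rw [this]; ring
  set M := ∫ x, ‖σ x‖ with hM
  have hM0 : 0 ≤ M := integral_nonneg fun x => norm_nonneg _
  have hreg : ∀ ε : ℝ, 0 < ε →
      ‖∫ ξ, φ ξ * chf σ (2 * π * ξ) * (Real.exp (-(π * ε * |ξ|)) : ℝ)‖ ≤
      (1 / (2 * a)) * (∫ ξ, |ξ| * ‖φ ξ‖ ^ 2) -
        a * ∫ p : ℝ × ℝ, σ p.1 * σ p.2 * ((1/2) * Real.log ((p.1 - p.2) ^ 2 + ε ^ 2)) := by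
    intro ε hε
    have hen := sig_energy h h0 hl ε hε
    set K : ℝ → ℝ := fun ξ => ‖chf σ (2 * π * ξ)‖ ^ 2 * (Real.exp (-(2 * π * ε * |ξ|)) / |ξ|) with hK
    have hKpos : IntegrableOn K (Ioi 0) ∧ ∫ ξ in Ioi (0:ℝ), K ξ =
        ∫ s in Ioi (0:ℝ), ‖chf σ s‖ ^ 2 * (Real.exp (-ε * s) / s) := by
      have e : ∀ ξ ∈ Ioi (0:ℝ), K ξ = (2 * π) *
          (fun s => ‖chf σ s‖ ^ 2 * (Real.exp (-ε * s) / s)) (2 * π * ξ) := by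
        intro ξ hξ
        have hξ' : 0 < ξ := hξ
        simp only [hK]
        rw [abs_of_pos hξ']
        have : -(2 * π * ε * ξ) = -ε * (2 * π * ξ) := by ring
        rw [this]; field_simp
      have h2π : (0:ℝ) < 2 * π := by positivity
      constructor
      · rw [integrableOn_congr_fun e measurableSet_Ioi]
        refine Integrable.const_mul ?_ _
        have := (integrableOn_Ioi_comp_mul_left_iff
          (fun s => ‖chf σ s‖ ^ 2 * (Real.exp (-ε * s) / s)) 0 h2π).2 (by simpa using hen.1)
        exact this
      · have hc := integral_comp_mul_left_Ioi
          (fun s => ‖chf σ s‖ ^ 2 * (Real.exp (-ε * s) / s)) 0 h2π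
        rw [mul_zero, smul_eq_mul] at hc
        rw [setIntegral_congr_fun measurableSet_Ioi e, integral_const_mul, hc]
        field_simp
    have hKev : ∀ ξ, K (-ξ) = K ξ := by
      intro ξ
      simp only [hK]
      rw [abs_neg, mul_neg, chf_neg]
    have hKi := int_split hKpos.1 (by simpa only [hKev] using hKpos.1)
    simp only [hKev] at hKi
    have hb : ∀ᵐ ξ : ℝ, ‖φ ξ * chf σ (2 * π * ξ) * (Real.exp (-(π * ε * |ξ|)) : ℝ)‖ ≤
        (1 / (2 * a)) * (|ξ| * ‖φ ξ‖ ^ 2) + (a / 2) * K ξ := by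
      have : ∀ᵐ ξ : ℝ, ξ ≠ 0 := by
        simp [ae_iff]
      filter_upwards [this] with ξ hξ
      have hξ' : 0 < |ξ| := abs_pos.2 hξ
      rw [norm_mul, norm_mul, Complex.norm_real, Real.norm_of_nonneg (Real.exp_pos _).le]
      simp only [hK]
      have he : Real.exp (-(2 * π * ε * |ξ|)) = Real.exp (-(π * ε * |ξ|)) ^ 2 := by
        rw [← Real.exp_nat_mul]; congr 1; push_cast; ring
      rw [he]
      set P := ‖φ ξ‖
      set Q := ‖chf σ (2 * π * ξ)‖
      set E := Real.exp (-(π * ε * |ξ|))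
      have : (1 / (2 * a)) * (|ξ| * P ^ 2) + (a / 2) * (Q ^ 2 * (E ^ 2 / |ξ|)) - P * Q * E =
        (|ξ| * P - a * (Q * E)) ^ 2 / (2 * a * |ξ|) := by
        field_simp; ring
      have h2 : 0 ≤ (|ξ| * P - a * (Q * E)) ^ 2 / (2 * a * |ξ|) := by positivity
      linarith
    have hbi : Integrable (fun ξ => (1 / (2 * a)) * (|ξ| * ‖φ ξ‖ ^ 2) + (a / 2) * K ξ) :=
      (hφ2.const_mul _).add (hKi.1.const_mul _)
    refine (norm_integral_le_of_norm_le hbi hb).trans (le_of_eq ?_)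
    rw [integral_add (hφ2.const_mul _) (hKi.1.const_mul _), integral_const_mul, integral_const_mul,
      hKi.2, hKpos.2, hen.2]
    ring
  have hpi : Integrable (fun ξ => φ ξ * chf σ (2 * π * ξ)) := by
    refine hφi.mul_bdd (c := M) (by fun_prop) (Eventually.of_forall fun ξ => chf_norm_le _)
  have hlim1 : Tendsto (fun ε : ℝ => ∫ ξ, φ ξ * chf σ (2 * π * ξ) * (Real.exp (-(π * ε * |ξ|)) : ℝ))
      (𝓝[>] 0) (𝓝 (∫ ξ, φ ξ * chf σ (2 * π * ξ))) := by
    refine tendsto_integral_filter_of_dominated_convergence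
      (fun ξ => ‖φ ξ * chf σ (2 * π * ξ)‖) ?_ ?_ hpi.norm ?_
    · refine Eventually.of_forall fun ε => ?_
      fun_prop
    · filter_upwards [self_mem_nhdsWithin] with ε hε
      refine Eventually.of_forall fun ξ => ?_
      have hε' : 0 < ε := hε
      rw [norm_mul _ ((Real.exp _ : ℝ) : ℂ), Complex.norm_real, Real.norm_of_nonneg (Real.exp_pos _).le]
      refine mul_le_of_le_one_right (norm_nonneg _) ?_
      rw [Real.exp_le_one_iff]
      have : 0 ≤ π * ε * |ξ| := by positivity
      linarith
    · refine Eventually.of_forall fun ξ => ?_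
      have : Continuous (fun ε : ℝ => φ ξ * chf σ (2 * π * ξ) * ((Real.exp (-(π * ε * |ξ|)) : ℝ) : ℂ)) := by
        fun_prop
      have := this.tendsto 0
      simp only [mul_zero, zero_mul, neg_zero, Real.exp_zero, Complex.ofReal_one, mul_one] at this
      exact this.mono_left nhdsWithin_le_nhds
  have hdiag : ∀ᵐ p : ℝ × ℝ, p.1 ≠ p.2 := by
    rw [Measure.volume_eq_prod, Measure.ae_prod_iff_ae_ae]
    · refine Eventually.of_forall fun x => ?_
      have : ∀ᵐ y : ℝ, y ≠ x := by simp [ae_iff]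
      filter_upwards [this] with y hy using hy.symm
    · exact (measurableSet_eq_fun measurable_fst measurable_snd).compl
  have hlp : Integrable (fun p : ℝ × ℝ => σ p.1 * σ p.2 * (Real.log 2 + Real.log (1 + p.1 ^ 2) +
      Real.log (1 + p.2 ^ 2))) := by
    have i1 : Integrable (fun p : ℝ × ℝ => (σ p.1 * Real.log (1 + p.1 ^ 2)) * σ p.2) := hl.mul_prod h
    have i2 : Integrable (fun p : ℝ × ℝ => σ p.1 * (σ p.2 * Real.log (1 + p.2 ^ 2))) := h.mul_prod hl
    have i3 : Integrable (fun p : ℝ × ℝ => σ p.1 * σ p.2) := h.mul_prod h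
    refine (((i3.mul_const (Real.log 2)).add i1).add i2).congr (Eventually.of_forall fun p => ?_)
    simp; ring
  have hlim2 : Tendsto (fun ε : ℝ => ∫ p : ℝ × ℝ,
      σ p.1 * σ p.2 * ((1/2) * Real.log ((p.1 - p.2) ^ 2 + ε ^ 2)))
      (𝓝[>] 0) (𝓝 (∫ p : ℝ × ℝ, σ p.1 * σ p.2 * Real.log |p.1 - p.2|)) := by
    refine tendsto_integral_filter_of_dominated_convergence
      (fun p => ‖σ p.1 * σ p.2 * Real.log |p.1 - p.2|‖ +
        ‖σ p.1 * σ p.2 * (Real.log 2 + Real.log (1 + p.1 ^ 2) + Real.log (1 + p.2 ^ 2))‖)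
      ?_ ?_ (hL.norm.add hlp.norm) ?_
    · refine Eventually.of_forall fun ε => ?_
      have i3 : Integrable (fun p : ℝ × ℝ => σ p.1 * σ p.2) := h.mul_prod h
      refine i3.aestronglyMeasurable.mul (Measurable.aestronglyMeasurable (by fun_prop))
    · filter_upwards [Ioo_mem_nhdsGT (show (0:ℝ) < 1 by norm_num)] with ε hε
      filter_upwards [hdiag] with p hp
      rw [norm_mul, norm_mul _ (Real.log |p.1 - p.2|), norm_mul _ (Real.log 2 + _ + _), ← mul_add]
      refine mul_le_mul_of_nonneg_left ?_ (norm_nonneg _)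
      have hd : p.1 - p.2 ≠ 0 := sub_ne_zero.2 hp
      set d := p.1 - p.2 with hd'
      have hd2 : 0 < d ^ 2 := by positivity
      have hε2 : ε ^ 2 ≤ 1 := by nlinarith [hε.1, hε.2]
      have l1 : Real.log (d ^ 2) ≤ Real.log (d ^ 2 + ε ^ 2) :=
        Real.log_le_log hd2 (by nlinarith [sq_nonneg ε])
      have l2 : Real.log (d ^ 2 + ε ^ 2) ≤ Real.log (2 * (1 + p.1 ^ 2) * (1 + p.2 ^ 2)) := by
        refine Real.log_le_log (by positivity) ?_
        nlinarith [sq_nonneg (p.1 + p.2), sq_nonneg (p.1 * p.2)]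
      rw [Real.log_mul (by positivity) (by positivity), Real.log_mul (by positivity) (by positivity)] at l2
      have l3 : Real.log (d ^ 2) = 2 * Real.log |d| := by
        rw [← sq_abs, Real.log_pow]; push_cast; ring
      have n1 : 0 ≤ Real.log 2 := Real.log_nonneg (by norm_num)
      have n2 : 0 ≤ Real.log (1 + p.1 ^ 2) := Real.log_nonneg (by nlinarith [sq_nonneg p.1])
      have n3 : 0 ≤ Real.log (1 + p.2 ^ 2) := Real.log_nonneg (by nlinarith [sq_nonneg p.2])
      rw [Real.norm_eq_abs, Real.norm_eq_abs, Real.norm_eq_abs,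
        abs_of_nonneg (by positivity : 0 ≤ Real.log 2 + Real.log (1 + p.1 ^ 2) + Real.log (1 + p.2 ^ 2)), abs_le]
      have a1 := neg_abs_le (Real.log |d|)
      have a2 := abs_nonneg (Real.log |d|)
      constructor <;> linarith
    · filter_upwards [hdiag] with p hp
      have hd : p.1 - p.2 ≠ 0 := sub_ne_zero.2 hp
      refine Tendsto.mono_left ?_ nhdsWithin_le_nhds
      have hd2 : (p.1 - p.2) ^ 2 + (0:ℝ) ^ 2 ≠ 0 := by positivity
      have hc : ContinuousAt (fun ε : ℝ => σ p.1 * σ p.2 *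
          ((1/2) * Real.log ((p.1 - p.2) ^ 2 + ε ^ 2))) 0 := by
        refine continuousAt_const.mul (continuousAt_const.mul (ContinuousAt.log ?_ hd2))
        fun_prop
      have := hc.tendsto
      have e : (1/2) * Real.log ((p.1 - p.2) ^ 2 + (0:ℝ) ^ 2) = Real.log |p.1 - p.2| := by
        rw [← sq_abs]
        simp only [ne_eq, OfNat.ofNat_ne_zero, not_false_eq_true, zero_pow, add_zero]
        rw [Real.log_pow]; push_cast; ring
      rw [e] at this
      exact this
  have hfin := le_of_tendsto_of_tendsto hlim1.norm
    ((hlim2.const_mul a).const_sub ((1 / (2 * a)) * (∫ ξ, |ξ| * ‖φ ξ‖ ^ 2)))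
    (by filter_upwards [self_mem_nhdsWithin] with ε hε using hreg ε hε)
  rw [← hpar, Complex.norm_real] at hfin
  have hc : 1 / (8 * π ^ 2 * a) * (4 * π ^ 2 * ∫ ξ, |ξ| * ‖φ ξ‖ ^ 2) =
      (1 / (2 * a)) * (∫ ξ, |ξ| * ‖φ ξ‖ ^ 2) := by
    field_simp; ring
  rw [hc]
  exact (le_abs_self _).trans hfin

end Onofri


namespace Onofri

open Set Filter Topology

/-- A contour lemma in the upper half plane. -/
lemma contour (F : ℂ → ℂ) (hF : DifferentiableOn ℂ F {z | 0 < z.im}) (m : ℝ → ℝ) (hm : Integrable m)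
    (δ₀ : ℝ) (hδ₀ : 0 < δ₀)
    (hb : ∀ δ ∈ Ioo 0 δ₀, ∀ᵐ x : ℝ, ‖F (x + δ * Complex.I)‖ ≤ m x)
    (C R₀ : ℝ) (hC : ∀ z : ℂ, 0 < z.im → R₀ ≤ ‖z‖ → ‖F z‖ ≤ C / ‖z‖ ^ 2)
    (F0 : ℝ → ℂ) (hlim : ∀ᵐ x : ℝ, Tendsto (fun δ : ℝ => F (x + δ * Complex.I)) (𝓝[>] 0) (𝓝 (F0 x))) :
    ∫ x, F0 x = 0 := by
  have hmeas : ∀ δ : ℝ, 0 < δ → AEStronglyMeasurable (fun x : ℝ => F (x + δ * Complex.I)) volume := by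
    intro δ hδ
    refine Continuous.aestronglyMeasurable ?_
    refine hF.continuousOn.comp_continuous (by fun_prop) (fun x => ?_)
    simpa using hδ
  have hzero : ∀ δ ∈ Ioo 0 δ₀, ∫ x : ℝ, F (x + δ * Complex.I) = 0 := by
    intro δ hδ
    have hi : Integrable (fun x : ℝ => F (x + δ * Complex.I)) :=
      hm.mono' (hmeas δ hδ.1) (hb δ hδ)
    have hl := intervalIntegral_tendsto_integral (l := atTop) (a := fun R : ℝ => -R)
      (b := fun R : ℝ => R) hi tendsto_neg_atTop_atBot tendsto_id
    refine tendsto_nhds_unique hl ?_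
    have hC0 : 0 ≤ |C| := abs_nonneg C
    have hbound : ∀ᶠ R : ℝ in atTop, ‖∫ x in (-R)..R, F (x + δ * Complex.I)‖ ≤ 4 * |C| / R := by
      filter_upwards [eventually_ge_atTop R₀, eventually_gt_atTop δ, eventually_gt_atTop 0]
        with R hR1 hR2 hR3
      have hCz : ∀ z : ℂ, 0 < z.im → R ≤ ‖z‖ → ‖F z‖ ≤ |C| / R ^ 2 := by
        intro z hz hz'
        refine (hC z hz (hR1.trans hz')).trans ?_
        have : 0 < ‖z‖ := hR3.trans_le hz'
        calc C / ‖z‖ ^ 2 ≤ |C| / ‖z‖ ^ 2 := by gcongr; exact le_abs_self C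
          _ ≤ |C| / R ^ 2 := by gcongr
      have hrect := Complex.integral_boundary_rect_eq_zero_of_differentiableOn F
        (⟨-R, δ⟩ : ℂ) (⟨R, R⟩ : ℂ) (hF.mono (by
          intro z hz
          have := hz.2
          simp only [mem_preimage] at this
          rw [uIcc_of_le hR2.le] at this
          exact lt_of_lt_of_le hδ.1 this.1))
      simp only at hrect
      have t1 : ‖∫ x in (-R)..R, F (x + R * Complex.I)‖ ≤ |C| / R ^ 2 * |R - (-R)| := by
        refine intervalIntegral.norm_integral_le_of_norm_le_const fun x _ => hCz _ (by simpa using hR3) ?_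
        have := Complex.abs_im_le_norm (x + R * Complex.I)
        simp at this
        exact (le_abs_self R).trans this
      have t2 : ∀ x0 : ℝ, |x0| = R → ‖∫ y in δ..R, F (x0 + y * Complex.I)‖ ≤ |C| / R ^ 2 * |R - δ| := by
        intro x0 hx0
        refine intervalIntegral.norm_integral_le_of_norm_le_const fun y hy => hCz _ ?_ ?_
        · rw [uIoc_of_le hR2.le] at hy
          simpa using hδ.1.trans hy.1
        · have := Complex.abs_re_le_norm (x0 + y * Complex.I)
          simp at this
          rw [← hx0]; exact this
      have t2a := t2 R (abs_of_pos hR3)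
      have t2b := t2 (-R) (by rw [abs_neg, abs_of_pos hR3])
      have e : ∫ x in (-R)..R, F (x + δ * Complex.I) = (∫ x in (-R)..R, F (x + R * Complex.I))
        - Complex.I • (∫ y in δ..R, F (R + y * Complex.I))
        + Complex.I • (∫ y in δ..R, F (((-R : ℝ) : ℂ) + y * Complex.I)) := by
        linear_combination hrect
      rw [e]
      have a1 : |R - (-R)| = 2 * R := by rw [abs_of_pos] <;> linarith
      have a2 : |R - δ| ≤ R := by rw [abs_of_pos] <;> linarith [hδ.1]
      rw [a1] at t1
      have hq : 0 ≤ |C| / R ^ 2 := by positivity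
      have a3 := mul_le_mul_of_nonneg_left a2 hq
      have e4 : 4 * |C| / R = |C| / R ^ 2 * (2 * R) + |C| / R ^ 2 * R + |C| / R ^ 2 * R := by
        field_simp; ring
      rw [e4]
      refine (norm_add_le _ _).trans (add_le_add ((norm_sub_le _ _).trans (add_le_add t1 ?_)) ?_)
      · rw [norm_smul, Complex.norm_I, one_mul]; exact t2a.trans a3
      · rw [norm_smul, Complex.norm_I, one_mul]; exact t2b.trans a3
    refine squeeze_zero_norm' hbound ?_
    exact tendsto_const_nhds.div_atTop tendsto_id
  have hl : Tendsto (fun δ : ℝ => ∫ x : ℝ, F (x + δ * Complex.I)) (𝓝[>] 0) (𝓝 (∫ x, F0 x)) := by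
    refine tendsto_integral_filter_of_dominated_convergence m ?_ ?_ hm hlim
    · filter_upwards [self_mem_nhdsWithin] with δ hδ using hmeas δ hδ
    · filter_upwards [Ioo_mem_nhdsGT hδ₀] with δ hδ using hb δ hδ
  refine tendsto_nhds_unique hl ?_
  refine tendsto_const_nhds.congr' ?_
  filter_upwards [Ioo_mem_nhdsGT hδ₀] with δ hδ using (hzero δ hδ).symm

/-- quadratic denominators -/
noncomputable def qf (a θ x : ℝ) : ℝ := (x ^ a) ^ 2 + 2 * x ^ a * Real.cos θ + 1

noncomputable def gh (a θ x : ℝ) : ℝ := Real.sin θ / π * (x ^ (a - 1) / qf a θ x)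

noncomputable def gg (a θ x : ℝ) : ℝ := if 0 < x then gh a θ x else gh a (π * a - θ) (-x)

noncomputable def rh (a θ x : ℝ) : ℝ := x ^ (a - 1) * (x ^ a + Real.cos θ) / qf a θ x

noncomputable def rr (a θ x : ℝ) : ℝ := if 0 < x then rh a θ x else - rh a (π * a - θ) (-x)

noncomputable def qq (a θ x : ℝ) : ℝ := if 0 < x then qf a θ x else qf a (π * a - θ) (-x)

/-- basic weight -/
noncomputable def hb (a x : ℝ) : ℝ := |x| ^ (a - 1) / (1 + |x| ^ a)

noncomputable def ww (a x : ℝ) : ℝ := |x| ^ (a - 1) / (1 + |x| ^ a) ^ 2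

noncomputable def Hc (a θ : ℝ) (z : ℂ) : ℂ :=
  z ^ ((a : ℂ) - 1) / (z ^ (a : ℂ) + Complex.exp (θ * Complex.I))

lemma quad_lower (X c : ℝ) (hc1 : c ≤ 1) :
    (1 + c) / 2 * (1 + X) ^ 2 ≤ X ^ 2 + 2 * X * c + 1 := by
  nlinarith [mul_nonneg (sub_nonneg.2 hc1) (sq_nonneg (X - 1))]

lemma cpow_polar (z : ℂ) (hz : z ≠ 0) (a : ℝ) :
    z ^ (a : ℂ) = ((‖z‖ ^ a : ℝ) : ℂ) * Complex.exp (((a * z.arg : ℝ) : ℂ) * Complex.I) := by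
  rw [Complex.cpow_def_of_ne_zero hz]
  have h1 : Complex.log z = Real.log ‖z‖ + z.arg * Complex.I := by
    apply Complex.ext <;> simp [Complex.log_re, Complex.log_im]
  rw [h1, Real.rpow_def_of_pos (norm_pos_iff.2 hz), Complex.ofReal_exp, ← Complex.exp_add]
  congr 1; push_cast; ring

lemma den_polar (r α θ : ℝ) :
    ‖((r : ℝ) : ℂ) * Complex.exp ((α : ℂ) * Complex.I) + Complex.exp (θ * Complex.I)‖ ^ 2 =
      r ^ 2 + 2 * r * Real.cos (α - θ) + 1 := by
  rw [Complex.sq_norm, Complex.normSq_apply, Real.cos_sub]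
  simp only [Complex.add_re, Complex.add_im, Complex.re_ofReal_mul, Complex.im_ofReal_mul,
    Complex.exp_ofReal_mul_I_re, Complex.exp_ofReal_mul_I_im]
  nlinarith [Real.sin_sq_add_cos_sq α, Real.sin_sq_add_cos_sq θ]

/-- constants -/
noncomputable def c0 (a θ : ℝ) : ℝ := (1 + min (Real.cos θ) (Real.cos (π * a - θ))) / 2

lemma cos_gt_neg_one {t : ℝ} (h0 : 0 ≤ t) (h1 : t < π) : -1 < Real.cos t := by
  rw [← Real.cos_pi]
  exact Real.cos_lt_cos_of_nonneg_of_le_pi h0 le_rfl h1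

lemma c0_pos {a θ : ℝ} (ha1 : a ≤ 1) (h0 : 0 < θ) (h1 : θ < π * a) : 0 < c0 a θ := by
  have hp := Real.pi_pos
  have h2 : π * a ≤ π := by nlinarith
  have := cos_gt_neg_one h0.le (h1.trans_le h2)
  have := cos_gt_neg_one (t := π * a - θ) (by linarith) (by linarith)
  unfold c0
  have := lt_min ‹-1 < Real.cos θ› ‹-1 < Real.cos (π * a - θ)›
  linarith

lemma den_lower {a θ : ℝ} (ha : 0 < a) (ha1 : a ≤ 1) (h0 : 0 < θ) (h1 : θ < π * a) (z : ℂ) (hz : z ≠ 0)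
    (him : 0 ≤ z.im) :
    c0 a θ * (1 + ‖z‖ ^ a) ^ 2 ≤ ‖z ^ (a : ℂ) + Complex.exp (θ * Complex.I)‖ ^ 2 := by
  rw [cpow_polar z hz, den_polar]
  have hp := Real.pi_pos
  have h2 : π * a ≤ π := by nlinarith
  have g0 : 0 ≤ z.arg := Complex.arg_nonneg_iff.2 him
  have g1 : z.arg ≤ π := Complex.arg_le_pi z
  have hc : min (Real.cos θ) (Real.cos (π * a - θ)) ≤ Real.cos (a * z.arg - θ) := by
    rcases le_total (a * z.arg) θ with h | h
    · refine (min_le_left _ _).trans ?_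
      rw [← Real.cos_neg (a * z.arg - θ)]
      refine Real.cos_le_cos_of_nonneg_of_le_pi (by linarith) (by linarith) ?_
      nlinarith
    · refine (min_le_right _ _).trans ?_
      refine Real.cos_le_cos_of_nonneg_of_le_pi (by linarith) (by linarith) ?_
      nlinarith
  have hr : 0 ≤ ‖z‖ ^ a := by positivity
  have := quad_lower (‖z‖ ^ a) (Real.cos (a * z.arg - θ)) (Real.cos_le_one _)
  refine le_trans ?_ this
  unfold c0
  refine mul_le_mul_of_nonneg_right ?_ (by positivity)
  linarith

lemma den_im_pos {a θ : ℝ} (ha : 0 < a) (ha1 : a ≤ 1) (h0 : 0 < θ) (h1 : θ < π * a) (z : ℂ)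
    (him : 0 < z.im) : 0 < (z ^ (a : ℂ) + Complex.exp (θ * Complex.I)).im := by
  have hz : z ≠ 0 := by rintro rfl; simp at him
  rw [cpow_polar z hz]
  simp only [Complex.add_im, Complex.im_ofReal_mul, Complex.exp_ofReal_mul_I_im]
  have hp := Real.pi_pos
  have h2 : π * a ≤ π := by nlinarith
  have g0 : 0 ≤ z.arg := Complex.arg_nonneg_iff.2 him.le
  have g1 : z.arg ≤ π := Complex.arg_le_pi z
  have s1 : 0 < Real.sin θ := Real.sin_pos_of_pos_of_lt_pi h0 (by linarith)
  have s2 : 0 ≤ Real.sin (a * z.arg) :=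
    Real.sin_nonneg_of_nonneg_of_le_pi (by positivity) (by nlinarith)
  have : 0 ≤ ‖z‖ ^ a := by positivity
  positivity

lemma Hc_norm_le {a θ : ℝ} (ha : 0 < a) (ha1 : a ≤ 1) (h0 : 0 < θ) (h1 : θ < π * a) (z : ℂ) (hz : z ≠ 0)
    (him : 0 ≤ z.im) : ‖Hc a θ z‖ ≤ 1 / √(c0 a θ) * hb a ‖z‖ := by
  have hc := c0_pos ha1 h0 h1
  have hd := den_lower ha ha1 h0 h1 z hz him
  have hd' : √(c0 a θ) * (1 + ‖z‖ ^ a) ≤ ‖z ^ (a : ℂ) + Complex.exp (θ * Complex.I)‖ := by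
    refine le_of_sq_le_sq ?_ (norm_nonneg _)
    rw [mul_pow, Real.sq_sqrt hc.le]; exact hd
  unfold Hc hb
  rw [norm_div, show ((a : ℂ) - 1) = ((a - 1 : ℝ) : ℂ) by push_cast; ring, Complex.norm_cpow_real, abs_norm]
  have hz' : 0 < ‖z‖ := norm_pos_iff.2 hz
  have h3 : 0 < √(c0 a θ) := Real.sqrt_pos.2 hc
  rw [one_div_mul_eq_div, div_div, mul_comm (1 + ‖z‖ ^ a)]
  gcongr

lemma Hc_differentiableOn {a θ : ℝ} (ha : 0 < a) (ha1 : a ≤ 1) (h0 : 0 < θ) (h1 : θ < π * a) :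
    DifferentiableOn ℂ (Hc a θ) {z | 0 < z.im} := by
  intro z hz
  have hz' : 0 < z.im := hz
  have hs : z ∈ Complex.slitPlane := Complex.mem_slitPlane_iff.2 (Or.inr hz'.ne')
  have hd : z ^ (a : ℂ) + Complex.exp (θ * Complex.I) ≠ 0 := by
    intro h
    have := den_im_pos ha ha1 h0 h1 z hz'
    rw [h] at this; simp at this
  refine DifferentiableAt.differentiableWithinAt ?_
  unfold Hc
  refine DifferentiableAt.div ?_ ?_ hd
  · exact (differentiableAt_id.cpow_const (by simpa using hs))
  · exact (differentiableAt_id.cpow_const (by simpa using hs)).add_const _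

end Onofri


namespace Onofri

open Set Filter Topology

/-- truncated power -/
noncomputable def rind (s x : ℝ) : ℝ := (Ioo (-1:ℝ) 1).indicator (fun x => |x| ^ s) x

lemma rind_nonneg (s x : ℝ) : 0 ≤ rind s x := by
  unfold rind; exact indicator_nonneg (fun x _ => by positivity) x

lemma rind_neg (s x : ℝ) : rind s (-x) = rind s x := by
  unfold rind
  by_cases h : x ∈ Ioo (-1:ℝ) 1
  · rw [indicator_of_mem h, indicator_of_mem (show -x ∈ Ioo (-1:ℝ) 1 from ⟨by linarith [h.2], by linarith [h.1]⟩), abs_neg]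
  · rw [indicator_of_notMem h, indicator_of_notMem]
    rintro ⟨h1, h2⟩; exact h ⟨by linarith, by linarith⟩

lemma rind_integrable (s : ℝ) (hs : -1 < s) : Integrable (rind s) := by
  have h1 : IntegrableOn (rind s) (Ioi 0) := by
    unfold rind
    rw [IntegrableOn, integrable_indicator_iff measurableSet_Ioo, IntegrableOn,
      Measure.restrict_restrict measurableSet_Ioo]
    have h2 := intervalIntegral.intervalIntegrable_rpow' (a := 0) (b := 1) hs
    rw [intervalIntegrable_iff_integrableOn_Ioo_of_le (by norm_num)] at h2
    have e : (Ioo (-1:ℝ) 1 ∩ Ioi 0) = Ioo 0 1 := by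
      ext x; simp only [mem_inter_iff, mem_Ioo, mem_Ioi]
      constructor
      · rintro ⟨⟨_, h⟩, h'⟩; exact ⟨h', h⟩
      · rintro ⟨h, h'⟩; exact ⟨⟨by linarith, h'⟩, h⟩
    rw [e]
    refine (integrableOn_congr_fun (fun x hx => ?_) measurableSet_Ioo).2 h2
    rw [abs_of_pos hx.1]
  exact (int_split h1 (by simpa only [rind_neg] using h1)).1

lemma hb_nonneg (a x : ℝ) : 0 ≤ hb a x := by unfold hb; positivity

lemma hb_le_one {a x : ℝ} (ha1 : a ≤ 1) (hx : 1 ≤ |x|) : hb a x ≤ 1 := by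
  unfold hb
  have h1 : |x| ^ (a - 1) ≤ 1 := Real.rpow_le_one_of_one_le_of_nonpos hx (by linarith)
  have h2 : 0 ≤ |x| ^ a := by positivity
  rw [div_le_one (by positivity)]; linarith

lemma hb_le {a : ℝ} (ha1 : a ≤ 1) (x : ℝ) : hb a x ≤ rind (a - 1) x + 1 := by
  by_cases h : x ∈ Ioo (-1:ℝ) 1
  · unfold rind hb
    rw [indicator_of_mem h]
    have h2 : 0 ≤ |x| ^ a := by positivity
    have : |x| ^ (a - 1) / (1 + |x| ^ a) ≤ |x| ^ (a - 1) := div_le_self (by positivity) (by linarith)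
    linarith
  · have : 1 ≤ |x| := by
      by_contra hc
      push Not at hc
      exact h (abs_lt.1 hc)
    have h2 := rind_nonneg (a - 1) x
    linarith [hb_le_one ha1 this]

lemma hb_anti {a : ℝ} (ha : 0 ≤ a) (ha1 : a ≤ 1) {x y : ℝ} (hx : 0 < |x|) (hxy : |x| ≤ |y|) :
    hb a y ≤ hb a x := by
  unfold hb
  have h1 : |y| ^ (a - 1) ≤ |x| ^ (a - 1) := Real.rpow_le_rpow_of_nonpos hx hxy (by linarith)
  have h2 : |x| ^ a ≤ |y| ^ a := Real.rpow_le_rpow hx.le hxy ha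
  gcongr

lemma hb_measurable (a : ℝ) : Measurable (hb a) := by unfold hb; fun_prop

lemma cauchy_kernel (p q : ℝ) (hq : 0 < q) :
    Integrable (fun x : ℝ => q / ((x - p) ^ 2 + q ^ 2)) ∧ ∫ x : ℝ, q / ((x - p) ^ 2 + q ^ 2) = π := by
  have e : ∀ x : ℝ, q / ((x - p) ^ 2 + q ^ 2) = q⁻¹ * (fun t : ℝ => (1 + t ^ 2)⁻¹) ((x - p) / q) := by
    intro x; simp only; field_simp; ring
  simp_rw [e]
  have h1 := integrable_inv_one_add_sq.comp_div hq.ne'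
  have h2 := h1.comp_sub_right p
  refine ⟨h2.const_mul _, ?_⟩
  rw [integral_const_mul, integral_sub_right_eq_self (fun x : ℝ => (fun t : ℝ => (1 + t ^ 2)⁻¹) (x / q)) p,
    Measure.integral_comp_div (fun t : ℝ => (1 + t ^ 2)⁻¹), integral_univ_inv_one_add_sq,
    abs_of_pos hq, smul_eq_mul]
  field_simp

lemma hb_mul_cauchy {a : ℝ} (ha : 0 < a) (ha1 : a ≤ 1) (p q : ℝ) (hq : 0 < q) :
    Integrable (fun x : ℝ => hb a x * (q / ((x - p) ^ 2 + q ^ 2))) := by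
  have hc := (cauchy_kernel p q hq).1
  have hr := rind_integrable (a - 1) (by linarith)
  refine ((hr.mul_const (1 / q)).add hc).mono'
    ((hb_measurable a).aestronglyMeasurable.mul hc.aestronglyMeasurable) (Eventually.of_forall fun x => ?_)
  have h1 : 0 ≤ q / ((x - p) ^ 2 + q ^ 2) := by positivity
  have h2 : q / ((x - p) ^ 2 + q ^ 2) ≤ 1 / q := by
    rw [div_le_div_iff₀ (by positivity) hq]; nlinarith [sq_nonneg (x - p)]
  rw [Real.norm_of_nonneg (mul_nonneg (hb_nonneg a x) h1)]
  have h3 := mul_le_mul_of_nonneg_right (hb_le ha1 x) h1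
  have h4 := mul_le_mul_of_nonneg_left h2 (rind_nonneg (a - 1) x)
  simp only [Pi.add_apply]
  linarith

lemma inv_den (X φ : ℝ) (hq : X ^ 2 + 2 * X * Real.cos φ + 1 ≠ 0) :
    ((X : ℂ) + Complex.exp (φ * Complex.I))⁻¹ =
      (((X + Real.cos φ) / (X ^ 2 + 2 * X * Real.cos φ + 1) : ℝ) : ℂ)
        - ((Real.sin φ / (X ^ 2 + 2 * X * Real.cos φ + 1) : ℝ) : ℂ) * Complex.I := by
  refine inv_eq_of_mul_eq_one_right ?_
  have hs := Real.sin_sq_add_cos_sq φ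
  have hQ' : (X + Real.cos φ) ^ 2 + Real.sin φ ^ 2 = X ^ 2 + 2 * X * Real.cos φ + 1 := by
    linear_combination hs
  generalize X ^ 2 + 2 * X * Real.cos φ + 1 = Q at *
  apply Complex.ext
  · simp only [Complex.mul_re, Complex.add_re, Complex.add_im, Complex.sub_re, Complex.sub_im,
      Complex.exp_ofReal_mul_I_re, Complex.exp_ofReal_mul_I_im, Complex.ofReal_re, Complex.ofReal_im,
      Complex.mul_im, Complex.I_re, Complex.I_im, Complex.one_re]
    field_simp
    ring_nf
    field_simp
    linear_combination hQ'
  · simp only [Complex.mul_re, Complex.add_re, Complex.add_im, Complex.sub_re, Complex.sub_im,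
      Complex.exp_ofReal_mul_I_re, Complex.exp_ofReal_mul_I_im, Complex.ofReal_re, Complex.ofReal_im,
      Complex.mul_im, Complex.I_re, Complex.I_im, Complex.one_im]
    field_simp
    ring

lemma qf_pos {a θ x : ℝ} (h0 : 0 ≤ θ) (h1 : θ < π) (hx : 0 ≤ x) : 0 < qf a θ x := by
  have := cos_gt_neg_one h0 h1
  have h2 := quad_lower (x ^ a) (Real.cos θ) (Real.cos_le_one _)
  have h3 : 0 ≤ x ^ a := by positivity
  unfold qf
  refine lt_of_lt_of_le ?_ h2
  have : 0 < 1 + Real.cos θ := by linarith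
  positivity

lemma Hc_real {a θ : ℝ} (ha1 : a ≤ 1) (h0 : 0 < θ) (h1 : θ < π * a) (x : ℝ) (hx : x ≠ 0) :
    Hc a θ (x : ℂ) = ((rr a θ x : ℝ) : ℂ) - ((π * gg a θ x : ℝ) : ℂ) * Complex.I := by
  have hp := Real.pi_pos
  have h2 : π * a ≤ π := by nlinarith
  rcases lt_or_gt_of_ne hx with h | h
  · have hr : 0 < -x := by linarith
    have hx0 : (x : ℂ) ≠ 0 := by exact_mod_cast hx
    have hq := qf_pos (a := a) (θ := π * a - θ) (x := -x) (by linarith) (by linarith) hr.le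
    unfold rr gg
    rw [if_neg (by linarith), if_neg (by linarith)]
    unfold rh gh
    unfold Hc
    have e1 : (x:ℂ) ^ ((a:ℂ) - 1) = -(((-x) ^ (a - 1) : ℝ) : ℂ) * Complex.exp (((π * a : ℝ) : ℂ) * Complex.I) := by
      rw [show ((a : ℂ) - 1) = ((a - 1 : ℝ) : ℂ) by push_cast; ring, cpow_polar _ hx0, Complex.norm_real,
        Real.norm_eq_abs, abs_of_neg h, Complex.arg_ofReal_of_neg h]
      have : ((((a - 1) * π : ℝ)) : ℂ) * Complex.I = ((π * a : ℝ) : ℂ) * Complex.I - π * Complex.I := by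
        push_cast; ring
      rw [this, Complex.exp_sub, Complex.exp_pi_mul_I]; ring
    have e2 : (x:ℂ) ^ (a:ℂ) + Complex.exp (θ * Complex.I) = Complex.exp (((π * a : ℝ) : ℂ) * Complex.I) *
        ((((-x) ^ a : ℝ) : ℂ) + Complex.exp (((-(π * a - θ) : ℝ) : ℂ) * Complex.I)) := by
      rw [cpow_polar _ hx0, Complex.norm_real, Real.norm_eq_abs, abs_of_neg h, Complex.arg_ofReal_of_neg h,
        mul_add, ← Complex.exp_add, mul_comm a π]
      congr 1
      · ring
      · congr 1; push_cast; ring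
    have hne := Complex.exp_ne_zero (((π * a : ℝ) : ℂ) * Complex.I)
    rw [e1, e2]
    have hq' : ((-x) ^ a) ^ 2 + 2 * (-x) ^ a * Real.cos (-(π * a - θ)) + 1 ≠ 0 := by
      rw [Real.cos_neg]; exact hq.ne'
    have hinv := inv_den ((-x) ^ a) (-(π * a - θ)) hq'
    rw [mul_comm (-_) (Complex.exp (((π * a : ℝ) : ℂ) * Complex.I)), mul_div_mul_left _ _ hne,
      div_eq_mul_inv, hinv, Real.cos_neg, Real.sin_neg]
    have hq3 : ((-x) ^ a) ^ 2 + 2 * (-x) ^ a * Real.cos (π * a - θ) + 1 = qf a (π * a - θ) (-x) := rfl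
    rw [hq3]
    generalize qf a (π * a - θ) (-x) = Q
    have hpc : (π : ℂ) ≠ 0 := by exact_mod_cast hp.ne'
    push_cast
    field_simp
    ring
  · have hq := qf_pos (a := a) (θ := θ) (x := x) h0.le (by linarith) h.le
    unfold rr gg
    rw [if_pos h, if_pos h]
    unfold rh gh
    unfold Hc
    rw [show ((a : ℂ) - 1) = ((a - 1 : ℝ) : ℂ) by push_cast; ring, ← Complex.ofReal_cpow h.le,
      ← Complex.ofReal_cpow h.le, div_eq_mul_inv, inv_den _ _ (by exact hq.ne')]
    have hq3 : (x ^ a) ^ 2 + 2 * x ^ a * Real.cos θ + 1 = qf a θ x := rfl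
    rw [hq3]
    generalize qf a θ x = Q
    have hpc : (π : ℂ) ≠ 0 := by exact_mod_cast hp.ne'
    push_cast
    field_simp

lemma line_tendsto (x : ℝ) :
    Tendsto (fun δ : ℝ => (x : ℂ) + δ * Complex.I) (𝓝[>] 0) (𝓝[{z | 0 ≤ z.im}] (x : ℂ)) := by
  rw [tendsto_nhdsWithin_iff]
  constructor
  · have : Continuous (fun δ : ℝ => (x : ℂ) + δ * Complex.I) := by fun_prop
    have := this.tendsto 0
    simp only [Complex.ofReal_zero, zero_mul, add_zero] at this
    exact this.mono_left nhdsWithin_le_nhds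
  · filter_upwards [self_mem_nhdsWithin] with δ hδ
    have : 0 < δ := hδ
    simpa using this.le

lemma cpow_line (x : ℝ) (hx : x ≠ 0) (c : ℂ) :
    Tendsto (fun δ : ℝ => ((x : ℂ) + δ * Complex.I) ^ c) (𝓝[>] 0) (𝓝 ((x : ℂ) ^ c)) := by
  have hx0 : (x : ℂ) ≠ 0 := by exact_mod_cast hx
  have hlog : Tendsto (fun δ : ℝ => Complex.log ((x : ℂ) + δ * Complex.I)) (𝓝[>] 0)
      (𝓝 (Complex.log x)) := by
    rcases lt_or_gt_of_ne hx with h | h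
    · have := Complex.continuousWithinAt_log_of_re_neg_of_im_zero (z := (x : ℂ)) (by simpa using h) (by simp)
      exact this.tendsto.comp (line_tendsto x)
    · have : ContinuousAt Complex.log (x : ℂ) :=
        continuousAt_clog (Complex.ofReal_mem_slitPlane.2 h)
      exact this.tendsto.comp ((line_tendsto x).mono_right nhdsWithin_le_nhds)
  rw [Complex.cpow_def_of_ne_zero hx0]
  refine ((hlog.mul_const c).cexp).congr' ?_
  filter_upwards [self_mem_nhdsWithin] with δ hδ
  have hδ' : 0 < δ := hδ
  rw [Complex.cpow_def_of_ne_zero]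
  intro h
  have := congrArg Complex.im h
  simp at this
  linarith

lemma Hc_line {a θ : ℝ} (ha : 0 < a) (ha1 : a ≤ 1) (h0 : 0 < θ) (h1 : θ < π * a) (x : ℝ) (hx : x ≠ 0) :
    Tendsto (fun δ : ℝ => Hc a θ ((x : ℂ) + δ * Complex.I)) (𝓝[>] 0) (𝓝 (Hc a θ x)) := by
  have hx0 : (x : ℂ) ≠ 0 := by exact_mod_cast hx
  have hd := den_lower ha ha1 h0 h1 x hx0 (by simp)
  have hc := c0_pos ha1 h0 h1
  refine (cpow_line x hx _).div ((cpow_line x hx _).add_const _) ?_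
  intro h
  rw [h] at hd
  simp only [norm_zero, ne_eq, OfNat.ofNat_ne_zero, not_false_eq_true, zero_pow] at hd
  have : 0 < c0 a θ * (1 + ‖(x:ℂ)‖ ^ a) ^ 2 := by positivity
  linarith

end Onofri


namespace Onofri

open Set Filter Topology

lemma ae_ne_zero : ∀ᵐ x : ℝ, x ≠ 0 := by simp [ae_iff]

lemma hb_norm_line {a : ℝ} (ha : 0 ≤ a) (ha1 : a ≤ 1) (x δ : ℝ) (hx : x ≠ 0) :
    hb a ‖(x : ℂ) + δ * Complex.I‖ ≤ hb a x := by
  refine hb_anti ha ha1 (abs_pos.2 hx) ?_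
  have := Complex.abs_re_le_norm ((x : ℂ) + δ * Complex.I)
  simp at this
  rw [abs_norm]; exact this

lemma norm_prod_lower (p q x δ : ℝ) (hq : 0 < q) (hδ : 0 < δ) (hδ2 : δ < q / 2) :
    (x - p) ^ 2 + (q / 2) ^ 2 ≤
      ‖((x : ℂ) + δ * Complex.I) - (p + q * Complex.I)‖ * ‖((x : ℂ) + δ * Complex.I) - (p - q * Complex.I)‖ := by
  have h1 : (x - p) ^ 2 + (q / 2) ^ 2 ≤ ‖((x : ℂ) + δ * Complex.I) - (p + q * Complex.I)‖ ^ 2 := by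
    rw [Complex.sq_norm, Complex.normSq_apply]; simp; nlinarith
  have h2 : (x - p) ^ 2 + (q / 2) ^ 2 ≤ ‖((x : ℂ) + δ * Complex.I) - (p - q * Complex.I)‖ ^ 2 := by
    rw [Complex.sq_norm, Complex.normSq_apply]; simp; nlinarith
  have h3 : 0 ≤ (x - p) ^ 2 + (q / 2) ^ 2 := by positivity
  refine le_of_sq_le_sq ?_ (by positivity)
  rw [mul_pow, sq ((x - p) ^ 2 + (q / 2) ^ 2)]
  exact mul_le_mul h1 h2 h3 (by positivity)

lemma poisson_c {a θ : ℝ} (ha : 0 < a) (ha1 : a ≤ 1) (h0 : 0 < θ) (h1 : θ < π * a) (p q : ℝ) (hq : 0 < q) :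
    ∫ x : ℝ, (Hc a θ x - Hc a θ (p + q * Complex.I)) *
      ((2 * Complex.I) * ((q / ((x - p) ^ 2 + q ^ 2) : ℝ) : ℂ)) = 0 := by
  set z : ℂ := p + q * Complex.I with hz
  set z' : ℂ := p - q * Complex.I with hz'
  have hzim : 0 < z.im := by simp [hz, hq]
  have hzz : z - z' = 2 * Complex.I * q := by rw [hz, hz']; ring
  have hzz' : ‖z - z'‖ = 2 * q := by rw [hzz]; simp [abs_of_pos hq]
  set c := 1 / √(c0 a θ) with hc
  have hc0 : 0 ≤ c := by positivity
  set F : ℂ → ℂ := fun ω => dslope (Hc a θ) z ω * ((z - z') / (ω - z')) with hF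
  have hop : {z : ℂ | 0 < z.im} ∈ 𝓝 z := (isOpen_lt continuous_const Complex.continuous_im).mem_nhds hzim
  have hne' : ∀ ω : ℂ, 0 ≤ ω.im → ω - z' ≠ 0 := by
    intro ω hω h
    have := congrArg Complex.im h
    simp [hz'] at this
    linarith
  have hFd : DifferentiableOn ℂ F {z | 0 < z.im} := by
    refine ((Complex.differentiableOn_dslope hop).2 (Hc_differentiableOn ha ha1 h0 h1)).mul ?_
    intro ω hω
    refine DifferentiableAt.differentiableWithinAt ?_
    exact (differentiableAt_const _).div (by fun_prop) (hne' ω (le_of_lt hω))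
  have hFne : ∀ ω : ℂ, ω ≠ z → F ω = (Hc a θ ω - Hc a θ z) * ((z - z') / ((ω - z) * (ω - z'))) := by
    intro ω hω
    simp only [hF]
    rw [dslope_of_ne _ hω, slope_def_field, div_mul_div_comm, mul_div_assoc]
  have hFn : ∀ ω : ℂ, ω ≠ z → 0 ≤ ω.im → ω ≠ 0 → ‖F ω‖ ≤ (c * hb a ‖ω‖ + ‖Hc a θ z‖) *
      (2 * q / (‖ω - z‖ * ‖ω - z'‖)) := by
    intro ω hω hi hω0
    rw [hFne ω hω, norm_mul, norm_div, norm_mul, hzz']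
    refine mul_le_mul_of_nonneg_right ?_ (by positivity)
    exact (norm_sub_le _ _).trans (add_le_add (Hc_norm_le ha ha1 h0 h1 ω hω0 hi) le_rfl)
  set m : ℝ → ℝ := fun x => 4 * (c * (hb a x * ((q / 2) / ((x - p) ^ 2 + (q / 2) ^ 2))) +
    ‖Hc a θ z‖ * ((q / 2) / ((x - p) ^ 2 + (q / 2) ^ 2))) with hm
  have hmi : Integrable m := by
    refine Integrable.const_mul (Integrable.add ?_ ?_) 4
    · exact (hb_mul_cauchy ha ha1 p (q / 2) (by positivity)).const_mul c
    · exact (cauchy_kernel p (q / 2) (by positivity)).1.const_mul _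
  have hbd : ∀ δ ∈ Ioo 0 (q / 2), ∀ᵐ x : ℝ, ‖F (x + δ * Complex.I)‖ ≤ m x := by
    intro δ hδ
    filter_upwards [ae_ne_zero] with x hx
    have g1 : (x : ℂ) + δ * Complex.I ≠ z := by
      intro h
      have := congrArg Complex.im h
      simp [hz] at this
      linarith [hδ.2]
    have g2 : (x : ℂ) + δ * Complex.I ≠ 0 := by
      intro h
      have := congrArg Complex.im h
      simp at this
      linarith [hδ.1]
    refine (hFn _ g1 (by simpa using hδ.1.le) g2).trans ?_
    have g3 := norm_prod_lower p q x δ hq hδ.1 hδ.2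
    have g4 := hb_norm_line ha.le ha1 x δ hx
    have g5 : 0 < (x - p) ^ 2 + (q / 2) ^ 2 := by positivity
    have g6 := hb_nonneg a x
    calc (c * hb a ‖(x : ℂ) + δ * Complex.I‖ + ‖Hc a θ z‖) *
          (2 * q / (‖((x : ℂ) + δ * Complex.I) - z‖ * ‖((x : ℂ) + δ * Complex.I) - z'‖))
        ≤ (c * hb a x + ‖Hc a θ z‖) * (2 * q / ((x - p) ^ 2 + (q / 2) ^ 2)) := by gcongr
      _ = m x := by simp only [hm]; ring
  have hCb : ∀ ω : ℂ, 0 < ω.im → max 1 (2 * ‖z‖) ≤ ‖ω‖ →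
      ‖F ω‖ ≤ ((c + ‖Hc a θ z‖) * (8 * q)) / ‖ω‖ ^ 2 := by
    intro ω hi hR
    have r1 : 1 ≤ ‖ω‖ := (le_max_left _ _).trans hR
    have r2 : 2 * ‖z‖ ≤ ‖ω‖ := (le_max_right _ _).trans hR
    have zpos : 0 < ‖z‖ := norm_pos_iff.2 (by intro h; rw [h] at hzim; simp at hzim)
    have zz : ‖z'‖ = ‖z‖ := by
      have : z' = (starRingEnd ℂ) z := by simp [hz, hz', sub_eq_add_neg]
      rw [this, Complex.norm_conj]
    have g1 : ω ≠ z := by rintro rfl; linarith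
    have g2 : ω ≠ 0 := by rintro rfl; simp at hi
    refine (hFn ω g1 hi.le g2).trans ?_
    have n1 : ‖ω‖ / 2 ≤ ‖ω - z‖ := by have := norm_sub_norm_le ω z; linarith
    have n2 : ‖ω‖ / 2 ≤ ‖ω - z'‖ := by have := norm_sub_norm_le ω z'; linarith
    have n3 : hb a ‖ω‖ ≤ 1 := hb_le_one ha1 (by rw [abs_norm]; exact r1)
    have n0 : 0 < ‖ω‖ := by linarith
    calc (c * hb a ‖ω‖ + ‖Hc a θ z‖) * (2 * q / (‖ω - z‖ * ‖ω - z'‖))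
        ≤ (c * 1 + ‖Hc a θ z‖) * (2 * q / ((‖ω‖ / 2) * (‖ω‖ / 2))) := by gcongr
      _ = _ := by field_simp; ring
  refine contour F hFd m hmi (q / 2) (by positivity) hbd _ _ hCb _ ?_
  filter_upwards [ae_ne_zero] with x hx
  have hxz : (x : ℂ) ≠ z := by
    intro h
    have := congrArg Complex.im h
    simp [hz] at this
    linarith
  have hl := (line_tendsto x).mono_right nhdsWithin_le_nhds
  have hlim : Tendsto (fun δ : ℝ => (Hc a θ (x + δ * Complex.I) - Hc a θ z) *
      ((z - z') / (((x + δ * Complex.I) - z) * ((x + δ * Complex.I) - z')))) (𝓝[>] 0)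
      (𝓝 ((Hc a θ x - Hc a θ z) * ((z - z') / ((x - z) * (x - z'))))) := by
    refine ((Hc_line ha ha1 h0 h1 x hx).sub_const _).mul (tendsto_const_nhds.div
      ((hl.sub_const _).mul (hl.sub_const _)) ?_)
    exact mul_ne_zero (sub_ne_zero.2 hxz) (hne' x (by simp))
  have e : (z - z') / ((x - z) * (x - z')) = 2 * Complex.I * ((q / ((x - p) ^ 2 + q ^ 2) : ℝ) : ℂ) := by
    have : (x - z) * (x - z') = (((x - p) ^ 2 + q ^ 2 : ℝ) : ℂ) := by
      rw [hz, hz']; push_cast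
      linear_combination (-(q:ℂ) ^ 2) * Complex.I_sq
    rw [this, hzz]; push_cast; ring
  rw [e] at hlim
  refine hlim.congr' ?_
  filter_upwards [Ioo_mem_nhdsGT hq] with δ hδ
  rw [hFne]
  intro h
  have := congrArg Complex.im h
  simp [hz] at this
  linarith [hδ.2]

lemma ww_nonneg (a x : ℝ) : 0 ≤ ww a x := by unfold ww; positivity

lemma gh_le {a θ c x : ℝ} (h0 : 0 ≤ θ) (h1 : θ < π) (hx : 0 ≤ x) (hc : 0 < c)
    (hcc : c ≤ (1 + Real.cos θ) / 2) :
    0 ≤ gh a θ x ∧ gh a θ x ≤ 1 / c * ww a x := by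
  have hq := qf_pos (a := a) h0 h1 hx
  have hs : 0 ≤ Real.sin θ := Real.sin_nonneg_of_nonneg_of_le_pi h0 h1.le
  have hs1 := Real.sin_le_one θ
  have hp := Real.pi_gt_three
  have hql := quad_lower (x ^ a) (Real.cos θ) (Real.cos_le_one _)
  have hx1 : 0 ≤ x ^ a := by positivity
  have hx2 : 0 ≤ x ^ (a - 1) := by positivity
  unfold gh ww
  constructor
  · positivity
  rw [abs_of_nonneg hx]
  have : c * (1 + x ^ a) ^ 2 ≤ qf a θ x := by
    unfold qf
    refine le_trans (mul_le_mul_of_nonneg_right hcc (by positivity)) hql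
  have hsp : Real.sin θ / π ≤ 1 := by
    rw [div_le_one (by positivity)]; linarith
  calc Real.sin θ / π * (x ^ (a - 1) / qf a θ x) ≤ 1 * (x ^ (a - 1) / (c * (1 + x ^ a) ^ 2)) := by gcongr
    _ = _ := by field_simp

lemma gg_le {a θ : ℝ} (ha1 : a ≤ 1) (h0 : 0 < θ) (h1 : θ < π * a) (x : ℝ) :
    0 ≤ gg a θ x ∧ gg a θ x ≤ 1 / c0 a θ * ww a x := by
  have hp := Real.pi_pos
  have h2 : π * a ≤ π := by nlinarith
  have hc := c0_pos ha1 h0 h1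
  unfold gg
  split_ifs with h
  · refine gh_le h0.le (by linarith) h.le hc ?_
    unfold c0; linarith [min_le_left (Real.cos θ) (Real.cos (π * a - θ))]
  · have := gh_le (a := a) (θ := π * a - θ) (c := c0 a θ) (x := -x) (by linarith) (by linarith) (by linarith) hc (by
      unfold c0; linarith [min_le_right (Real.cos θ) (Real.cos (π * a - θ))])
    have e : ww a (-x) = ww a x := by unfold ww; rw [abs_neg]
    rwa [e] at this

lemma rr_le {a θ : ℝ} (ha : 0 < a) (ha1 : a ≤ 1) (h0 : 0 < θ) (h1 : θ < π * a) (x : ℝ) (hx : x ≠ 0) :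
    |rr a θ x| ≤ 1 / √(c0 a θ) * hb a x := by
  have := Hc_norm_le ha ha1 h0 h1 x (by exact_mod_cast hx) (by simp)
  have h2 := Complex.abs_re_le_norm (Hc a θ x)
  rw [Hc_real ha1 h0 h1 x hx] at h2 this
  simp only [Complex.sub_re, Complex.ofReal_re, Complex.mul_re, Complex.I_re, mul_zero, Complex.ofReal_im,
    Complex.I_im, zero_mul, sub_zero] at h2
  refine h2.trans (this.trans (le_of_eq ?_))
  unfold hb; simp

lemma gh_measurable (a θ : ℝ) : Measurable (gh a θ) := by unfold gh qf; fun_prop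
lemma gg_measurable (a θ : ℝ) : Measurable (gg a θ) := by
  unfold gg
  exact Measurable.ite measurableSet_Ioi (gh_measurable a θ)
    ((gh_measurable a (π * a - θ)).comp measurable_neg)
lemma rh_measurable (a θ : ℝ) : Measurable (rh a θ) := by unfold rh qf; fun_prop
lemma rr_measurable (a θ : ℝ) : Measurable (rr a θ) := by
  unfold rr
  exact Measurable.ite measurableSet_Ioi (rh_measurable a θ)
    ((rh_measurable a (π * a - θ)).comp measurable_neg).neg

lemma ww_measurable (a : ℝ) : Measurable (ww a) := by unfold ww; fun_prop

lemma ww_le_hb (a x : ℝ) : ww a x ≤ hb a x := by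
  unfold ww hb
  have : 0 ≤ |x| ^ a := by positivity
  refine div_le_div_of_nonneg_left (by positivity) (by positivity) ?_
  nlinarith

/-- Poisson formula -/
lemma poisson_gg {a θ : ℝ} (ha : 0 < a) (ha1 : a ≤ 1) (h0 : 0 < θ) (h1 : θ < π * a) (p q : ℝ) (hq : 0 < q) :
    ∫ x : ℝ, gg a θ x * (q / ((x - p) ^ 2 + q ^ 2)) = - (Hc a θ (p + q * Complex.I)).im := by
  have h := poisson_c ha ha1 h0 h1 p q hq
  set z : ℂ := p + q * Complex.I
  have hck := cauchy_kernel p q hq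
  have hbk := hb_mul_cauchy ha ha1 p q hq
  have hgk : Integrable (fun x : ℝ => gg a θ x * (q / ((x - p) ^ 2 + q ^ 2))) := by
    refine (hbk.const_mul (1 / c0 a θ)).mono' ((gg_measurable a θ).aestronglyMeasurable.mul
      hck.1.aestronglyMeasurable) (Eventually.of_forall fun x => ?_)
    have g := gg_le ha1 h0 h1 x
    have k : 0 ≤ q / ((x - p) ^ 2 + q ^ 2) := by positivity
    rw [Real.norm_of_nonneg (mul_nonneg g.1 k), ← mul_assoc]
    refine mul_le_mul_of_nonneg_right (g.2.trans ?_) k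
    have := c0_pos ha1 h0 h1
    exact mul_le_mul_of_nonneg_left (ww_le_hb a x) (by positivity)
  have hrk : Integrable (fun x : ℝ => rr a θ x * (q / ((x - p) ^ 2 + q ^ 2))) := by
    refine (hbk.const_mul (1 / √(c0 a θ))).mono' ((rr_measurable a θ).aestronglyMeasurable.mul
      hck.1.aestronglyMeasurable) ?_
    filter_upwards [ae_ne_zero] with x hx
    have k : 0 ≤ q / ((x - p) ^ 2 + q ^ 2) := by positivity
    rw [norm_mul, Real.norm_of_nonneg k, ← mul_assoc]
    exact mul_le_mul_of_nonneg_right (rr_le ha ha1 h0 h1 x hx) k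
  have e : ∀ᵐ x : ℝ, (Hc a θ x - Hc a θ z) * ((2 * Complex.I) * ((q / ((x - p) ^ 2 + q ^ 2) : ℝ) : ℂ)) =
      ((2 * (π * (gg a θ x * (q / ((x - p) ^ 2 + q ^ 2))) + (Hc a θ z).im * (q / ((x - p) ^ 2 + q ^ 2))) : ℝ) : ℂ)
      + ((2 * (rr a θ x * (q / ((x - p) ^ 2 + q ^ 2)) - (Hc a θ z).re * (q / ((x - p) ^ 2 + q ^ 2))) : ℝ) : ℂ)
        * Complex.I := by
    filter_upwards [ae_ne_zero] with x hx
    rw [Hc_real ha1 h0 h1 x hx]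
    generalize q / ((x - p) ^ 2 + q ^ 2) = P
    apply Complex.ext
    · simp; ring
    · simp; ring
  rw [integral_congr_ae e] at h
  have i1 : Integrable (fun x : ℝ => 2 * (π * (gg a θ x * (q / ((x - p) ^ 2 + q ^ 2))) +
    (Hc a θ z).im * (q / ((x - p) ^ 2 + q ^ 2)))) := ((hgk.const_mul _).add (hck.1.const_mul _)).const_mul _
  have i2 : Integrable (fun x : ℝ => 2 * (rr a θ x * (q / ((x - p) ^ 2 + q ^ 2)) -
    (Hc a θ z).re * (q / ((x - p) ^ 2 + q ^ 2)))) := (hrk.sub (hck.1.const_mul _)).const_mul _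
  rw [integral_add i1.ofReal (i2.ofReal.mul_const _), integral_mul_const] at h
  have h2 := congrArg Complex.re h
  rw [integral_complex_ofReal, integral_complex_ofReal] at h2
  simp only [Complex.add_re, Complex.ofReal_re, Complex.mul_re, Complex.I_re, mul_zero, Complex.ofReal_im,
    zero_mul, sub_zero, add_zero, Complex.zero_re] at h2
  rw [integral_const_mul, integral_add (hgk.const_mul _) (hck.1.const_mul _), integral_const_mul,
    integral_const_mul, hck.2] at h2
  have hp := Real.pi_pos
  have : 2 * π * ((∫ x : ℝ, gg a θ x * (q / ((x - p) ^ 2 + q ^ 2))) + (Hc a θ z).im) = 0 := by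
    linear_combination h2
  have := (mul_eq_zero.1 this).resolve_left (by positivity)
  linarith

end Onofri

namespace Onofri
open Set Filter Topology

lemma rpow_a_tendsto {a : ℝ} (ha : 0 < a) : Tendsto (fun x : ℝ => x ^ a) atTop atTop :=
  tendsto_rpow_atTop ha

noncomputable def w1 (a x : ℝ) : ℝ := |x| ^ (a - 1) / ((1 + |x| ^ a) * √(1 + |x| ^ a))

lemma w1_nonneg (a x : ℝ) : 0 ≤ w1 a x := by unfold w1; positivity

lemma w1_measurable (a : ℝ) : Measurable (w1 a) := by unfold w1; fun_prop

lemma w1_integrable {a : ℝ} (ha : 0 < a) : Integrable (w1 a) := by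
  have key : IntegrableOn (w1 a) (Ioi 0) := by
    have h := integrableOn_Ioi_deriv_of_nonneg (a := 0) (g := fun x : ℝ => -(2 / a) / √(1 + x ^ a)) (g' := w1 a) (l := 0) ?_ ?_
      (fun x _ => w1_nonneg a x) ?_
    · exact h
    · refine ContinuousAt.continuousWithinAt ?_
      refine ContinuousAt.div continuousAt_const ?_ ?_
      · exact (continuousAt_const.add (continuousAt_rpow_const _ _ (Or.inr ha.le))).sqrt
      · simp [Real.zero_rpow ha.ne']
    · intro x hx
      have hx : 0 < x := hx
      have h1 : 0 < 1 + x ^ a := by positivity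
      have h2 := (((hasDerivAt_rpow_const (p := a) (Or.inl hx.ne')).const_add 1).sqrt h1.ne')
      have h3 := ((hasDerivAt_const x (-(2 / a))).div h2 (by positivity))
      refine h3.congr_deriv ?_
      unfold w1
      rw [abs_of_pos hx]
      have h4 : √(1 + x ^ a) ^ 2 = 1 + x ^ a := Real.sq_sqrt h1.le
      have h5 : 0 < √(1 + x ^ a) := by positivity
      rw [h4]
      field_simp
      ring
    · have h1 : Tendsto (fun x : ℝ => √(1 + x ^ a)) atTop atTop :=
        Real.tendsto_sqrt_atTop.comp (tendsto_atTop_add_const_left _ _ (tendsto_rpow_atTop ha))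
      exact tendsto_const_nhds.div_atTop h1
  refine (int_split key ?_).1
  have : (fun x => w1 a (-x)) = w1 a := by funext x; simp [w1]
  rw [this]; exact key

lemma ww_le_w1 (a x : ℝ) : ww a x ≤ w1 a x := by
  unfold ww w1
  have h1 : 0 ≤ |x| ^ a := by positivity
  refine div_le_div_of_nonneg_left (by positivity) (by positivity) ?_
  rw [sq]
  gcongr
  rw [Real.sqrt_le_left (by linarith)]
  nlinarith

lemma ww_integrable {a : ℝ} (ha : 0 < a) : Integrable (ww a) :=
  (w1_integrable ha).mono' (ww_measurable a).aestronglyMeasurable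
    (Eventually.of_forall fun x => by rw [Real.norm_of_nonneg (ww_nonneg a x)]; exact ww_le_w1 a x)

lemma log_le_sqrt {a : ℝ} (ha : 0 < a) (ha1 : a ≤ 1) (x : ℝ) :
    Real.log (1 + x ^ 2) ≤ 4 / a * √(1 + |x| ^ a) := by
  have h0 : 0 ≤ |x| := abs_nonneg x
  have h1 : 1 + |x| ≤ (1 + |x| ^ a) ^ (1 / a) := by
    have := Real.add_rpow_le_rpow_add (a := 1) (b := |x| ^ a) (p := 1 / a) zero_le_one (by positivity)
      (by rw [le_div_iff₀ ha]; linarith)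
    rwa [Real.one_rpow, ← Real.rpow_mul h0, mul_one_div_cancel ha.ne', Real.rpow_one] at this
  have hp : 0 < 1 + |x| ^ a := by positivity
  have h2 : Real.log (1 + |x|) ≤ 1 / a * Real.log (1 + |x| ^ a) := by
    rw [← Real.log_rpow hp]; exact Real.log_le_log (by positivity) h1
  have h3 : Real.log (1 + |x| ^ a) ≤ 2 * √(1 + |x| ^ a) := by
    have := Real.log_le_self (Real.sqrt_nonneg (1 + |x| ^ a))
    rw [Real.log_sqrt hp.le] at this; linarith
  have h4 : Real.log (1 + x ^ 2) ≤ 2 * Real.log (1 + |x|) := by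
    have : 2 * Real.log (1 + |x|) = Real.log ((1 + |x|) ^ 2) := by rw [Real.log_pow]; norm_num
    rw [this]
    apply Real.log_le_log (by positivity)
    nlinarith [sq_abs x]
  have h5 : 0 < 1 / a := by positivity
  calc _ ≤ 2 * (1 / a * (2 * √(1 + |x| ^ a))) := by nlinarith
    _ = _ := by ring

lemma ww_log_integrable {a : ℝ} (ha : 0 < a) (ha1 : a ≤ 1) :
    Integrable (fun x => ww a x * Real.log (1 + x ^ 2)) := by
  refine ((w1_integrable ha).const_mul (4 / a)).mono' ?_ (Eventually.of_forall fun x => ?_)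
  · exact ((ww_measurable a).mul (by fun_prop)).aestronglyMeasurable
  · have h0 : 0 ≤ Real.log (1 + x ^ 2) := Real.log_nonneg (by nlinarith)
    rw [Real.norm_of_nonneg (mul_nonneg (ww_nonneg a x) h0)]
    refine (mul_le_mul_of_nonneg_left (log_le_sqrt ha ha1 x) (ww_nonneg a x)).trans (le_of_eq ?_)
    unfold ww w1
    have h1 : 0 < 1 + |x| ^ a := by positivity
    have h5 : 0 < √(1 + |x| ^ a) := by positivity
    have h4 : √(1 + |x| ^ a) ^ 2 = 1 + |x| ^ a := Real.sq_sqrt h1.le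
    field_simp
    rw [h4]

lemma abs_log_le {s : ℝ} (hs : 0 < s) (x y : ℝ) :
    |Real.log (|x - y|)| ≤ Real.log (1 + x ^ 2) + Real.log (1 + y ^ 2) + 1 / s * rind (-s) (x - y) := by
  have hl : ∀ x : ℝ, 0 ≤ Real.log (1 + x ^ 2) := fun x => Real.log_nonneg (by nlinarith)
  by_cases h : |x - y| < 1
  · have : rind (-s) (x - y) = |x - y| ^ (-s) := by
      unfold rind; rw [indicator_of_mem (show x - y ∈ Ioo (-1:ℝ) 1 from abs_lt.1 h)]
    rw [this]
    have h1 : |Real.log (|x - y|)| ≤ 1 / s * |x - y| ^ (-s) := by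
      rcases eq_or_lt_of_le (abs_nonneg (x - y)) with h0 | h0
      · rw [← h0]; simp; positivity
      · rw [abs_of_nonpos (Real.log_nonpos h0.le h.le)]
        have := Real.log_le_self (x := |x - y| ^ (-s)) (by positivity)
        rw [Real.log_rpow h0] at this
        rw [one_div, ← div_eq_inv_mul, le_div_iff₀ hs]; linarith
    linarith [hl x, hl y]
  · push Not at h
    rw [abs_of_nonneg (Real.log_nonneg h), ← Real.log_mul (by positivity) (by positivity)]
    have h1 : |x - y| ≤ (1 + x ^ 2) * (1 + y ^ 2) := by
      rw [abs_le]; constructor <;> nlinarith [sq_nonneg (x - 1), sq_nonneg (x + 1), sq_nonneg (y - 1), sq_nonneg (y + 1), mul_nonneg (sq_nonneg x) (sq_nonneg y)]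
    have h2 := Real.log_le_log (by linarith) h1
    have h3 : 0 ≤ 1 / s * rind (-s) (x - y) := mul_nonneg (by positivity) (rind_nonneg _ _)
    linarith

lemma rind_mul {a x y : ℝ} (ha : 0 < a) (ha1 : a ≤ 1) :
    rind (a - 1) y * rind (-(a / 2)) x ≤ rind (a / 2 - 1) y + rind (a / 2 - 1) x := by
  by_cases hx : x ∈ Ioo (-1:ℝ) 1
  · by_cases hy : y ∈ Ioo (-1:ℝ) 1
    · unfold rind
      simp only [indicator_of_mem hx, indicator_of_mem hy]
      rcases eq_or_lt_of_le (abs_nonneg x) with h0 | h0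
      · rw [← h0, Real.zero_rpow (by linarith), mul_zero]; positivity
      rcases eq_or_lt_of_le (abs_nonneg y) with h1 | h1
      · rw [← h1]
        by_cases h : a = 1
        · subst h
          norm_num
        · rw [Real.zero_rpow (by intro h'; apply h; linarith), zero_mul]; positivity
      rcases le_total (|x|) (|y|) with h | h
      · have e : |x| ^ (a / 2 - 1) = |x| ^ (a - 1) * |x| ^ (-(a / 2)) := by
          rw [← Real.rpow_add h0]; ring_nf
        have : |y| ^ (a - 1) ≤ |x| ^ (a - 1) := Real.rpow_le_rpow_of_nonpos h0 h (by linarith)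
        rw [e]
        have h2 : 0 ≤ |y| ^ (a / 2 - 1) := by positivity
        have h3 : 0 ≤ |x| ^ (-(a / 2)) := by positivity
        nlinarith
      · have e : |y| ^ (a / 2 - 1) = |y| ^ (a - 1) * |y| ^ (-(a / 2)) := by
          rw [← Real.rpow_add h1]; ring_nf
        have : |x| ^ (-(a / 2)) ≤ |y| ^ (-(a / 2)) := Real.rpow_le_rpow_of_nonpos h1 h (by linarith)
        rw [e]
        have h2 : 0 ≤ |x| ^ (a / 2 - 1) := by positivity
        have h3 : 0 ≤ |y| ^ (a - 1) := by positivity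
        nlinarith
    · have : rind (a - 1) y = 0 := by unfold rind; rw [indicator_of_notMem hy]
      rw [this, zero_mul]; exact add_nonneg (rind_nonneg _ _) (rind_nonneg _ _)
  · have : rind (-(a / 2)) x = 0 := by unfold rind; rw [indicator_of_notMem hx]
    rw [this, mul_zero]; exact add_nonneg (rind_nonneg _ _) (rind_nonneg _ _)

lemma rind_measurable (s : ℝ) : Measurable (rind s) := by
  unfold rind
  exact Measurable.indicator (by fun_prop) measurableSet_Ioo

lemma ww_mul_rind {a : ℝ} (ha : 0 < a) (ha1 : a ≤ 1) (x y : ℝ) :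
    ww a y * rind (-(a / 2)) (x - y) ≤ rind (a / 2 - 1) y + rind (a / 2 - 1) (x - y) + rind (-(a / 2)) (x - y) := by
  have h1 := (ww_le_hb a y).trans (hb_le ha1 y)
  have h2 := rind_mul (x := x - y) (y := y) ha ha1
  have h3 := rind_nonneg (-(a / 2)) (x - y)
  nlinarith

lemma ww_log_one {a : ℝ} (ha : 0 < a) (ha1 : a ≤ 1) (x : ℝ) :
    Integrable (fun y => ww a y * Real.log |x - y|) := by
  have i1 : Integrable (fun y => Real.log (1 + x ^ 2) * ww a y + ww a y * Real.log (1 + y ^ 2)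
      + 1 / (a / 2) * (rind (a / 2 - 1) y + rind (a / 2 - 1) (x - y) + rind (-(a / 2)) (x - y))) := by
    refine (((ww_integrable ha).const_mul _).add (ww_log_integrable ha ha1)).add (Integrable.const_mul ?_ _)
    have j1 := rind_integrable (a / 2 - 1) (by linarith)
    have j2 := rind_integrable (-(a / 2)) (by linarith)
    exact (j1.add (j1.comp_sub_left x)).add (j2.comp_sub_left x)
  refine i1.mono' ?_ (Eventually.of_forall fun y => ?_)
  · exact ((ww_measurable a).mul (by fun_prop)).aestronglyMeasurable
  · rw [Real.norm_eq_abs, abs_mul, abs_of_nonneg (ww_nonneg a y)]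
    have h1 := abs_log_le (s := a / 2) (by positivity) x y
    have h2 := mul_le_mul_of_nonneg_left h1 (ww_nonneg a y)
    have h3 := mul_le_mul_of_nonneg_left (ww_mul_rind ha ha1 x y) (show 0 ≤ 1 / (a / 2) by positivity)
    nlinarith

lemma ww_log_two {a : ℝ} (ha : 0 < a) (ha1 : a ≤ 1) :
    Integrable (fun p : ℝ × ℝ => ww a p.1 * ww a p.2 * Real.log |p.1 - p.2|) := by
  have conv : ∀ s : ℝ, -1 < s → Integrable (fun p : ℝ × ℝ => ww a p.1 * rind s (p.1 - p.2)) := by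
    intro s hs
    have := (Integrable.convolution_integrand (ContinuousLinearMap.mul ℝ ℝ) (ww_integrable ha) (rind_integrable s hs)).swap
    refine this.congr (Eventually.of_forall fun p => ?_)
    simp only [Function.comp, Prod.swap, ContinuousLinearMap.mul_apply']
    rw [← rind_neg]; ring_nf
  have w := ww_integrable ha
  have wl := ww_log_integrable ha ha1
  have i1 := (wl.mul_prod w).add (w.mul_prod wl)
  have i2 := ((w.mul_prod (rind_integrable (a / 2 - 1) (by linarith))).add (conv (a / 2 - 1) (by linarith))).add
    (conv (-(a / 2)) (by linarith))
  refine (i1.add (i2.const_mul (1 / (a / 2)))).mono' ?_ (Eventually.of_forall fun p => ?_)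
  · exact ((((ww_measurable a).comp measurable_fst).mul ((ww_measurable a).comp measurable_snd)).mul (by fun_prop)).aestronglyMeasurable
  · simp only [Pi.add_apply]
    rw [Real.norm_eq_abs, abs_mul, abs_of_nonneg (mul_nonneg (ww_nonneg a p.1) (ww_nonneg a p.2))]
    have h1 := abs_log_le (s := a / 2) (by positivity) p.1 p.2
    have h2 := mul_le_mul_of_nonneg_left h1 (mul_nonneg (ww_nonneg a p.1) (ww_nonneg a p.2))
    have h3 := mul_le_mul_of_nonneg_left (ww_mul_rind ha ha1 p.1 p.2) (show 0 ≤ 1 / (a / 2) * ww a p.1 from mul_nonneg (by positivity) (ww_nonneg a p.1))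
    nlinarith

end Onofri

namespace Onofri
open Set Filter Topology

noncomputable def psi (a θ x : ℝ) : ℝ := π / 2 - Real.arctan ((x ^ a + Real.cos θ) / Real.sin θ)

lemma psi_zero {a θ : ℝ} (ha : 0 < a) (h0 : 0 < θ) (h1 : θ < π) : psi a θ 0 = θ := by
  unfold psi
  rw [Real.zero_rpow ha.ne', zero_add]
  have : Real.cos θ / Real.sin θ = Real.tan (π / 2 - θ) := by
    rw [Real.tan_pi_div_two_sub, Real.tan_eq_sin_div_cos, inv_div]
  rw [this, Real.arctan_tan (by linarith) (by linarith)]; ring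

lemma psi_continuous {a : ℝ} (ha : 0 < a) (θ : ℝ) : Continuous (psi a θ) := by
  unfold psi
  have : Continuous (fun x : ℝ => x ^ a) := continuous_id.rpow_const (fun _ => Or.inr ha.le)
  fun_prop

lemma psi_hasDerivAt {a θ x : ℝ} (h0 : 0 < θ) (h1 : θ < π) (hx : 0 < x) :
    HasDerivAt (psi a θ) (-(π * a * gh a θ x)) x := by
  have hs := Real.sin_pos_of_pos_of_lt_pi h0 h1
  have h2 := (((hasDerivAt_rpow_const (p := a) (Or.inl hx.ne')).add_const (Real.cos θ)).div_const (Real.sin θ)).arctan.const_sub (π / 2)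
  refine h2.congr_deriv ?_
  unfold gh
  have hq := qf_pos (a := a) h0.le h1 hx.le
  have e : 1 + ((x ^ a + Real.cos θ) / Real.sin θ) ^ 2 = qf a θ x / Real.sin θ ^ 2 := by
    unfold qf
    field_simp
    nlinarith [Real.sin_sq_add_cos_sq θ]
  rw [e]
  field_simp

lemma psi_tendsto {a θ : ℝ} (ha : 0 < a) (h0 : 0 < θ) (h1 : θ < π) : Tendsto (psi a θ) atTop (𝓝 0) := by
  have hs := Real.sin_pos_of_pos_of_lt_pi h0 h1
  have h : Tendsto (fun x : ℝ => (x ^ a + Real.cos θ) / Real.sin θ) atTop atTop :=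
    (tendsto_atTop_add_const_right _ _ (tendsto_rpow_atTop ha)).atTop_div_const hs
  have h2 := ((Real.tendsto_arctan_atTop.mono_right nhdsWithin_le_nhds).comp h).const_sub (π / 2)
  simp only [sub_self] at h2
  exact h2

lemma psi_pos (a θ x : ℝ) : 0 < psi a θ x := by
  unfold psi; linarith [Real.arctan_lt_pi_div_two ((x ^ a + Real.cos θ) / Real.sin θ)]

lemma psi_lt_pi (a θ x : ℝ) : psi a θ x < π := by
  unfold psi; linarith [Real.neg_pi_div_two_lt_arctan ((x ^ a + Real.cos θ) / Real.sin θ)]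

lemma sin_psi {a θ x : ℝ} (h0 : 0 < θ) (h1 : θ < π) (hx : 0 ≤ x) :
    Real.log (Real.sin (psi a θ x)) = Real.log (Real.sin θ) - 1 / 2 * Real.log (qf a θ x) := by
  have hs := Real.sin_pos_of_pos_of_lt_pi h0 h1
  have hq := qf_pos (a := a) h0.le h1 hx
  unfold psi
  rw [Real.sin_pi_div_two_sub, Real.cos_arctan]
  have e : 1 + ((x ^ a + Real.cos θ) / Real.sin θ) ^ 2 = qf a θ x / Real.sin θ ^ 2 := by
    unfold qf
    field_simp
    nlinarith [Real.sin_sq_add_cos_sq θ]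
  rw [e, Real.log_div one_ne_zero (by positivity), Real.log_sqrt (by positivity), Real.log_div hq.ne' (by positivity),
    Real.log_pow, Real.log_one]
  push_cast; ring

lemma gh_int_Ioi {a θ y : ℝ} (ha : 0 < a) (h0 : 0 < θ) (h1 : θ < π) (hy : 0 ≤ y) :
    IntegrableOn (gh a θ) (Ioi y) ∧ ∫ x in Ioi y, gh a θ x = psi a θ y / (π * a) := by
  have hp := Real.pi_pos
  have hd : ∀ x ∈ Ioi y, HasDerivAt (fun x => -(psi a θ x / (π * a))) (gh a θ x) x := by
    intro x hx
    refine ((psi_hasDerivAt h0 h1 (lt_of_le_of_lt hy hx)).div_const (π * a)).neg.congr_deriv ?_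
    field_simp
  have hc : ContinuousWithinAt (fun x => -(psi a θ x / (π * a))) (Ici y) y :=
    ((psi_continuous ha θ).div_const _).neg.continuousWithinAt
  have hn : ∀ x ∈ Ioi y, 0 ≤ gh a θ x := fun x hx => by
    have hx : 0 < x := lt_of_le_of_lt hy hx
    have := qf_pos (a := a) h0.le h1 hx.le
    have := Real.sin_pos_of_pos_of_lt_pi h0 h1
    unfold gh; positivity
  have ht : Tendsto (fun x => -(psi a θ x / (π * a))) atTop (𝓝 0) := by
    simpa using ((psi_tendsto ha h0 h1).div_const (π * a)).neg
  refine ⟨integrableOn_Ioi_deriv_of_nonneg hc hd hn ht, ?_⟩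
  rw [integral_Ioi_of_hasDerivAt_of_nonneg hc hd hn ht]; ring

noncomputable def Lam (t : ℝ) : ℝ := ∫ s in (0:ℝ)..t, Real.log (Real.sin s)

lemma lsi (c d : ℝ) : IntervalIntegrable (fun s => Real.log (Real.sin s)) volume c d :=
  intervalIntegrable_log_sin

lemma Lam_continuous : Continuous Lam := intervalIntegral.continuous_primitive lsi 0

lemma Lam_hasDerivAt {t : ℝ} (h0 : 0 < t) (h1 : t < π) : HasDerivAt Lam (Real.log (Real.sin t)) t := by
  have hs := Real.sin_pos_of_pos_of_lt_pi h0 h1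
  refine intervalIntegral.integral_hasDerivAt_right (lsi 0 t) ?_ ?_
  · exact (Real.measurable_log.comp Real.measurable_sin).stronglyMeasurable.stronglyMeasurableAtFilter
  · exact (Real.continuousAt_log hs.ne').comp Real.continuous_sin.continuousAt

lemma gh_log_int {a θ : ℝ} (ha : 0 < a) (h0 : 0 < θ) (h1 : θ < π) :
    IntegrableOn (fun x => gh a θ x * Real.log (Real.sin (psi a θ x))) (Ioi 0) ∧
    ∫ x in Ioi (0:ℝ), gh a θ x * Real.log (Real.sin (psi a θ x)) = Lam θ / (π * a) := by
  have hp := Real.pi_pos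
  have hd : ∀ x ∈ Ioi (0:ℝ), HasDerivAt (fun x => -(Lam (psi a θ x) / (π * a))) (gh a θ x * Real.log (Real.sin (psi a θ x))) x := by
    intro x hx
    refine (((Lam_hasDerivAt (psi_pos a θ x) (psi_lt_pi a θ x)).comp x (psi_hasDerivAt h0 h1 hx)).div_const (π * a)).neg.congr_deriv ?_
    field_simp
  have hc : ContinuousWithinAt (fun x => -(Lam (psi a θ x) / (π * a))) (Ici 0) 0 :=
    ((Lam_continuous.comp (psi_continuous ha θ)).div_const _).neg.continuousWithinAt
  have hn : ∀ x ∈ Ioi (0:ℝ), gh a θ x * Real.log (Real.sin (psi a θ x)) ≤ 0 := fun x hx => by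
    have hx : 0 < x := hx
    have h2 := qf_pos (a := a) h0.le h1 hx.le
    have h3 := Real.sin_pos_of_pos_of_lt_pi h0 h1
    refine mul_nonpos_of_nonneg_of_nonpos (by unfold gh; positivity) ?_
    exact Real.log_nonpos (Real.sin_nonneg_of_nonneg_of_le_pi (psi_pos a θ x).le (psi_lt_pi a θ x).le) (Real.sin_le_one _)
  have ht : Tendsto (fun x => -(Lam (psi a θ x) / (π * a))) atTop (𝓝 0) := by
    have := (((Lam_continuous.tendsto 0).comp (psi_tendsto ha h0 h1)).div_const (π * a)).neg
    simpa [Lam] using this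
  refine ⟨integrableOn_Ioi_deriv_of_nonpos hc hd hn ht, ?_⟩
  rw [integral_Ioi_of_hasDerivAt_of_nonpos hc hd hn ht, psi_zero ha h0 h1]; ring

lemma gg_pos {a θ x : ℝ} (ha1 : a ≤ 1) (h0 : 0 < θ) (h1 : θ < π * a) (hx : x ≠ 0) : 0 < gg a θ x := by
  have hpa : π * a ≤ π := by nlinarith [Real.pi_pos]
  have hp := Real.pi_pos
  unfold gg
  split_ifs with h
  · have h2 := qf_pos (a := a) h0.le (by linarith) h.le
    have h3 := Real.sin_pos_of_pos_of_lt_pi h0 (by linarith)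
    unfold gh; positivity
  · have h : 0 < -x := by
      rcases lt_or_gt_of_ne hx with h' | h'
      · linarith
      · exact absurd h' h
    have h2 := qf_pos (a := a) (θ := π * a - θ) (by linarith) (by linarith) h.le
    have h3 := Real.sin_pos_of_pos_of_lt_pi (x := π * a - θ) (by linarith) (by linarith)
    unfold gh; positivity

lemma qq_pos {a θ x : ℝ} (ha1 : a ≤ 1) (h0 : 0 < θ) (h1 : θ < π * a) : 0 < qq a θ x := by
  have hpa : π * a ≤ π := by nlinarith [Real.pi_pos]
  unfold qq
  split_ifs with h
  · exact qf_pos (a := a) h0.le (by linarith) h.le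
  · exact qf_pos (a := a) (θ := π * a - θ) (by linarith) (by linarith) (by linarith)

lemma gg_integrable {a θ : ℝ} (ha : 0 < a) (ha1 : a ≤ 1) (h0 : 0 < θ) (h1 : θ < π * a) : Integrable (gg a θ) :=
  ((ww_integrable ha).const_mul (1 / c0 a θ)).mono' (gg_measurable a θ).aestronglyMeasurable
    (Eventually.of_forall fun x => by
      rw [Real.norm_of_nonneg (gg_le ha1 h0 h1 x).1]; exact (gg_le ha1 h0 h1 x).2)

lemma gg_eq_pos {a θ x : ℝ} (hx : 0 < x) : gg a θ x = gh a θ x := by simp [gg, hx]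
lemma gg_eq_neg {a θ x : ℝ} (hx : 0 < x) : gg a θ (-x) = gh a (π * a - θ) x := by
  simp [gg, hx.le]

lemma gg_integral {a θ : ℝ} (ha : 0 < a) (ha1 : a ≤ 1) (h0 : 0 < θ) (h1 : θ < π * a) : ∫ x, gg a θ x = 1 := by
  have hpa : π * a ≤ π := by nlinarith [Real.pi_pos]
  have hp := Real.pi_pos
  have i1 := gh_int_Ioi (y := 0) ha h0 (by linarith) le_rfl
  have i2 := gh_int_Ioi (y := 0) (θ := π * a - θ) ha (by linarith) (by linarith) le_rfl
  have e1 : EqOn (gg a θ) (gh a θ) (Ioi 0) := fun x hx => gg_eq_pos hx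
  have e2 : EqOn (fun x => gg a θ (-x)) (gh a (π * a - θ)) (Ioi 0) := fun x hx => gg_eq_neg hx
  have h := int_split (f := gg a θ) (i1.1.congr_fun e1.symm measurableSet_Ioi) (i2.1.congr_fun e2.symm measurableSet_Ioi)
  rw [h.2, setIntegral_congr_fun measurableSet_Ioi e1, setIntegral_congr_fun measurableSet_Ioi e2, i1.2, i2.2,
    psi_zero ha h0 (by linarith), psi_zero ha (by linarith) (by linarith)]
  field_simp; ring

/-- pointwise entropy density -/
noncomputable def ee (a θ x : ℝ) : ℝ := Real.log (gg a θ x) + (1 - a) * Real.log |x| + 1 / 2 * Real.log (qq a θ x)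

lemma ee_pos {a θ x : ℝ} (h0 : 0 < θ) (h1 : θ < π) (hx : 0 < x) :
    Real.log (gh a θ x) + (1 - a) * Real.log x + 1 / 2 * Real.log (qf a θ x) =
      Real.log (Real.sin (psi a θ x)) - Real.log π := by
  have hp := Real.pi_pos
  have h2 := qf_pos (a := a) h0.le h1 hx.le
  have h3 := Real.sin_pos_of_pos_of_lt_pi h0 h1
  rw [sin_psi h0 h1 hx.le]
  unfold gh
  rw [Real.log_mul (by positivity) (by positivity), Real.log_div (by positivity) (by positivity),
    Real.log_div (by positivity) (by positivity), Real.log_rpow hx]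
  ring

lemma ee_int {a θ : ℝ} (ha : 0 < a) (ha1 : a ≤ 1) (h0 : 0 < θ) (h1 : θ < π * a) :
    Integrable (fun x => gg a θ x * ee a θ x) ∧
    ∫ x, gg a θ x * ee a θ x = (Lam θ + Lam (π * a - θ)) / (π * a) - Real.log π := by
  have hpa : π * a ≤ π := by nlinarith [Real.pi_pos]
  have hp := Real.pi_pos
  have i1 := gh_log_int ha h0 (by linarith)
  have i2 := gh_log_int (θ := π * a - θ) ha (by linarith) (by linarith)
  have j1 := gh_int_Ioi (y := 0) ha h0 (by linarith) le_rfl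
  have j2 := gh_int_Ioi (y := 0) (θ := π * a - θ) ha (by linarith) (by linarith) le_rfl
  have e1 : EqOn (fun x => gg a θ x * ee a θ x) (fun x => gh a θ x * Real.log (Real.sin (psi a θ x)) - gh a θ x * Real.log π) (Ioi 0) := by
    intro x hx
    have hx : 0 < x := hx
    have := ee_pos (a := a) h0 (by linarith) hx
    simp only [ee, gg_eq_pos hx, qq, if_pos hx, abs_of_pos hx]
    rw [this]; ring
  have e2 : EqOn (fun x => gg a θ (-x) * ee a θ (-x)) (fun x => gh a (π * a - θ) x * Real.log (Real.sin (psi a (π * a - θ) x)) - gh a (π * a - θ) x * Real.log π) (Ioi 0) := by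
    intro x hx
    have hx : 0 < x := hx
    have := ee_pos (a := a) (θ := π * a - θ) (by linarith) (by linarith) hx
    simp only [ee, gg_eq_neg hx, qq, if_neg (show ¬ 0 < -x by linarith), abs_neg, neg_neg, abs_of_pos hx]
    rw [this]; ring
  have k1 : IntegrableOn (fun x => gh a θ x * Real.log (Real.sin (psi a θ x)) - gh a θ x * Real.log π) (Ioi 0) :=
    i1.1.sub (j1.1.mul_const _)
  have k2 : IntegrableOn (fun x => gh a (π * a - θ) x * Real.log (Real.sin (psi a (π * a - θ) x)) - gh a (π * a - θ) x * Real.log π) (Ioi 0) :=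
    i2.1.sub (j2.1.mul_const _)
  have h := int_split (f := fun x => gg a θ x * ee a θ x) (k1.congr_fun e1.symm measurableSet_Ioi) (k2.congr_fun e2.symm measurableSet_Ioi)
  refine ⟨h.1, ?_⟩
  rw [h.2, setIntegral_congr_fun measurableSet_Ioi e1, setIntegral_congr_fun measurableSet_Ioi e2,
    integral_sub i1.1 (j1.1.mul_const _), integral_sub i2.1 (j2.1.mul_const _), integral_mul_const, integral_mul_const,
    i1.2, i2.2, j1.2, j2.2,
    psi_zero ha h0 (by linarith), psi_zero ha (by linarith) (by linarith)]
  field_simp; ring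

lemma Lam_sym {t s : ℝ} (h0 : 0 < t) (hts : t ≤ s) (hs : s ≤ π / 2) : 2 * Lam s ≤ Lam t + Lam (2 * s - t) := by
  have hp := Real.pi_pos
  have e1 : Lam s - Lam t = ∫ u in t..s, Real.log (Real.sin u) :=
    intervalIntegral.integral_interval_sub_left (lsi 0 s) (lsi 0 t)
  have e2 : Lam (2 * s - t) - Lam s = ∫ u in s..(2 * s - t), Real.log (Real.sin u) :=
    intervalIntegral.integral_interval_sub_left (lsi 0 _) (lsi 0 s)
  have e3 : ∫ u in t..s, Real.log (Real.sin (2 * s - u)) = ∫ u in s..(2 * s - t), Real.log (Real.sin u) := by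
    rw [intervalIntegral.integral_comp_sub_left (fun u => Real.log (Real.sin u)) (2 * s)]
    congr 1; ring
  have h : ∫ u in t..s, Real.log (Real.sin u) ≤ ∫ u in t..s, Real.log (Real.sin (2 * s - u)) := by
    refine intervalIntegral.integral_mono_on hts (lsi t s) ?_ ?_
    · have := (lsi (2 * s - t) (2 * s - s)).comp_sub_left (2 * s)
      simpa using this
    · intro u hu
      refine Real.log_le_log (Real.sin_pos_of_pos_of_lt_pi (by linarith [hu.1]) (by linarith [hu.2])) ?_
      by_cases hc : 2 * s - u ≤ π / 2
      · exact Real.sin_le_sin_of_le_of_le_pi_div_two (by linarith [hu.1]) hc (by linarith [hu.2])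
      · rw [← Real.sin_pi_sub (2 * s - u)]
        exact Real.sin_le_sin_of_le_of_le_pi_div_two (by linarith [hu.1]) (by linarith) (by linarith [hu.2])
  linarith

lemma Lam_ineq {a θ : ℝ} (ha : 0 < a) (ha1 : a ≤ 1) (h0 : 0 < θ) (h1 : θ < π * a) :
    Lam (π * a / 2) + Lam (π * a - π * a / 2) ≤ Lam θ + Lam (π * a - θ) := by
  have hpa : π * a ≤ π := by nlinarith [Real.pi_pos]
  have e : π * a - π * a / 2 = π * a / 2 := by ring
  rw [e]
  rcases le_total θ (π * a / 2) with h | h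
  · have := Lam_sym h0 h (by linarith)
    have e2 : 2 * (π * a / 2) - θ = π * a - θ := by ring
    rw [e2] at this; linarith
  · have := Lam_sym (t := π * a - θ) (s := π * a / 2) (by linarith) (by linarith) (by linarith)
    have e2 : 2 * (π * a / 2) - (π * a - θ) = θ := by ring
    rw [e2] at this; linarith

end Onofri

namespace Onofri
open Set Filter Topology

noncomputable def UU (a θ x y : ℝ) : ℝ := ∫ s, gg a θ s * (1 / 2 * Real.log ((x - s) ^ 2 + y ^ 2))
noncomputable def VV (a θ x y : ℝ) : ℝ :=
  1 / a * Real.log ‖((x : ℂ) + y * Complex.I) ^ (a : ℂ) + Complex.exp (θ * Complex.I)‖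

variable {a θ : ℝ}

lemma gg_mul_int (ha1 : a ≤ 1) (h0 : 0 < θ) (h1 : θ < π * a) {k : ℝ → ℝ}
    (hk : AEStronglyMeasurable k) (hi : Integrable (fun x => ww a x * k x)) : Integrable (fun x => gg a θ x * k x) := by
  refine (hi.norm.const_mul (1 / c0 a θ)).mono' ((gg_measurable a θ).aestronglyMeasurable.mul hk) (Eventually.of_forall fun x => ?_)
  rw [norm_mul, norm_mul, Real.norm_of_nonneg (gg_le ha1 h0 h1 x).1, Real.norm_of_nonneg (ww_nonneg a x), ← mul_assoc]
  exact mul_le_mul_of_nonneg_right (gg_le ha1 h0 h1 x).2 (norm_nonneg _)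

lemma log_shift_bound (x s y : ℝ) (hy : 0 < y) :
    |Real.log ((x - s) ^ 2 + y ^ 2)| ≤ |Real.log (y ^ 2)| + Real.log (1 + s ^ 2) + Real.log (2 * x ^ 2 + 2 + y ^ 2) := by
  have hp : 0 < y ^ 2 := by positivity
  have l1 : Real.log (y ^ 2) ≤ Real.log ((x - s) ^ 2 + y ^ 2) := Real.log_le_log hp (by nlinarith [sq_nonneg (x - s)])
  have l2 : Real.log ((x - s) ^ 2 + y ^ 2) ≤ Real.log (1 + s ^ 2) + Real.log (2 * x ^ 2 + 2 + y ^ 2) := by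
    rw [← Real.log_mul (by positivity) (by positivity)]
    refine Real.log_le_log (by positivity) ?_
    nlinarith [sq_nonneg (x + s), mul_nonneg (sq_nonneg x) (sq_nonneg s), mul_nonneg (sq_nonneg y) (sq_nonneg s)]
  have l3 : 0 ≤ Real.log (1 + s ^ 2) := Real.log_nonneg (by nlinarith)
  have l4 : 0 ≤ Real.log (2 * x ^ 2 + 2 + y ^ 2) := Real.log_nonneg (by nlinarith)
  rw [abs_le]; constructor
  · linarith [neg_abs_le (Real.log (y ^ 2))]
  · linarith [abs_nonneg (Real.log (y ^ 2))]

lemma U_int (ha : 0 < a) (ha1 : a ≤ 1) (h0 : 0 < θ) (h1 : θ < π * a) (x y : ℝ) (hy : 0 < y) :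
    Integrable (fun s => gg a θ s * (1 / 2 * Real.log ((x - s) ^ 2 + y ^ 2))) := by
  refine gg_mul_int ha1 h0 h1 (by fun_prop : Measurable _).aestronglyMeasurable ?_
  have i : Integrable (fun s => (|Real.log (y ^ 2)| + Real.log (2 * x ^ 2 + 2 + y ^ 2)) * ww a s + ww a s * Real.log (1 + s ^ 2)) :=
    ((ww_integrable ha).const_mul _).add (ww_log_integrable ha ha1)
  refine i.mono' ((ww_measurable a).mul (by fun_prop)).aestronglyMeasurable (Eventually.of_forall fun s => ?_)
  rw [norm_mul, Real.norm_of_nonneg (ww_nonneg a s), Real.norm_eq_abs, abs_mul]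
  have h := log_shift_bound x s y hy
  have h2 : |(1:ℝ) / 2| * |Real.log ((x - s) ^ 2 + y ^ 2)| ≤ |Real.log ((x - s) ^ 2 + y ^ 2)| := by
    rw [abs_of_pos (by norm_num)]; linarith [abs_nonneg (Real.log ((x - s) ^ 2 + y ^ 2))]
  nlinarith [ww_nonneg a s]

lemma U_dy (ha : 0 < a) (ha1 : a ≤ 1) (h0 : 0 < θ) (h1 : θ < π * a) (x y : ℝ) (hy : 0 < y) :
    HasDerivAt (UU a θ x) (- (Hc a θ (x + y * Complex.I)).im) y := by
  have key := (hasDerivAt_integral_of_dominated_loc_of_deriv_le (μ := (volume : Measure ℝ)) (s := Ioi (y / 2)) (x₀ := y)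
    (F := fun y s => gg a θ s * (1 / 2 * Real.log ((x - s) ^ 2 + y ^ 2)))
    (F' := fun y s => gg a θ s * (y / ((s - x) ^ 2 + y ^ 2))) (bound := fun s => gg a θ s * (2 / y))
    (Ioi_mem_nhds (by linarith)) (Eventually.of_forall fun y => ?_) (U_int ha ha1 h0 h1 x y hy) ?_ ?_ ?_ ?_).2
  · rw [poisson_gg ha ha1 h0 h1 x y hy] at key; exact key
  · exact ((gg_measurable a θ).mul (by fun_prop)).aestronglyMeasurable
  · exact ((gg_measurable a θ).mul (by fun_prop)).aestronglyMeasurable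
  · refine Eventually.of_forall fun s t ht => ?_
    have ht : y / 2 < t := ht
    have ht0 : 0 < t := by linarith
    rw [norm_mul, Real.norm_of_nonneg (gg_le ha1 h0 h1 s).1, Real.norm_of_nonneg (by positivity)]
    refine mul_le_mul_of_nonneg_left ?_ (gg_le ha1 h0 h1 s).1
    rw [div_le_div_iff₀ (by positivity) hy]
    nlinarith [sq_nonneg (s - x)]
  · exact (gg_integrable ha ha1 h0 h1).mul_const _
  · refine Eventually.of_forall fun s t ht => ?_
    have ht : y / 2 < t := ht
    have ht0 : 0 < t := by linarith
    have hp : (x - s) ^ 2 + t ^ 2 ≠ 0 := by positivity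
    have h2 := (((((hasDerivAt_id t).pow 2).const_add ((x - s) ^ 2)).log hp).const_mul (1 / 2)).const_mul (gg a θ s)
    refine h2.congr_deriv ?_
    have e : (s - x) ^ 2 = (x - s) ^ 2 := by ring
    rw [e]; simp only [id, Pi.pow_apply]; push_cast; ring

lemma U_dx (ha : 0 < a) (ha1 : a ≤ 1) (h0 : 0 < θ) (h1 : θ < π * a) (x y : ℝ) (hy : 0 < y) :
    HasDerivAt (fun x => UU a θ x y) (∫ s, gg a θ s * ((x - s) / ((x - s) ^ 2 + y ^ 2))) x := by
  refine (hasDerivAt_integral_of_dominated_loc_of_deriv_le (μ := (volume : Measure ℝ)) (s := univ) (x₀ := x)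
    (F := fun x s => gg a θ s * (1 / 2 * Real.log ((x - s) ^ 2 + y ^ 2)))
    (F' := fun x s => gg a θ s * ((x - s) / ((x - s) ^ 2 + y ^ 2))) (bound := fun s => gg a θ s * (1 / y))
    univ_mem (Eventually.of_forall fun y => ?_) (U_int ha ha1 h0 h1 x y hy) ?_ ?_ ?_ ?_).2
  · exact ((gg_measurable a θ).mul (by fun_prop)).aestronglyMeasurable
  · exact ((gg_measurable a θ).mul (by fun_prop)).aestronglyMeasurable
  · refine Eventually.of_forall fun s t _ => ?_
    have hp : 0 < (t - s) ^ 2 + y ^ 2 := by positivity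
    rw [norm_mul, Real.norm_of_nonneg (gg_le ha1 h0 h1 s).1]
    refine mul_le_mul_of_nonneg_left ?_ (gg_le ha1 h0 h1 s).1
    rw [Real.norm_eq_abs, abs_div, abs_of_pos hp, div_le_div_iff₀ hp hy]
    have : |t - s| ^ 2 = (t - s) ^ 2 := sq_abs _
    nlinarith [sq_nonneg (|t - s| - y), abs_nonneg (t - s)]
  · exact (gg_integrable ha ha1 h0 h1).mul_const _
  · refine Eventually.of_forall fun s t _ => ?_
    have hp : (t - s) ^ 2 + y ^ 2 ≠ 0 := by positivity
    have h2 := (((((((hasDerivAt_id t).sub_const s).pow 2).add_const (y ^ 2)).log hp).const_mul (1 / 2)).const_mul (gg a θ s))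
    refine h2.congr_deriv ?_
    simp only [id, Pi.pow_apply]; push_cast; ring

lemma logden_hasDerivAt (ha : 0 < a) (ha1 : a ≤ 1) (h0 : 0 < θ) (h1 : θ < π * a) (z : ℂ) (hz : 0 < z.im) :
    HasDerivAt (fun z : ℂ => (1 / a : ℂ) * Complex.log (z ^ (a : ℂ) + Complex.exp (θ * Complex.I))) (Hc a θ z) z := by
  have hs : z ∈ Complex.slitPlane := Or.inr hz.ne'
  have hi := den_im_pos ha ha1 h0 h1 z hz
  have h2 := (((hasDerivAt_id z).cpow_const (c := (a : ℂ)) hs).add_const (Complex.exp (θ * Complex.I))).clog (Or.inr hi.ne')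
  refine (h2.const_mul (1 / a : ℂ)).congr_deriv ?_
  have hac : (a : ℂ) ≠ 0 := by exact_mod_cast ha.ne'
  unfold Hc
  simp only [id, mul_one]
  field_simp

lemma VV_eq (x y : ℝ) : VV a θ x y =
    ((1 / a : ℂ) * Complex.log (((x : ℂ) + y * Complex.I) ^ (a : ℂ) + Complex.exp (θ * Complex.I))).re := by
  have e : (1 / a : ℂ) = ((1 / a : ℝ) : ℂ) := by push_cast; ring
  rw [e, Complex.re_ofReal_mul, Complex.log_re]; rfl

lemma V_dy (ha : 0 < a) (ha1 : a ≤ 1) (h0 : 0 < θ) (h1 : θ < π * a) (x y : ℝ) (hy : 0 < y) :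
    HasDerivAt (VV a θ x) (- (Hc a θ (x + y * Complex.I)).im) y := by
  have h2 := logden_hasDerivAt ha ha1 h0 h1 (x + y * Complex.I) (by simpa using hy)
  have h3 : HasDerivAt (fun t : ℝ => (x : ℂ) + t * Complex.I) Complex.I y := by
    simpa using ((Complex.ofRealCLM.hasDerivAt (x := y)).mul_const Complex.I).const_add (x : ℂ)
  have h4 := Complex.reCLM.hasFDerivAt.comp_hasDerivAt y (h2.scomp y h3)
  have e : (VV a θ x) = (Complex.reCLM ∘ (fun z : ℂ => (1 / a : ℂ) * Complex.log (z ^ (a : ℂ) + Complex.exp (θ * Complex.I))) ∘ fun t : ℝ => (x : ℂ) + t * Complex.I) := by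
    funext t; rw [VV_eq]; rfl
  rw [e]
  refine h4.congr_deriv ?_
  simp

lemma V_dx (ha : 0 < a) (ha1 : a ≤ 1) (h0 : 0 < θ) (h1 : θ < π * a) (x y : ℝ) (hy : 0 < y) :
    HasDerivAt (fun x => VV a θ x y) ((Hc a θ (x + y * Complex.I)).re) x := by
  have h2 := logden_hasDerivAt ha ha1 h0 h1 (x + y * Complex.I) (by simpa using hy)
  have h3 : HasDerivAt (fun t : ℝ => (t : ℂ) + y * Complex.I) 1 x := by
    simpa using ((Complex.ofRealCLM.hasDerivAt (x := x))).add_const (y * Complex.I : ℂ)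
  have h4 := Complex.reCLM.hasFDerivAt.comp_hasDerivAt x (h2.scomp x h3)
  have e : (fun x => VV a θ x y) = (Complex.reCLM ∘ (fun z : ℂ => (1 / a : ℂ) * Complex.log (z ^ (a : ℂ) + Complex.exp (θ * Complex.I))) ∘ fun t : ℝ => (t : ℂ) + y * Complex.I) := by
    funext t; rw [VV_eq]; rfl
  rw [e]
  refine h4.congr_deriv ?_
  simp

lemma U_lim (ha : 0 < a) (ha1 : a ≤ 1) (h0 : 0 < θ) (h1 : θ < π * a) (x : ℝ) :
    Tendsto (fun y => UU a θ x y - Real.log y) atTop (𝓝 0) := by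
  have e : ∀ᶠ y in atTop, ∫ s, gg a θ s * (1 / 2 * Real.log (((x - s) / y) ^ 2 + 1)) = UU a θ x y - Real.log y := by
    filter_upwards [eventually_gt_atTop 0] with y hy
    have : Real.log y = ∫ s, gg a θ s * Real.log y := by
      rw [integral_mul_const, gg_integral ha ha1 h0 h1, one_mul]
    rw [this, UU, ← integral_sub (U_int ha ha1 h0 h1 x y hy) ((gg_integrable ha ha1 h0 h1).mul_const _)]
    congr 1; funext s
    have e1 : ((x - s) / y) ^ 2 + 1 = ((x - s) ^ 2 + y ^ 2) / y ^ 2 := by field_simp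
    rw [e1, Real.log_div (by positivity) (by positivity), Real.log_pow]; push_cast; ring
  refine Tendsto.congr' e ?_
  have : (0:ℝ) = ∫ s, gg a θ s * (1 / 2 * Real.log (0 ^ 2 + 1)) := by simp
  rw [this]
  refine tendsto_integral_filter_of_dominated_convergence (fun s => gg a θ s * (1 / 2 * Real.log ((x - s) ^ 2 + 1 ^ 2))) ?_ ?_
    (U_int ha ha1 h0 h1 x 1 one_pos) ?_
  · exact Eventually.of_forall fun y => ((gg_measurable a θ).mul (by fun_prop)).aestronglyMeasurable
  · filter_upwards [eventually_ge_atTop 1] with y hy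
    refine Eventually.of_forall fun s => ?_
    have hl : 0 ≤ Real.log (((x - s) / y) ^ 2 + 1) := Real.log_nonneg (by nlinarith [sq_nonneg ((x - s) / y)])
    rw [norm_mul, Real.norm_of_nonneg (gg_le ha1 h0 h1 s).1, Real.norm_of_nonneg (by positivity)]
    refine mul_le_mul_of_nonneg_left ?_ (gg_le ha1 h0 h1 s).1
    have hle : ((x - s) / y) ^ 2 ≤ (x - s) ^ 2 := by
      rw [div_pow]
      exact div_le_self (sq_nonneg _) (by nlinarith)
    have := Real.log_le_log (x := ((x - s) / y) ^ 2 + 1) (y := (x - s) ^ 2 + 1 ^ 2) (by positivity) (by linarith)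
    linarith
  · refine Eventually.of_forall fun s => ?_
    have h2 : Tendsto (fun y : ℝ => (x - s) / y) atTop (𝓝 0) := tendsto_const_nhds.div_atTop tendsto_id
    have h3 := (h2.pow 2).add_const 1
    exact (((Real.continuousAt_log (by norm_num)).tendsto.comp h3).const_mul (1 / 2)).const_mul _

lemma V_lim (ha : 0 < a) (ha1 : a ≤ 1) (h0 : 0 < θ) (h1 : θ < π * a) (x : ℝ) :
    Tendsto (fun y => VV a θ x y - Real.log y) atTop (𝓝 0) := by
  have hn : ∀ y : ℝ, ‖(x : ℂ) + y * Complex.I‖ = √(x ^ 2 + y ^ 2) := by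
    intro y; rw [Complex.norm_add_mul_I]
  have key : Tendsto (fun y : ℝ => ‖((x : ℂ) + y * Complex.I) ^ (a : ℂ) + Complex.exp (θ * Complex.I)‖ / y ^ a) atTop (𝓝 1) := by
    have t1 : Tendsto (fun y : ℝ => √((x / y) ^ 2 + 1) ^ a) atTop (𝓝 1) := by
      have h2 : Tendsto (fun y : ℝ => x / y) atTop (𝓝 0) := tendsto_const_nhds.div_atTop tendsto_id
      have h3 := ((h2.pow 2).add_const 1).sqrt
      have h4 := h3.rpow_const (p := a) (Or.inr ha.le)
      simpa using h4
    have t2 : Tendsto (fun y : ℝ => 1 / y ^ a) atTop (𝓝 0) := tendsto_const_nhds.div_atTop (tendsto_rpow_atTop ha)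
    have t3 := t1.sub t2
    have t4 := t1.add t2
    simp only [sub_zero, add_zero] at t3 t4
    have bd : ∀ᶠ y : ℝ in atTop, ‖((x : ℂ) + y * Complex.I) ^ (a : ℂ)‖ / y ^ a = √((x / y) ^ 2 + 1) ^ a := by
      filter_upwards [eventually_gt_atTop 0] with y hy
      rw [Complex.norm_cpow_real, hn, ← Real.div_rpow (by positivity) hy.le]
      congr 1
      have : (x / y) ^ 2 + 1 = (x ^ 2 + y ^ 2) / y ^ 2 := by field_simp
      rw [this, Real.sqrt_div (by positivity), Real.sqrt_sq hy.le]
    have hone : ‖Complex.exp (θ * Complex.I)‖ = 1 := Complex.norm_exp_ofReal_mul_I θ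
    refine tendsto_of_tendsto_of_tendsto_of_le_of_le' t3 t4 ?_ ?_
    · filter_upwards [bd, eventually_gt_atTop 0] with y hy hy0
      rw [← hy, ← sub_div]
      gcongr
      have := norm_sub_le (((x : ℂ) + y * Complex.I) ^ (a : ℂ) + Complex.exp (θ * Complex.I)) (Complex.exp (θ * Complex.I))
      rw [add_sub_cancel_right, hone] at this; linarith
    · filter_upwards [bd, eventually_gt_atTop 0] with y hy hy0
      rw [← hy, ← add_div]
      gcongr
      have := norm_add_le (((x : ℂ) + y * Complex.I) ^ (a : ℂ)) (Complex.exp (θ * Complex.I))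
      rw [hone] at this; linarith
  have h2 := (((Real.continuousAt_log one_ne_zero).tendsto.comp key).const_mul (1 / a))
  simp only [Real.log_one, mul_zero] at h2
  refine h2.congr' ?_
  filter_upwards [eventually_gt_atTop 0] with y hy
  have hp := den_im_pos ha ha1 h0 h1 (x + y * Complex.I) (by simpa using hy)
  have hne : ‖((x : ℂ) + y * Complex.I) ^ (a : ℂ) + Complex.exp (θ * Complex.I)‖ ≠ 0 := by
    intro h; rw [norm_eq_zero] at h; rw [h] at hp; simp at hp
  simp only [Function.comp]
  rw [Real.log_div hne (by positivity), Real.log_rpow hy, VV]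
  field_simp

lemma U_eq_V (ha : 0 < a) (ha1 : a ≤ 1) (h0 : 0 < θ) (h1 : θ < π * a) (x y : ℝ) (hy : 0 < y) :
    UU a θ x y = VV a θ x y := by
  have hd : ∀ t ∈ Ioi (0:ℝ), HasDerivAt (fun t => UU a θ x t - VV a θ x t) 0 t := fun t ht => by
    exact ((U_dy ha ha1 h0 h1 x t ht).sub (V_dy ha ha1 h0 h1 x t ht)).congr_deriv (sub_self _)
  have hc : ∀ t ∈ Ioi (0:ℝ), UU a θ x t - VV a θ x t = UU a θ x y - VV a θ x y := fun t ht =>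
    isOpen_Ioi.is_const_of_deriv_eq_zero isPreconnected_Ioi
      (fun t ht => (hd t ht).differentiableAt.differentiableWithinAt) (fun t ht => (hd t ht).deriv) ht hy
  have hl := (U_lim ha ha1 h0 h1 x).sub (V_lim ha ha1 h0 h1 x)
  have hl2 : Tendsto (fun t => UU a θ x t - Real.log t - (VV a θ x t - Real.log t)) atTop (𝓝 (UU a θ x y - VV a θ x y)) := by
    refine tendsto_const_nhds.congr' ?_
    filter_upwards [eventually_gt_atTop 0] with t ht
    rw [← hc t ht]; ring
  have := tendsto_nhds_unique hl hl2
  linarith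

lemma conj_gg (ha : 0 < a) (ha1 : a ≤ 1) (h0 : 0 < θ) (h1 : θ < π * a) (x y : ℝ) (hy : 0 < y) :
    ∫ s, gg a θ s * ((x - s) / ((x - s) ^ 2 + y ^ 2)) = (Hc a θ (x + y * Complex.I)).re := by
  have h2 := U_dx ha ha1 h0 h1 x y hy
  have e : (fun x => UU a θ x y) = fun x => VV a θ x y := funext fun x => U_eq_V ha ha1 h0 h1 x y hy
  rw [e] at h2
  exact h2.unique (V_dx ha ha1 h0 h1 x y hy)

lemma norm_den_real (x : ℝ) (hx : x ≠ 0) :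
    ‖(x : ℂ) ^ (a : ℂ) + Complex.exp (θ * Complex.I)‖ ^ 2 = qq a θ x := by
  have hx0 : (x : ℂ) ≠ 0 := by exact_mod_cast hx
  rw [cpow_polar _ hx0, den_polar]
  unfold qq qf
  split_ifs with h
  · rw [Complex.arg_ofReal_of_nonneg h.le, mul_zero, zero_sub, Real.cos_neg, Complex.norm_real, Real.norm_of_nonneg h.le]
  · have h : x < 0 := lt_of_le_of_ne (not_lt.1 h) hx
    rw [Complex.arg_ofReal_of_neg h, Complex.norm_real, Real.norm_of_nonpos h.le, mul_comm a π]

lemma potential (ha : 0 < a) (ha1 : a ≤ 1) (h0 : 0 < θ) (h1 : θ < π * a) (x : ℝ) (hx : x ≠ 0) :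
    ∫ s, gg a θ s * Real.log |x - s| = 1 / (2 * a) * Real.log (qq a θ x) := by
  have hq := qq_pos (x := x) ha1 h0 h1
  have l1 : Tendsto (fun y => UU a θ x y) (𝓝[>] 0) (𝓝 (∫ s, gg a θ s * Real.log |x - s|)) := by
    unfold UU
    refine tendsto_integral_filter_of_dominated_convergence
      (fun s => ‖gg a θ s * Real.log |x - s|‖ + gg a θ s * (1 / 2 * Real.log ((x - s) ^ 2 + 1 ^ 2))) ?_ ?_ ?_ ?_
    · exact Eventually.of_forall fun y => ((gg_measurable a θ).mul (by fun_prop)).aestronglyMeasurable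
    · filter_upwards [Ioo_mem_nhdsGT (show (0:ℝ) < 1 by norm_num)] with y hy
      have : ∀ᵐ s : ℝ, s ≠ x := by simp [ae_iff]
      filter_upwards [this] with s hs
      have hs' : 0 < |x - s| := abs_pos.2 (sub_ne_zero.2 hs.symm)
      have hg := (gg_le ha1 h0 h1 s).1
      rw [norm_mul, norm_mul (gg a θ s) (Real.log |x - s|), Real.norm_of_nonneg hg, ← mul_add]
      refine mul_le_mul_of_nonneg_left ?_ hg
      have hy0 := hy.1
      have e : 1 / 2 * Real.log ((x - s) ^ 2) = Real.log |x - s| := by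
        rw [← sq_abs, Real.log_pow]; push_cast; ring
      have hpos : 0 < (x - s) ^ 2 := by rw [← sq_abs]; positivity
      have b1 : Real.log ((x - s) ^ 2) ≤ Real.log ((x - s) ^ 2 + y ^ 2) := Real.log_le_log hpos (by nlinarith)
      have b2 : Real.log ((x - s) ^ 2 + y ^ 2) ≤ Real.log ((x - s) ^ 2 + 1 ^ 2) := Real.log_le_log (by positivity) (by nlinarith [hy.2])
      have b3 : 0 ≤ Real.log ((x - s) ^ 2 + 1 ^ 2) := Real.log_nonneg (by nlinarith)
      rw [Real.norm_eq_abs, Real.norm_eq_abs, abs_le]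
      have n1 := neg_abs_le (Real.log |x - s|)
      have n2 := abs_nonneg (Real.log |x - s|)
      generalize Real.log |x - s| = B at e n1 n2 ⊢
      generalize |B| = A at n1 n2 ⊢
      generalize Real.log ((x - s) ^ 2 + 1 ^ 2) = C at *
      generalize Real.log ((x - s) ^ 2 + y ^ 2) = D at *
      constructor
      · linarith
      · linarith
    · refine Integrable.add ?_ (U_int ha ha1 h0 h1 x 1 one_pos)
      exact (gg_mul_int ha1 h0 h1 (by fun_prop : Measurable fun s => Real.log |x - s|).aestronglyMeasurable (ww_log_one ha ha1 x)).norm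
    · have : ∀ᵐ s : ℝ, s ≠ x := by simp [ae_iff]
      filter_upwards [this] with s hs
      have hs' : x - s ≠ 0 := sub_ne_zero.2 hs.symm
      refine Tendsto.const_mul _ ?_
      have e : Real.log |x - s| = 1 / 2 * Real.log ((x - s) ^ 2 + 0 ^ 2) := by
        rw [← sq_abs]; simp
      rw [e]
      have hc : ContinuousAt (fun y : ℝ => 1 / 2 * Real.log ((x - s) ^ 2 + y ^ 2)) 0 := by
        refine ContinuousAt.mul continuousAt_const (ContinuousAt.log (by fun_prop) ?_)
        simpa using hs'
      exact hc.tendsto.mono_left nhdsWithin_le_nhds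
  have l2 : Tendsto (fun y => VV a θ x y) (𝓝[>] 0) (𝓝 (1 / (2 * a) * Real.log (qq a θ x))) := by
    have hne : ‖(x : ℂ) ^ (a : ℂ) + Complex.exp (θ * Complex.I)‖ ≠ 0 := by
      intro h
      have := norm_den_real (a := a) (θ := θ) x hx
      rw [h] at this; norm_num at this; linarith
    have h2 := (((cpow_line x hx (a : ℂ)).add_const (Complex.exp (θ * Complex.I))).norm.log hne).const_mul (1 / a)
    have e : 1 / (2 * a) * Real.log (qq a θ x) = 1 / a * Real.log ‖(x : ℂ) ^ (a : ℂ) + Complex.exp (θ * Complex.I)‖ := by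
      rw [← norm_den_real x hx, Real.log_pow]; push_cast; field_simp
    rw [e]; exact h2
  refine tendsto_nhds_unique l1 (l2.congr' ?_)
  filter_upwards [self_mem_nhdsWithin] with y hy
  exact (U_eq_V ha ha1 h0 h1 x y hy).symm

end Onofri

namespace Onofri
open Set Filter Topology

variable {a θ : ℝ}

lemma ker_bound (d ε : ℝ) (hε : 0 < ε) : |d / (d ^ 2 + ε ^ 2)| ≤ 1 / ε := by
  have hp : 0 < d ^ 2 + ε ^ 2 := by positivity
  rw [abs_div, abs_of_pos hp, div_le_div_iff₀ hp hε]
  have : |d| ^ 2 = d ^ 2 := sq_abs _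
  nlinarith [sq_nonneg (|d| - ε), abs_nonneg d]

lemma conj_sym (ha : 0 < a) (ha1 : a ≤ 1) (h0 : 0 < θ) (h1 : θ < π * a) (β : ℝ → ℝ) (hβ : Measurable β) (N : ℝ)
    (hN : ∀ x, |β x| ≤ N) (ε : ℝ) (hε : 0 < ε) :
    ∫ p : ℝ × ℝ, gg a θ p.1 * gg a θ p.2 * ((β p.1 - β p.2) * ((p.1 - p.2) / ((p.1 - p.2) ^ 2 + ε ^ 2))) =
      2 * ∫ x, gg a θ x * β x * (Hc a θ (x + ε * Complex.I)).re := by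
  have hg := gg_integrable ha ha1 h0 h1
  have hgm := gg_measurable a θ
  have hgb : Integrable (fun x => gg a θ x * β x) := by
    refine (hg.mul_const N).mono' (hgm.mul hβ).aestronglyMeasurable (Eventually.of_forall fun x => ?_)
    rw [norm_mul, Real.norm_of_nonneg (gg_le ha1 h0 h1 x).1]
    exact mul_le_mul_of_nonneg_left (hN x) (gg_le ha1 h0 h1 x).1
  set F : ℝ × ℝ → ℝ := fun p => (gg a θ p.1 * β p.1) * (gg a θ p.2 * ((p.1 - p.2) / ((p.1 - p.2) ^ 2 + ε ^ 2))) with hF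
  have hFi : Integrable F := by
    refine (((hgb.norm).mul_prod hg).mul_const (1 / ε)).mono' ?_ (Eventually.of_forall fun p => ?_)
    · have m1 : Measurable F := by
        have g1 : Measurable (fun p : ℝ × ℝ => gg a θ p.1) := hgm.comp measurable_fst
        have g2 : Measurable (fun p : ℝ × ℝ => gg a θ p.2) := hgm.comp measurable_snd
        have g3 : Measurable (fun p : ℝ × ℝ => β p.1) := hβ.comp measurable_fst
        exact (g1.mul g3).mul (g2.mul (by fun_prop))
      exact m1.aestronglyMeasurable
    · simp only [hF]
      rw [norm_mul, norm_mul (gg a θ p.2), Real.norm_of_nonneg (gg_le ha1 h0 h1 p.2).1, ← mul_assoc]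
      exact mul_le_mul_of_nonneg_left (ker_bound _ _ hε) (mul_nonneg (norm_nonneg _) (gg_le ha1 h0 h1 p.2).1)
  have hFint : ∫ p, F p = ∫ x, gg a θ x * β x * (Hc a θ (x + ε * Complex.I)).re := by
    rw [Measure.volume_eq_prod, integral_prod _ (by rw [← Measure.volume_eq_prod]; exact hFi)]
    congr 1; funext x
    simp only [hF]
    rw [integral_const_mul, conj_gg ha ha1 h0 h1 x ε hε]
  have hsw : ∫ p : ℝ × ℝ, F p.swap = ∫ p, F p := by
    rw [Measure.volume_eq_prod]; exact integral_prod_swap F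
  have hswi : Integrable (fun p : ℝ × ℝ => F p.swap) := by
    rw [Measure.volume_eq_prod] at hFi ⊢; exact hFi.swap
  have e : (fun p : ℝ × ℝ => gg a θ p.1 * gg a θ p.2 * ((β p.1 - β p.2) * ((p.1 - p.2) / ((p.1 - p.2) ^ 2 + ε ^ 2)))) =
      fun p => F p + F p.swap := by
    funext p
    simp only [hF, Prod.fst_swap, Prod.snd_swap]
    have : (p.2 - p.1) / ((p.2 - p.1) ^ 2 + ε ^ 2) = - ((p.1 - p.2) / ((p.1 - p.2) ^ 2 + ε ^ 2)) := by
      rw [← neg_div, neg_sub, ← neg_sub p.1 p.2, neg_sq, neg_sub]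
    rw [this]; ring
  rw [e, integral_add hFi hswi, hsw, hFint]; ring

noncomputable def clampN (N x : ℝ) : ℝ := max (-N) (min N x)

lemma clampN_lip (N x y : ℝ) : |clampN N x - clampN N y| ≤ |x - y| := by
  unfold clampN
  refine (abs_max_sub_max_le_max _ _ _ _).trans ?_
  rw [sub_self, abs_zero, max_eq_right (abs_nonneg _)]
  refine (abs_min_sub_min_le_max _ _ _ _).trans ?_
  rw [sub_self, abs_zero, max_eq_right (abs_nonneg _)]

lemma clampN_abs (N x : ℝ) (hN : 0 ≤ N) : |clampN N x| ≤ N := by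
  unfold clampN
  rw [abs_le]; exact ⟨le_max_left _ _, max_le (by linarith) (min_le_left _ _)⟩

lemma clampN_eq (N x : ℝ) (hN : |x| ≤ N) : clampN N x = x := by
  rw [abs_le] at hN
  unfold clampN
  rw [min_eq_right hN.2, max_eq_right hN.1]

lemma abs_mul_hb {x : ℝ} (hx : x ≠ 0) : |x| * hb a x ≤ 1 := by
  unfold hb
  have hp : 0 < |x| := abs_pos.2 hx
  have : |x| * |x| ^ (a - 1) = |x| ^ a := by
    rw [Real.rpow_sub_one hp.ne']; field_simp
  rw [← mul_div_assoc, this, div_le_one (by positivity)]; linarith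

lemma conj_lim (ha : 0 < a) (ha1 : a ≤ 1) (h0 : 0 < θ) (h1 : θ < π * a) (α : ℝ → ℝ) (K : ℝ)
    (hα : ∀ x y, |α x - α y| ≤ K * |x - y|) (hα0 : α 0 = 0) (hαm : Measurable α) :
    ∫ p : ℝ × ℝ, gg a θ p.1 * gg a θ p.2 * ((α p.1 - α p.2) / (p.1 - p.2)) = 2 * ∫ x, gg a θ x * α x * rr a θ x := by
  have hK : 0 ≤ K := by have := (abs_nonneg _).trans (hα 1 0); simpa using this
  have hg := gg_integrable ha ha1 h0 h1
  have hgm := gg_measurable a θ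
  have hg1 : Measurable (fun p : ℝ × ℝ => gg a θ p.1) := hgm.comp measurable_fst
  have hg2 : Measurable (fun p : ℝ × ℝ => gg a θ p.2) := hgm.comp measurable_snd
  have hcm : ∀ N : ℝ, Measurable (fun x => clampN N (α x)) := fun N => by unfold clampN; fun_prop
  have heq : ∀ n : ℕ, ∫ p : ℝ × ℝ, gg a θ p.1 * gg a θ p.2 * ((clampN n (α p.1) - clampN n (α p.2)) *
      ((p.1 - p.2) / ((p.1 - p.2) ^ 2 + (1 / ((n:ℝ) + 1)) ^ 2))) =
      2 * ∫ x, gg a θ x * clampN n (α x) * (Hc a θ (x + ((1 / ((n:ℝ) + 1) : ℝ)) * Complex.I)).re := fun n =>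
    conj_sym ha ha1 h0 h1 (fun x => clampN n (α x)) (hcm n) n (fun x => clampN_abs _ _ (by positivity)) _ (by positivity)
  have hev : ∀ x, ∀ᶠ n : ℕ in atTop, clampN n (α x) = α x := by
    intro x
    filter_upwards [(tendsto_natCast_atTop_atTop (R := ℝ)).eventually_ge_atTop |α x|] with n hn
    exact clampN_eq _ _ hn
  have heps : Tendsto (fun n : ℕ => 1 / ((n:ℝ) + 1)) atTop (𝓝 0) := tendsto_one_div_add_atTop_nhds_zero_nat
  have l1 : Tendsto (fun n : ℕ => ∫ p : ℝ × ℝ, gg a θ p.1 * gg a θ p.2 * ((clampN n (α p.1) - clampN n (α p.2)) *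
      ((p.1 - p.2) / ((p.1 - p.2) ^ 2 + (1 / ((n:ℝ) + 1)) ^ 2)))) atTop
      (𝓝 (∫ p : ℝ × ℝ, gg a θ p.1 * gg a θ p.2 * ((α p.1 - α p.2) / (p.1 - p.2)))) := by
    refine tendsto_integral_of_dominated_convergence (fun p => gg a θ p.1 * gg a θ p.2 * K) ?_ ?_ ?_ ?_
    · intro n
      have c1 : Measurable (fun p : ℝ × ℝ => clampN n (α p.1)) := (hcm n).comp measurable_fst
      have c2 : Measurable (fun p : ℝ × ℝ => clampN n (α p.2)) := (hcm n).comp measurable_snd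
      exact ((hg1.mul hg2).mul ((c1.sub c2).mul (by fun_prop))).aestronglyMeasurable
    · exact (hg.mul_prod hg).mul_const K
    · intro n
      refine Eventually.of_forall fun p => ?_
      have hgg := mul_nonneg (gg_le ha1 h0 h1 p.1).1 (gg_le ha1 h0 h1 p.2).1
      rw [norm_mul, Real.norm_of_nonneg hgg]
      refine mul_le_mul_of_nonneg_left ?_ hgg
      set d := p.1 - p.2
      have e1 : 0 < (1 / ((n:ℝ) + 1)) ^ 2 := by positivity
      have hp : 0 < d ^ 2 + (1 / ((n:ℝ) + 1)) ^ 2 := by positivity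
      have c := (clampN_lip n (α p.1) (α p.2)).trans (hα p.1 p.2)
      rw [norm_mul, Real.norm_eq_abs, Real.norm_eq_abs, abs_div, abs_of_pos hp, ← mul_div_assoc, div_le_iff₀ hp]
      have : |d| ^ 2 = d ^ 2 := sq_abs _
      calc _ ≤ K * |d| * |d| := mul_le_mul_of_nonneg_right c (abs_nonneg _)
        _ = K * d ^ 2 := by rw [← this]; ring
        _ ≤ _ := by nlinarith
    · refine Eventually.of_forall fun p => ?_
      refine Tendsto.const_mul _ ?_
      by_cases hd : p.1 - p.2 = 0
      · simp [hd]
      · have t1 : Tendsto (fun n : ℕ => (p.1 - p.2) / ((p.1 - p.2) ^ 2 + (1 / ((n:ℝ) + 1)) ^ 2)) atTop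
            (𝓝 ((p.1 - p.2) / ((p.1 - p.2) ^ 2 + 0 ^ 2))) :=
          tendsto_const_nhds.div ((heps.pow 2).const_add _) (by simpa using hd)
        have e : (α p.1 - α p.2) / (p.1 - p.2) = (α p.1 - α p.2) * ((p.1 - p.2) / ((p.1 - p.2) ^ 2 + 0 ^ 2)) := by
          field_simp; simp
        rw [e]
        refine (t1.const_mul (α p.1 - α p.2)).congr' ?_
        filter_upwards [hev p.1, hev p.2] with n e1 e2
        rw [e1, e2]
  have l2 : Tendsto (fun n : ℕ => ∫ x, gg a θ x * clampN n (α x) * (Hc a θ (x + ((1 / ((n:ℝ) + 1) : ℝ)) * Complex.I)).re) atTop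
      (𝓝 (∫ x, gg a θ x * α x * rr a θ x)) := by
    refine tendsto_integral_of_dominated_convergence (fun x => gg a θ x * (K * (1 / √(c0 a θ)))) ?_ ?_ ?_ ?_
    · intro n
      refine ((hgm.mul (hcm n)).mul ?_).aestronglyMeasurable
      unfold Hc; fun_prop
    · exact hg.mul_const _
    · intro n
      filter_upwards [ae_ne_zero] with x hx
      have hgx := (gg_le ha1 h0 h1 x).1
      rw [mul_assoc, norm_mul, Real.norm_of_nonneg hgx]
      refine mul_le_mul_of_nonneg_left ?_ hgx
      rw [norm_mul, Real.norm_eq_abs, Real.norm_eq_abs]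
      have c : |clampN n (α x)| ≤ K * |x| := by
        have c1 := (clampN_lip n (α x) (α 0)).trans (hα x 0)
        rwa [hα0, clampN_eq n 0 (by simp), sub_zero, sub_zero] at c1
      have hz : (x : ℂ) + ((1 / ((n:ℝ) + 1) : ℝ)) * Complex.I ≠ 0 := by
        intro h; have := congrArg Complex.re h; simp at this; exact hx this
      have d := ((Complex.abs_re_le_norm _).trans (Hc_norm_le ha ha1 h0 h1 _ hz (by rw [Complex.add_im, Complex.ofReal_im, Complex.im_ofReal_mul, Complex.I_im]; positivity))).trans
        (mul_le_mul_of_nonneg_left (hb_norm_line ha.le ha1 x _ hx) (by positivity))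
      calc _ ≤ K * |x| * (1 / √(c0 a θ) * hb a x) := mul_le_mul c d (abs_nonneg _) (by positivity)
        _ = K * (1 / √(c0 a θ)) * (|x| * hb a x) := by ring
        _ ≤ _ := mul_le_of_le_one_right (by positivity) (abs_mul_hb hx)
    · filter_upwards [ae_ne_zero] with x hx
      have t1 : Tendsto (fun n : ℕ => 1 / ((n:ℝ) + 1)) atTop (𝓝[>] 0) :=
        tendsto_nhdsWithin_iff.2 ⟨heps, Eventually.of_forall fun n => by simp only [mem_Ioi]; positivity⟩
      have t2 := Complex.continuous_re.continuousAt.tendsto.comp ((Hc_line ha ha1 h0 h1 x hx).comp t1)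
      rw [Hc_real ha1 h0 h1 x hx] at t2
      have e : (((rr a θ x : ℝ) : ℂ) - ((π * gg a θ x : ℝ) : ℂ) * Complex.I).re = rr a θ x := by simp
      rw [e] at t2
      refine (t2.const_mul (gg a θ x * α x)).congr' ?_
      filter_upwards [hev x] with n e1
      rw [e1]; rfl
  have l2' := l2.const_mul 2
  simp_rw [← heq] at l2'
  exact tendsto_nhds_unique l1 l2'

lemma gh_hasDerivAt (h0 : 0 < θ) (h1 : θ < π) {x : ℝ} (hx : 0 < x) :
    HasDerivAt (gh a θ) (gh a θ x * (-((1 - a) / x + 2 * a * rh a θ x))) x := by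
  have hq := qf_pos (a := a) h0.le h1 hx.le
  have d1 := Real.hasDerivAt_rpow_const (x := x) (p := a) (Or.inl hx.ne')
  have d2 := Real.hasDerivAt_rpow_const (x := x) (p := a - 1) (Or.inl hx.ne')
  have d3 : HasDerivAt (qf a θ) (2 * (x ^ a) * (a * x ^ (a - 1)) + 2 * (a * x ^ (a - 1)) * Real.cos θ) x := by
    refine (((d1.pow 2).add ((d1.const_mul 2).mul_const (Real.cos θ))).add_const 1).congr_deriv ?_
    push_cast; ring
  refine ((d2.div d3 hq.ne').const_mul (Real.sin θ / π)).congr_deriv ?_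
  unfold gh rh
  have e2 : x ^ (a - 1 - 1) = x ^ (a - 1) / x := Real.rpow_sub_one hx.ne' _
  rw [e2]
  have hq' := hq.ne'
  field_simp
  ring

lemma mul_ww_le {x : ℝ} (hx : 0 < x) : x * ww a x ≤ x ^ a ∧ x * ww a x ≤ (x ^ a)⁻¹ ∧ x * ww a x ≤ 1 := by
  unfold ww
  rw [abs_of_pos hx]
  have : x * x ^ (a - 1) = x ^ a := by
    rw [Real.rpow_sub_one hx.ne']; field_simp
  rw [← mul_div_assoc, this]
  have hp : 0 < x ^ a := by positivity
  set X := x ^ a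
  refine ⟨div_le_self hp.le (by nlinarith), ?_, ?_⟩
  · rw [div_le_iff₀ (by positivity), inv_mul_eq_div, le_div_iff₀ hp]; nlinarith
  · rw [div_le_one (by positivity)]; nlinarith

lemma half_ident (ha : 0 < a) (ha1 : a ≤ 1) (h0 : 0 < θ) (h1 : θ < π) (α m : ℝ → ℝ) (K : ℝ) (hK : 0 ≤ K)
    (hα : ∀ x, 0 < x → |α x| ≤ K * x) (hα0 : α 0 = 0) (hαm : Measurable α) (hm : Measurable m)
    (hmb : ∀ x, |m x| ≤ K) (hd : ∀ x, 0 < x → HasDerivAt α (m x) x) :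
    ∫ x in Ioi (0:ℝ), gh a θ x * m x = ∫ x in Ioi (0:ℝ), gh a θ x * (α x * ((1 - a) / x + 2 * a * rh a θ x)) := by
  have hg : IntegrableOn (gh a θ) (Ioi 0) := (gh_int_Ioi ha h0 h1 le_rfl).1
  have hgm := gh_measurable a θ
  have hcos : 0 < (1 + Real.cos θ) / 2 := by
    have := Real.cos_lt_cos_of_nonneg_of_le_pi h0.le le_rfl h1
    rw [Real.cos_pi] at this; linarith
  set c := (1 + Real.cos θ) / 2 with hc
  have hgle : ∀ x, 0 ≤ x → 0 ≤ gh a θ x ∧ gh a θ x ≤ 1 / c * ww a x := fun x hx =>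
    gh_le h0.le h1 hx hcos le_rfl
  have hrh : ∃ R, 0 ≤ R ∧ ∀ x, 0 < x → x * |rh a θ x| ≤ R := by
    refine ⟨1 / c, by positivity, fun x hx => ?_⟩
    have hp : 0 < x ^ a := by positivity
    have e : x * |rh a θ x| = x ^ a * |x ^ a + Real.cos θ| / qf a θ x := by
      unfold rh
      rw [abs_div, abs_of_pos (qf_pos h0.le h1 hx.le), abs_mul, abs_of_pos (by positivity : 0 < x ^ (a - 1)),
        Real.rpow_sub_one hx.ne']
      field_simp
    rw [e, div_le_div_iff₀ (qf_pos h0.le h1 hx.le) hcos]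
    unfold qf
    set X := x ^ a
    have hcu := Real.cos_le_one θ
    have hcl := Real.neg_one_le_cos θ
    have hab : |X + Real.cos θ| ≤ X + 1 := by rw [abs_le]; constructor <;> linarith
    have : X * |X + Real.cos θ| * c ≤ X * (X + 1) * c := by gcongr
    rw [hc] at this ⊢
    nlinarith [sq_nonneg (X - 1), mul_nonneg hp.le (sub_nonneg.2 hcu), mul_nonneg hp.le (by linarith : 0 ≤ 1 + Real.cos θ)]
  obtain ⟨R, hR0, hR⟩ := hrh
  have i1 : IntegrableOn (fun x => gh a θ x * m x) (Ioi 0) := by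
    refine (hg.mul_const K).mono' (hgm.mul hm).aestronglyMeasurable ?_
    filter_upwards [ae_restrict_mem measurableSet_Ioi] with x hx
    rw [norm_mul, Real.norm_of_nonneg (hgle x (le_of_lt hx)).1]
    exact mul_le_mul_of_nonneg_left (hmb x) (hgle x (le_of_lt hx)).1
  have i2 : IntegrableOn (fun x => gh a θ x * (α x * ((1 - a) / x + 2 * a * rh a θ x))) (Ioi 0) := by
    refine (hg.mul_const (K * (1 + 2 * a * R))).mono' ?_ ?_
    · refine (hgm.mul (hαm.mul ?_)).aestronglyMeasurable
      have := rh_measurable a θ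
      fun_prop
    · filter_upwards [ae_restrict_mem measurableSet_Ioi] with x hx
      have hx : 0 < x := hx
      rw [norm_mul, Real.norm_of_nonneg (hgle x hx.le).1]
      refine mul_le_mul_of_nonneg_left ?_ (hgle x hx.le).1
      rw [norm_mul, Real.norm_eq_abs, Real.norm_eq_abs]
      have t : x * |(1 - a) / x + 2 * a * rh a θ x| ≤ 1 + 2 * a * R := by
        have t1 : |(1 - a) / x + 2 * a * rh a θ x| ≤ (1 - a) / x + 2 * a * |rh a θ x| := by
          refine (abs_add_le _ _).trans ?_
          rw [abs_of_nonneg (div_nonneg (by linarith) hx.le), abs_mul, abs_of_pos (by positivity : 0 < 2 * a)]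
        have t2 := mul_le_mul_of_nonneg_left t1 hx.le
        have t3 : x * ((1 - a) / x) = 1 - a := by field_simp
        have t4 := hR x hx
        nlinarith
      calc _ ≤ K * x * |(1 - a) / x + 2 * a * rh a θ x| := mul_le_mul_of_nonneg_right (hα x hx) (abs_nonneg _)
        _ = K * (x * |(1 - a) / x + 2 * a * rh a θ x|) := by ring
        _ ≤ _ := mul_le_mul_of_nonneg_left t hK
  have hbound : ∀ x, 0 < x → |gh a θ x * α x| ≤ 1 / c * K * (x * ww a x) := fun x hx => by
    rw [abs_mul, abs_of_nonneg (hgle x hx.le).1]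
    calc _ ≤ 1 / c * ww a x * (K * x) := mul_le_mul (hgle x hx.le).2 (hα x hx) (abs_nonneg _) (mul_nonneg (by positivity) (ww_nonneg a x))
      _ = _ := by ring
  have hFTC := integral_Ioi_of_hasDerivAt_of_tendsto (a := (0:ℝ)) (f := fun x => gh a θ x * α x) (m := 0)
    (f' := fun x => gh a θ x * m x - gh a θ x * (α x * ((1 - a) / x + 2 * a * rh a θ x))) ?_ ?_ (i1.sub i2) ?_
  · rw [integral_sub i1 i2, hα0, mul_zero, sub_zero] at hFTC
    linarith
  · rw [← continuousWithinAt_Ioi_iff_Ici]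
    unfold ContinuousWithinAt
    simp only [hα0, mul_zero]
    refine squeeze_zero_norm' (a := fun x => 1 / c * K * x ^ a) ?_ ?_
    · filter_upwards [self_mem_nhdsWithin] with x hx
      exact (hbound x hx).trans (mul_le_mul_of_nonneg_left (mul_ww_le hx).1 (by positivity))
    · have : Tendsto (fun x : ℝ => 1 / c * K * x ^ a) (𝓝 0) (𝓝 (1 / c * K * 0 ^ a)) :=
        ((Real.continuous_rpow_const ha.le).tendsto 0).const_mul _
      rw [Real.zero_rpow ha.ne', mul_zero] at this
      exact this.mono_left nhdsWithin_le_nhds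
  · intro x hx
    refine ((gh_hasDerivAt h0 h1 hx).mul (hd x hx)).congr_deriv ?_
    ring
  · refine squeeze_zero_norm' (a := fun x => 1 / c * K * (x ^ a)⁻¹) ?_ ?_
    · filter_upwards [eventually_gt_atTop 0] with x hx
      exact (hbound x hx).trans (mul_le_mul_of_nonneg_left (mul_ww_le hx).2.1 (by positivity))
    · have := ((tendsto_rpow_atTop ha).inv_tendsto_atTop).const_mul (1 / c * K)
      rw [mul_zero] at this; exact this

lemma rr_eq_pos {x : ℝ} (hx : 0 < x) : rr a θ x = rh a θ x := by simp [rr, hx]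
lemma rr_eq_neg {x : ℝ} (hx : 0 < x) : rr a θ (-x) = -rh a (π * a - θ) x := by simp [rr, hx.le]

lemma identI (ha : 0 < a) (ha1 : a ≤ 1) (h0 : 0 < θ) (h1 : θ < π * a) (α m : ℝ → ℝ) (K : ℝ)
    (hα : ∀ x y, |α x - α y| ≤ K * |x - y|) (hα0 : α 0 = 0) (hαm : Measurable α) (hm : Measurable m)
    (hmb : ∀ x, |m x| ≤ K) (hd : ∀ x, x ≠ 0 → HasDerivAt α (m x) x) :
    a * (∫ p : ℝ × ℝ, gg a θ p.1 * gg a θ p.2 * ((α p.1 - α p.2) / (p.1 - p.2))) + (1 - a) * ∫ x, gg a θ x * (α x / x)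
      = ∫ x, gg a θ x * m x := by
  have hK : 0 ≤ K := (abs_nonneg _).trans (hmb 0)
  have hpa : π * a ≤ π := by nlinarith [Real.pi_pos]
  have hg := gg_integrable ha ha1 h0 h1
  have hgm := gg_measurable a θ
  have hαx : ∀ x, |α x| ≤ K * |x| := fun x => by simpa [hα0] using hα x 0
  have i1 : Integrable (fun x => gg a θ x * m x) := by
    refine (hg.mul_const K).mono' (hgm.mul hm).aestronglyMeasurable (Eventually.of_forall fun x => ?_)
    rw [norm_mul, Real.norm_of_nonneg (gg_le ha1 h0 h1 x).1]
    exact mul_le_mul_of_nonneg_left (hmb x) (gg_le ha1 h0 h1 x).1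
  have i2 : Integrable (fun x => gg a θ x * (α x / x)) := by
    refine (hg.mul_const K).mono' (hgm.mul (by fun_prop)).aestronglyMeasurable ?_
    filter_upwards [ae_ne_zero] with x hx
    rw [norm_mul, Real.norm_of_nonneg (gg_le ha1 h0 h1 x).1]
    refine mul_le_mul_of_nonneg_left ?_ (gg_le ha1 h0 h1 x).1
    rw [Real.norm_eq_abs, abs_div, div_le_iff₀ (abs_pos.2 hx)]; exact hαx x
  have i3 : Integrable (fun x => gg a θ x * α x * rr a θ x) := by
    refine (hg.mul_const (K * (1 / √(c0 a θ)))).mono' ((hgm.mul hαm).mul (rr_measurable a θ)).aestronglyMeasurable ?_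
    filter_upwards [ae_ne_zero] with x hx
    rw [mul_assoc, norm_mul, Real.norm_of_nonneg (gg_le ha1 h0 h1 x).1]
    refine mul_le_mul_of_nonneg_left ?_ (gg_le ha1 h0 h1 x).1
    rw [norm_mul, Real.norm_eq_abs, Real.norm_eq_abs]
    calc _ ≤ K * |x| * (1 / √(c0 a θ) * hb a x) := mul_le_mul (hαx x) (rr_le ha ha1 h0 h1 x hx) (abs_nonneg _) (by positivity)
      _ = K * (1 / √(c0 a θ)) * (|x| * hb a x) := by ring
      _ ≤ _ := mul_le_of_le_one_right (by positivity) (abs_mul_hb hx)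
  have key : ∫ x, gg a θ x * m x = ∫ x, ((1 - a) * (gg a θ x * (α x / x)) + 2 * a * (gg a θ x * α x * rr a θ x)) := by
    have i4 : Integrable (fun x => (1 - a) * (gg a θ x * (α x / x)) + 2 * a * (gg a θ x * α x * rr a θ x)) :=
      (i2.const_mul _).add (i3.const_mul _)
    rw [(int_split i1.integrableOn i1.comp_neg.integrableOn).2, (int_split i4.integrableOn i4.comp_neg.integrableOn).2]
    have e1 := half_ident ha ha1 h0 (h1.trans_le hpa) α m K hK (fun x hx => by simpa [abs_of_pos hx] using hαx x) hα0 hαm hm hmb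
      (fun x hx => hd x hx.ne')
    have e2 := half_ident (θ := π * a - θ) ha ha1 (by linarith) (by linarith) (fun x => α (-x)) (fun x => -m (-x)) K hK
      (fun x hx => by simpa [abs_of_pos hx] using hαx (-x)) (by simpa using hα0) (hαm.comp measurable_neg)
      (hm.comp measurable_neg).neg (fun x => by simpa using hmb (-x))
      (fun x hx => by
        have := (hd (-x) (by linarith [hx] : -x < 0).ne).comp x (hasDerivAt_neg x)
        exact this.congr_deriv (by ring))
    congr 1
    · rw [setIntegral_congr_fun measurableSet_Ioi (g := fun x => gh a θ x * m x) (fun x hx => by simp only [gg_eq_pos hx]), e1]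
      refine setIntegral_congr_fun measurableSet_Ioi fun x hx => ?_
      simp only [gg_eq_pos hx, rr_eq_pos hx]; ring
    · have e3 : ∫ x in Ioi (0:ℝ), gg a θ (-x) * m (-x) = - ∫ x in Ioi (0:ℝ), gh a (π * a - θ) x * -m (-x) := by
        rw [← integral_neg]
        refine setIntegral_congr_fun measurableSet_Ioi fun x hx => ?_
        simp only [gg_eq_neg hx]; ring
      rw [e3, e2, ← integral_neg]
      refine setIntegral_congr_fun measurableSet_Ioi fun x hx => ?_
      simp only [gg_eq_neg hx, rr_eq_neg hx, div_neg]; ring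
  rw [key, integral_add (i2.const_mul _) (i3.const_mul _), integral_const_mul, integral_const_mul,
    conj_lim ha ha1 h0 h1 α K hα hα0 hαm]
  ring

end Onofri

namespace Onofri
open Set Filter Topology

variable {a : ℝ}

structure Adm (a C : ℝ) (f : ℝ → ℝ) : Prop where
  meas : Measurable f
  int : Integrable f
  cont : ∀ x, x ≠ 0 → ContinuousAt f x
  lower : ∀ x, x ≠ 0 → ww a x ≤ C * f x
  upper : ∀ x, x ≠ 0 → f x ≤ C * ww a x

lemma ww_neg (x : ℝ) : ww a (-x) = ww a x := by unfold ww; rw [abs_neg]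
lemma ww_pos {x : ℝ} (hx : x ≠ 0) : 0 < ww a x := by
  have := abs_pos.2 hx
  unfold ww; positivity

lemma Adm.neg {C : ℝ} {f : ℝ → ℝ} (h : Adm a C f) : Adm a C (fun x => f (-x)) where
  meas := h.meas.comp measurable_neg
  int := h.int.comp_neg
  cont := fun x hx => (h.cont (-x) (neg_ne_zero.2 hx)).comp (f := fun x => -x) continuous_neg.continuousAt
  lower := fun x hx => by rw [← ww_neg]; exact h.lower _ (neg_ne_zero.2 hx)
  upper := fun x hx => by rw [← ww_neg]; exact h.upper _ (neg_ne_zero.2 hx)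

lemma Adm.pos {C : ℝ} (hC : 0 < C) {f : ℝ → ℝ} (h : Adm a C f) {x : ℝ} (hx : x ≠ 0) : 0 < f x := by
  have := (ww_pos (a := a) hx).trans_le (h.lower x hx)
  exact pos_of_mul_pos_right this hC.le

lemma ww_tail (ha : 0 < a) {x : ℝ} (hx : 0 ≤ x) : ∫ t in Ioi x, ww a t = 1 / a * (1 / (1 + x ^ a)) := by
  have h := integral_Ioi_of_hasDerivAt_of_tendsto (a := x) (f := fun t => - (1 / a * (1 / (1 + t ^ a)))) (f' := ww a) (m := 0)
    ?_ ?_ (ww_integrable ha).integrableOn ?_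
  · rw [h]; ring
  · refine ContinuousAt.continuousWithinAt ?_
    have : 1 + x ^ a ≠ 0 := by positivity
    have c : ContinuousAt (fun t : ℝ => t ^ a) x := Real.continuousAt_rpow_const _ _ (Or.inr ha.le)
    exact ((continuousAt_const.div (continuousAt_const.add c) this).const_mul _).neg
  · intro t ht
    have ht : 0 < t := lt_of_le_of_lt hx ht
    have hp : 1 + t ^ a ≠ 0 := by positivity
    have d1 := Real.hasDerivAt_rpow_const (x := t) (p := a) (Or.inl ht.ne')
    have d2 := ((((d1.const_add 1).inv hp)).const_mul (1 / a)).neg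
    simp only [one_div] at d2 ⊢
    refine d2.congr_deriv ?_
    unfold ww
    rw [abs_of_pos ht]
    field_simp
  · have t1 : Tendsto (fun t : ℝ => 1 + t ^ a) atTop atTop := tendsto_atTop_add_const_left _ _ (tendsto_rpow_atTop ha)
    have t2 := (((tendsto_const_nhds (x := (1:ℝ))).div_atTop t1).const_mul (1 / a)).neg
    simpa using t2

lemma ww_head (ha : 0 < a) {x : ℝ} (hx : 0 ≤ x) : ∫ t in Ioc 0 x, ww a t = 1 / a * (x ^ a / (1 + x ^ a)) := by
  have h1 := ww_tail ha hx
  have h2 := ww_tail ha (le_refl (0:ℝ))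
  have h3 : ∫ t in Ioi (0:ℝ), ww a t = (∫ t in Ioc 0 x, ww a t) + ∫ t in Ioi x, ww a t := by
    rw [← Ioc_union_Ioi_eq_Ioi hx]
    exact setIntegral_union (by rw [Set.disjoint_left]; intro t h1 h2; exact absurd h1.2 (not_le.2 h2)) measurableSet_Ioi
      (ww_integrable ha).integrableOn (ww_integrable ha).integrableOn
  rw [h1, h2, Real.zero_rpow ha.ne'] at h3
  have : (0:ℝ) < 1 + x ^ a := by positivity
  have e : x ^ a / (1 + x ^ a) = 1 - 1 / (1 + x ^ a) := by field_simp; ring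
  rw [e]; linarith

lemma ww_comp (ha : 0 < a) {x ξ R : ℝ} (hx : 0 < x) (hξ : 0 < ξ) (hR : 1 ≤ R)
    (h1 : x ^ a / (1 + x ^ a) ≤ R * (ξ ^ a / (1 + ξ ^ a))) (h2 : ξ ^ a / (1 + ξ ^ a) ≤ R * (x ^ a / (1 + x ^ a)))
    (h3 : 1 / (1 + x ^ a) ≤ R * (1 / (1 + ξ ^ a))) (h4 : 1 / (1 + ξ ^ a) ≤ R * (1 / (1 + x ^ a))) :
    ww a ξ ≤ R ^ 4 * (R ^ 2) ^ (1 / a) * ww a x := by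
  have hu : 0 < x ^ a := by positivity
  have hs : 0 < ξ ^ a := by positivity
  have hxx : x ≤ (R ^ 2) ^ (1 / a) * ξ := by
    have k : x ^ a ≤ R ^ 2 * ξ ^ a := by
      rw [mul_div_assoc', div_le_div_iff₀ (by positivity) (by positivity)] at h1
      rw [mul_div_assoc', div_le_div_iff₀ (by positivity) (by positivity)] at h4
      set u := x ^ a
      set s := ξ ^ a
      have h4' : 1 + u ≤ R * (1 + s) := by linarith
      have : u * (1 + s) ≤ R * s * (R * (1 + s)) := h1.trans (mul_le_mul_of_nonneg_left h4' (by positivity))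
      have h5 : u * (1 + s) ≤ R ^ 2 * s * (1 + s) := by linarith
      exact le_of_mul_le_mul_right h5 (by positivity)
    have k2 := Real.rpow_le_rpow hu.le k (by positivity : 0 ≤ 1 / a)
    rw [Real.mul_rpow (by positivity) hs.le, ← Real.rpow_mul hx.le, ← Real.rpow_mul hξ.le, mul_one_div_cancel ha.ne',
      Real.rpow_one, Real.rpow_one] at k2
    exact k2
  set Q := (R ^ 2) ^ (1 / a) with hQ
  have hQ0 : 0 < Q := by positivity
  unfold ww
  rw [abs_of_pos hx, abs_of_pos hξ, Real.rpow_sub_one hx.ne', Real.rpow_sub_one hξ.ne']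
  set u := x ^ a
  set s := ξ ^ a
  have e1 : s / ξ / (1 + s) ^ 2 = (s / (1 + s)) * (1 / (1 + s)) * (1 / ξ) := by field_simp
  have e2 : u / x / (1 + u) ^ 2 = (u / (1 + u)) * (1 / (1 + u)) * (1 / x) := by field_simp
  have h5 : 1 / ξ ≤ Q * (1 / x) := by
    rw [mul_one_div, div_le_div_iff₀ hξ hx]; linarith
  rw [e1, e2]
  have hR0 : 0 < R := by linarith
  calc _ ≤ (R * (u / (1 + u))) * (R * (1 / (1 + u))) * (Q * (1 / x)) := by gcongr
    _ = R ^ 2 * (Q * ((u / (1 + u)) * (1 / (1 + u)) * (1 / x))) := by ring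
    _ ≤ R ^ 4 * (Q * ((u / (1 + u)) * (1 / (1 + u)) * (1 / x))) := by
        refine mul_le_mul_of_nonneg_right ?_ (by positivity)
        exact pow_le_pow_right₀ hR (by norm_num)
    _ = _ := by ring

lemma half_comp (ha : 0 < a) {C : ℝ} (hC : 1 ≤ C) {f g : ℝ → ℝ} (hf : Adm a C f) (hg : Adm a C g) {x ξ : ℝ}
    (hx : 0 < x) (hξ : 0 < ξ) (h1 : ∫ t in Ioc 0 x, f t = ∫ t in Ioc 0 ξ, g t) (h2 : ∫ t in Ioi x, f t = ∫ t in Ioi ξ, g t) :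
    ww a ξ ≤ (C ^ 2) ^ 4 * ((C ^ 2) ^ 2) ^ (1 / a) * ww a x := by
  have hC0 : 0 < C := by linarith
  have hW := ww_integrable ha
  have lo : ∀ {f : ℝ → ℝ} (_ : Adm a C f) {s : Set ℝ}, MeasurableSet s → (∀ t ∈ s, 0 < t) →
      ∫ t in s, ww a t ≤ C * ∫ t in s, f t := by
    intro f hf s hs hp
    rw [← integral_const_mul]
    exact setIntegral_mono_on hW.integrableOn (hf.int.const_mul C).integrableOn hs (fun t ht => hf.lower t (hp t ht).ne')
  have up : ∀ {f : ℝ → ℝ} (_ : Adm a C f) {s : Set ℝ}, MeasurableSet s → (∀ t ∈ s, 0 < t) →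
      ∫ t in s, f t ≤ C * ∫ t in s, ww a t := by
    intro f hf s hs hp
    rw [← integral_const_mul]
    exact setIntegral_mono_on hf.int.integrableOn (hW.const_mul C).integrableOn hs (fun t ht => hf.upper t (hp t ht).ne')
  have key : ∀ {f g : ℝ → ℝ} (_ : Adm a C f) (_ : Adm a C g) {s s' : Set ℝ}, MeasurableSet s → (∀ t ∈ s, 0 < t) →
      MeasurableSet s' → (∀ t ∈ s', 0 < t) → ∫ t in s, f t = ∫ t in s', g t →
      ∫ t in s, ww a t ≤ C ^ 2 * ∫ t in s', ww a t := by
    intro f g hf hg s s' h1 h2 h3 h4 h5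
    have k1 := lo hf h1 h2
    have k2 := up hg h3 h4
    rw [h5] at k1
    nlinarith
  have hp1 : ∀ {x : ℝ}, ∀ t ∈ Ioc 0 x, 0 < t := fun t ht => ht.1
  have hp2 : ∀ {x : ℝ}, 0 < x → ∀ t ∈ Ioi x, 0 < t := fun hx t ht => lt_trans hx ht
  have a1 := key hf hg measurableSet_Ioc hp1 measurableSet_Ioc hp1 h1
  have a2 := key hg hf measurableSet_Ioc hp1 measurableSet_Ioc hp1 h1.symm
  have a3 := key hf hg measurableSet_Ioi (hp2 hx) measurableSet_Ioi (hp2 hξ) h2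
  have a4 := key hg hf measurableSet_Ioi (hp2 hξ) measurableSet_Ioi (hp2 hx) h2.symm
  rw [ww_head ha hx.le, ww_head ha hξ.le] at a1 a2
  rw [ww_tail ha hx.le, ww_tail ha hξ.le] at a3 a4
  have hia : 0 < 1 / a := by positivity
  refine ww_comp ha hx hξ (by nlinarith) ?_ ?_ ?_ ?_
  · exact le_of_mul_le_mul_left (by linarith) hia
  · exact le_of_mul_le_mul_left (by linarith) hia
  · exact le_of_mul_le_mul_left (by linarith) hia
  · exact le_of_mul_le_mul_left (by linarith) hia

end Onofri

namespace Onofri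
open Set Filter Topology

variable {a C : ℝ} {f g : ℝ → ℝ}

noncomputable def prim (f : ℝ → ℝ) (x : ℝ) : ℝ := ∫ t in (0:ℝ)..x, f t

lemma prim_zero : prim f 0 = 0 := by simp [prim]

lemma Adm.ii (hf : Adm a C f) (x y : ℝ) : IntervalIntegrable f volume x y := hf.int.intervalIntegrable

lemma Adm.prim_deriv (hf : Adm a C f) {x : ℝ} (hx : x ≠ 0) : HasDerivAt (prim f) (f x) x :=
  intervalIntegral.integral_hasDerivAt_right (hf.ii 0 x) hf.meas.stronglyMeasurable.stronglyMeasurableAtFilter (hf.cont x hx)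

lemma Adm.prim_cont (hf : Adm a C f) : Continuous (prim f) := intervalIntegral.continuous_primitive hf.ii 0

lemma mono_off_zero {F F' : ℝ → ℝ} (hc : Continuous F) (hd : ∀ x, x ≠ 0 → HasDerivAt F (F' x) x)
    (hF : ∀ x, x ≠ 0 → 0 ≤ F' x) : Monotone F := by
  refine MonotoneOn.Iic_union_Ici (a := 0) ?_ ?_
  · refine monotoneOn_of_deriv_nonneg (convex_Iic 0) hc.continuousOn ?_ ?_
    · rw [interior_Iic]; exact fun x hx => (hd x (ne_of_lt hx)).differentiableAt.differentiableWithinAt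
    · rw [interior_Iic]; intro x hx; rw [(hd x (ne_of_lt hx)).deriv]; exact hF x (ne_of_lt hx)
  · refine monotoneOn_of_deriv_nonneg (convex_Ici 0) hc.continuousOn ?_ ?_
    · rw [interior_Ici]; exact fun x hx => (hd x (ne_of_gt hx)).differentiableAt.differentiableWithinAt
    · rw [interior_Ici]; intro x hx; rw [(hd x (ne_of_gt hx)).deriv]; exact hF x (ne_of_gt hx)

lemma strictMono_off_zero {F F' : ℝ → ℝ} (hc : Continuous F) (hd : ∀ x, x ≠ 0 → HasDerivAt F (F' x) x)
    (hF : ∀ x, x ≠ 0 → 0 < F' x) : StrictMono F := by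
  refine StrictMonoOn.Iic_union_Ici (a := 0) ?_ ?_
  · refine strictMonoOn_of_deriv_pos (convex_Iic 0) hc.continuousOn ?_
    rw [interior_Iic]; intro x hx; rw [(hd x (ne_of_lt hx)).deriv]; exact hF x (ne_of_lt hx)
  · refine strictMonoOn_of_deriv_pos (convex_Ici 0) hc.continuousOn ?_
    rw [interior_Ici]; intro x hx; rw [(hd x (ne_of_gt hx)).deriv]; exact hF x (ne_of_gt hx)

lemma Adm.prim_mono (hC : 0 < C) (hf : Adm a C f) : StrictMono (prim f) :=
  strictMono_off_zero hf.prim_cont (fun _ hx => hf.prim_deriv hx) (fun _ hx => hf.pos hC hx)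

lemma Adm.top (hf : Adm a C f) : Tendsto (prim f) atTop (𝓝 (∫ t in Ioi (0:ℝ), f t)) :=
  intervalIntegral_tendsto_integral_Ioi 0 hf.int.integrableOn tendsto_id

lemma Adm.bot (hf : Adm a C f) : Tendsto (prim f) atBot (𝓝 (-∫ t in Iic (0:ℝ), f t)) := by
  have := (intervalIntegral_tendsto_integral_Iic 0 hf.int.integrableOn (tendsto_id (x := atBot))).neg
  refine this.congr fun x => ?_
  unfold prim; rw [intervalIntegral.integral_symm]; simp

lemma Adm.exists_eq (hC : 0 < C) (hf : Adm a C f) (hg : Adm a C g) (hp : ∫ t in Ioi (0:ℝ), f t = ∫ t in Ioi (0:ℝ), g t)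
    (hm : ∫ t in Iic (0:ℝ), f t = ∫ t in Iic (0:ℝ), g t) (ξ : ℝ) : ∃ x, prim f x = prim g ξ := by
  have hgm := hg.prim_mono hC
  have u : prim g ξ < ∫ t in Ioi (0:ℝ), f t := by
    rw [hp]
    exact (hgm (by linarith : ξ < ξ + 1)).trans_le (hgm.monotone.ge_of_tendsto hg.top _)
  have l : -∫ t in Iic (0:ℝ), f t < prim g ξ := by
    rw [hm]
    exact (hgm.monotone.le_of_tendsto hg.bot (ξ - 1)).trans_lt (hgm (by linarith : ξ - 1 < ξ))
  obtain ⟨y, hy⟩ := (Tendsto.eventually_const_lt u hf.top).exists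
  obtain ⟨z, hz⟩ := (Tendsto.eventually_lt_const l hf.bot).exists
  exact mem_range_of_exists_le_of_exists_ge hf.prim_cont ⟨z, hz.le⟩ ⟨y, hy.le⟩

lemma exists_T (hC : 0 < C) (hf : Adm a C f) (hg : Adm a C g) (hp : ∫ t in Ioi (0:ℝ), f t = ∫ t in Ioi (0:ℝ), g t)
    (hm : ∫ t in Iic (0:ℝ), f t = ∫ t in Iic (0:ℝ), g t) :
    ∃ T : ℝ → ℝ, StrictMono T ∧ Continuous T ∧ Function.Surjective T ∧ T 0 = 0 ∧ ∀ ξ, prim f (T ξ) = prim g ξ := by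
  choose T hT using hf.exists_eq hC hg hp hm
  have hfm := hf.prim_mono hC
  have hgm := hg.prim_mono hC
  have h1 : StrictMono T := fun x y h => by
    rw [← hfm.lt_iff_lt, hT, hT]; exact hgm h
  have h2 : Function.Surjective T := fun x => by
    obtain ⟨ξ, hξ⟩ := hg.exists_eq hC hf hp.symm hm.symm x
    refine ⟨ξ, hfm.injective ?_⟩
    rw [hT, hξ]
  refine ⟨T, h1, h1.monotone.continuous_of_surjective h2, h2, hfm.injective ?_, hT⟩
  rw [hT, prim_zero, prim_zero]

lemma implicit_deriv {F P T : ℝ → ℝ} {F' P' ξ : ℝ} (hT : ContinuousAt T ξ) (hTi : Function.Injective T)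
    (hF : HasDerivAt F F' (T ξ)) (hP : HasDerivAt P P' ξ) (hF' : F' ≠ 0) (he : ∀ t, F (T t) = P t) :
    HasDerivAt T (P' / F') ξ := by
  rw [hasDerivAt_iff_tendsto_slope] at hF hP ⊢
  have t1 : Tendsto T (𝓝[≠] ξ) (𝓝[≠] (T ξ)) :=
    tendsto_nhdsWithin_iff.2 ⟨hT.tendsto.mono_left nhdsWithin_le_nhds, by
      filter_upwards [self_mem_nhdsWithin] with t ht
      exact fun h => ht (hTi h)⟩
  have t2 := hF.comp t1
  refine (hP.div t2 hF').congr' ?_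
  have hne : ∀ᶠ t in 𝓝[≠] ξ, (slope F (T ξ) ∘ T) t ≠ 0 := t2.eventually_ne hF'
  filter_upwards [self_mem_nhdsWithin, hne] with t ht h2
  have ht : t - ξ ≠ 0 := sub_ne_zero.2 ht
  simp only [Function.comp, slope_def_field, Pi.div_apply] at h2 ⊢
  rw [he, he] at h2 ⊢
  have h3 : P t - P ξ ≠ 0 := fun h => h2 (by rw [h, zero_div])
  have h4 : T t - T ξ ≠ 0 := fun h => h2 (by rw [h, div_zero])
  field_simp

lemma prim_head {x : ℝ} (hx : 0 < x) : prim f x = ∫ t in Ioc 0 x, f t := intervalIntegral.integral_of_le hx.le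

lemma Adm.prim_tail (hf : Adm a C f) {x : ℝ} (hx : 0 < x) : ∫ t in Ioi x, f t = (∫ t in Ioi (0:ℝ), f t) - prim f x := by
  rw [← Ioc_union_Ioi_eq_Ioi hx.le, setIntegral_union _ measurableSet_Ioi hf.int.integrableOn hf.int.integrableOn, prim_head hx]
  · ring
  · rw [Set.disjoint_left]; intro t h1 h2; exact absurd h1.2 (not_le.2 h2)

lemma prim_neg (x : ℝ) : prim (fun t => f (-t)) x = - prim f (-x) := by
  unfold prim
  rw [intervalIntegral.integral_comp_neg, neg_zero, intervalIntegral.integral_symm]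

lemma tail_neg : ∫ t in Ioi (0:ℝ), f (-t) = ∫ t in Iic (0:ℝ), f t := by
  have := integral_comp_neg_Ioi (0:ℝ) f
  rwa [neg_zero] at this

lemma comp_pos (ha : 0 < a) (hC : 1 ≤ C) (hf : Adm a C f) (hg : Adm a C g)
    (hp : ∫ t in Ioi (0:ℝ), f t = ∫ t in Ioi (0:ℝ), g t) {x ξ : ℝ} (hx : 0 < x) (hξ : 0 < ξ) (he : prim f x = prim g ξ) :
    ww a ξ ≤ (C ^ 2) ^ 4 * ((C ^ 2) ^ 2) ^ (1 / a) * ww a x := by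
  refine half_comp ha hC hf hg hx hξ ?_ ?_
  · rw [← prim_head hx, ← prim_head hξ, he]
  · rw [hf.prim_tail hx, hg.prim_tail hξ, he, hp]

lemma comp_all (ha : 0 < a) (hC : 1 ≤ C) (hf : Adm a C f) (hg : Adm a C g)
    (hp : ∫ t in Ioi (0:ℝ), f t = ∫ t in Ioi (0:ℝ), g t)
    (hm : ∫ t in Iic (0:ℝ), f t = ∫ t in Iic (0:ℝ), g t) {x ξ : ℝ} (hx : ξ ≠ 0) (he : prim f x = prim g ξ) :
    ww a ξ ≤ (C ^ 2) ^ 4 * ((C ^ 2) ^ 2) ^ (1 / a) * ww a x ∧ ww a x ≤ (C ^ 2) ^ 4 * ((C ^ 2) ^ 2) ^ (1 / a) * ww a ξ := by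
  have hC0 : 0 < C := by linarith
  have hfm := hf.prim_mono hC0
  have hgm := hg.prim_mono hC0
  rcases lt_or_gt_of_ne hx with h | h
  · have hx : x < 0 := by
      rw [← hfm.lt_iff_lt, he, prim_zero, ← prim_zero (f := g)]; exact hgm h
    have e : prim (fun t => f (-t)) (-x) = prim (fun t => g (-t)) (-ξ) := by
      rw [prim_neg, prim_neg, neg_neg, neg_neg, he]
    have q : ∫ t in Ioi (0:ℝ), f (-t) = ∫ t in Ioi (0:ℝ), g (-t) := by rw [tail_neg, tail_neg, hm]
    have k1 := comp_pos ha hC hf.neg hg.neg q (neg_pos.2 hx) (neg_pos.2 h) e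
    have k2 := comp_pos ha hC hg.neg hf.neg q.symm (neg_pos.2 h) (neg_pos.2 hx) e.symm
    rw [ww_neg, ww_neg] at k1 k2
    exact ⟨k1, k2⟩
  · have hx : 0 < x := by
      rw [← hfm.lt_iff_lt, he, prim_zero, ← prim_zero (f := g)]; exact hgm h
    exact ⟨comp_pos ha hC hf hg hp hx h he, comp_pos ha hC hg hf hp.symm h hx he.symm⟩

structure Trans (f g T m α : ℝ → ℝ) (L : ℝ) : Prop where
  inj : Function.Injective T
  surj : Function.Surjective T
  cont : Continuous T
  zero : T 0 = 0
  deriv : ∀ x, x ≠ 0 → HasDerivAt T (Real.exp (m x)) x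
  dens : ∀ x, x ≠ 0 → Real.exp (m x) * f (T x) = g x
  mm : Measurable m
  mb : ∀ x, |m x| ≤ L
  αzero : α 0 = 0
  αlip : ∀ x y, |α x - α y| ≤ L * |x - y|
  αderiv : ∀ x, x ≠ 0 → HasDerivAt α (m x) x
  lower : ∀ x y, x ≠ y → Real.log |x - y| + (α x - α y) / (x - y) ≤ Real.log |T x - T y|
  upper : ∀ x y, x ≠ y → Real.log |T x - T y| ≤ Real.log |x - y| + L

lemma exists_trans (ha : 0 < a) (hC : 1 ≤ C) (hf : Adm a C f) (hg : Adm a C g)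
    (hp : ∫ t in Ioi (0:ℝ), f t = ∫ t in Ioi (0:ℝ), g t)
    (hm : ∫ t in Iic (0:ℝ), f t = ∫ t in Iic (0:ℝ), g t) : ∃ T m α L, Trans f g T m α L := by
  have hC0 : 0 < C := by linarith
  obtain ⟨T, hT1, hT2, hT3, hT4, hT5⟩ := exists_T hC0 hf hg hp hm
  have hTne : ∀ {x}, x ≠ 0 → T x ≠ 0 := fun hx h => hx (hT1.injective (h.trans hT4.symm))
  set M := (C ^ 2) ^ 4 * ((C ^ 2) ^ 2) ^ (1 / a) with hM
  have hM0 : 0 < M := by positivity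
  set B := C ^ 2 * M with hB
  have hB0 : 0 < B := by positivity
  have hB1 : 1 ≤ B := by
    have h1 : 1 ≤ C ^ 2 := by nlinarith
    have h2 : 1 ≤ ((C ^ 2) ^ 2) ^ (1 / a) := Real.one_le_rpow (by nlinarith) (by positivity)
    have h3 : 1 ≤ (C ^ 2) ^ 4 := one_le_pow₀ h1
    have h4 : 1 ≤ M := by rw [hM]; nlinarith
    nlinarith
  set L := Real.log B with hL
  have hL0 : 0 ≤ L := Real.log_nonneg hB1
  have hr0 : ∀ x, x ≠ 0 → 0 < g x / f (T x) := fun x hx => div_pos (hg.pos hC0 hx) (hf.pos hC0 (hTne hx))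
  have hru : ∀ x, x ≠ 0 → g x / f (T x) ≤ B := fun x hx => by
    have k := (comp_all ha hC hf hg hp hm hx (hT5 x)).1
    rw [div_le_iff₀ (hf.pos hC0 (hTne hx))]
    calc g x ≤ C * ww a x := hg.upper x hx
      _ ≤ C * (M * ww a (T x)) := by gcongr
      _ ≤ C * (M * (C * f (T x))) := by have := hf.lower _ (hTne hx); gcongr
      _ = _ := by rw [hB]; ring
  have hrl : ∀ x, x ≠ 0 → B⁻¹ ≤ g x / f (T x) := fun x hx => by
    have k := (comp_all ha hC hf hg hp hm hx (hT5 x)).2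
    rw [le_div_iff₀ (hf.pos hC0 (hTne hx)), inv_mul_le_iff₀ hB0]
    calc f (T x) ≤ C * ww a (T x) := hf.upper _ (hTne hx)
      _ ≤ C * (M * ww a x) := by gcongr
      _ ≤ C * (M * (C * g x)) := by have := hg.lower _ hx; gcongr
      _ = _ := by rw [hB]; ring
  set m : ℝ → ℝ := fun x => if x = 0 then 0 else Real.log (g x / f (T x)) with hmdef
  have hmne : ∀ x, x ≠ 0 → m x = Real.log (g x / f (T x)) := fun x hx => by simp [hmdef, hx]
  have hexp : ∀ x, x ≠ 0 → Real.exp (m x) = g x / f (T x) := fun x hx => by rw [hmne x hx, Real.exp_log (hr0 x hx)]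
  have hmm : Measurable m :=
    Measurable.ite (measurableSet_singleton 0) measurable_const (hg.meas.div (hf.meas.comp hT2.measurable)).log
  have hmb : ∀ x, |m x| ≤ L := fun x => by
    by_cases hx : x = 0
    · simp [hmdef, hx, hL0]
    · rw [hmne x hx, abs_le]
      constructor
      · rw [hL, ← Real.log_inv]; exact Real.log_le_log (by positivity) (hrl x hx)
      · exact Real.log_le_log (hr0 x hx) (hru x hx)
  have hmc : ∀ x, x ≠ 0 → ContinuousAt m x := fun x hx => by
    have c : ContinuousAt (fun x => Real.log (g x / f (T x))) x :=
      ((hg.cont x hx).div ((hf.cont _ (hTne hx)).comp hT2.continuousAt) (hf.pos hC0 (hTne hx)).ne').log (hr0 x hx).ne'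
    refine c.congr ?_
    filter_upwards [isOpen_ne.mem_nhds hx] with t ht
    exact (hmne t ht).symm
  have hd : ∀ x, x ≠ 0 → HasDerivAt T (Real.exp (m x)) x := fun x hx => by
    rw [hexp x hx]
    exact implicit_deriv hT2.continuousAt hT1.injective (hf.prim_deriv (hTne hx)) (hg.prim_deriv hx) (hf.pos hC0 (hTne hx)).ne' hT5
  have hmi : ∀ x y, IntervalIntegrable m volume x y := fun x y => by
    rw [intervalIntegrable_iff]
    exact Measure.integrableOn_of_bounded (M := L) (by simp) hmm.aestronglyMeasurable (Eventually.of_forall hmb)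
  have hαd : ∀ x, x ≠ 0 → HasDerivAt (prim m) (m x) x := fun x hx =>
    intervalIntegral.integral_hasDerivAt_right (hmi 0 x) hmm.stronglyMeasurable.stronglyMeasurableAtFilter (hmc x hx)
  have hαl : ∀ x y, |prim m x - prim m y| ≤ L * |x - y| := fun x y => by
    unfold prim
    rw [intervalIntegral.integral_interval_sub_left (hmi _ _) (hmi _ _)]
    exact intervalIntegral.norm_integral_le_of_norm_le_const (f := m) (C := L) fun t _ => hmb t
  have hαc : Continuous (prim m) := intervalIntegral.continuous_primitive hmi 0
  have hlow : ∀ x y, y < x → Real.log (x - y) + (prim m x - prim m y) / (x - y) ≤ Real.log (T x - T y) := fun x y h => by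
    have hxy : 0 < x - y := by linarith
    set c := (prim m x - prim m y) / (x - y) with hc
    have mono : Monotone (fun t => T t - Real.exp c * ((1 - c) * t + prim m t)) := by
      refine mono_off_zero (F' := fun t => Real.exp (m t) - Real.exp c * ((1 - c) + m t)) (by fun_prop) (fun t ht => ?_) (fun t ht => ?_)
      · refine ((hd t ht).sub ((((hasDerivAt_id t).const_mul (1 - c)).add (hαd t ht)).const_mul (Real.exp c))).congr_deriv ?_
        ring
      · have e : Real.exp (m t) = Real.exp c * Real.exp (m t - c) := by rw [← Real.exp_add]; congr 1; ring
        have k := Real.add_one_le_exp (m t - c)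
        show 0 ≤ Real.exp (m t) - Real.exp c * ((1 - c) + m t)
        rw [e, ← mul_sub]
        exact mul_nonneg (Real.exp_pos c).le (by linarith)
    have k := mono h.le
    have hcc : prim m x - prim m y = c * (x - y) := by rw [hc]; field_simp
    have k2 : Real.exp c * (x - y) ≤ T x - T y := by
      have e : Real.exp c * ((1 - c) * x + prim m x) - Real.exp c * ((1 - c) * y + prim m y) = Real.exp c * (x - y) := by
        rw [← mul_sub]; congr 1; linarith
      simp only at k
      linarith
    calc _ = Real.log (Real.exp c * (x - y)) := by rw [Real.log_mul (Real.exp_pos c).ne' hxy.ne', Real.log_exp]; ring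
      _ ≤ _ := Real.log_le_log (by positivity) k2
  have hup : ∀ x y, y < x → Real.log (T x - T y) ≤ Real.log (x - y) + L := fun x y h => by
    have hxy : 0 < x - y := by linarith
    have mono : Monotone (fun t => Real.exp L * t - T t) := by
      refine mono_off_zero (F' := fun t => Real.exp L * 1 - Real.exp (m t)) (by fun_prop) (fun t ht => ?_) (fun t ht => ?_)
      · exact ((hasDerivAt_id t).const_mul (Real.exp L)).sub (hd t ht)
      · have := Real.exp_le_exp.2 ((le_abs_self _).trans (hmb t))
        linarith
    have k := mono h.le
    simp only at k
    have k2 : T x - T y ≤ Real.exp L * (x - y) := by linarith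
    calc _ ≤ Real.log (Real.exp L * (x - y)) := Real.log_le_log (sub_pos.2 (hT1 h)) k2
      _ = _ := by rw [Real.log_mul (Real.exp_pos L).ne' hxy.ne', Real.log_exp]; ring
  refine ⟨T, m, prim m, L, hT1.injective, hT3, hT2, hT4, hd, fun x hx => ?_, hmm, hmb, prim_zero, hαl, hαd, ?_, ?_⟩
  · rw [hexp x hx]; have := (hf.pos hC0 (hTne hx)).ne'; field_simp
  · intro x y hxy
    rcases lt_or_gt_of_ne hxy with h | h
    · have := hlow y x h
      rw [abs_sub_comm x y, abs_sub_comm (T x), abs_of_pos (sub_pos.2 h), abs_of_pos (sub_pos.2 (hT1 h))]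
      rw [← neg_sub (prim m y), ← neg_sub y x, neg_div_neg_eq]
      exact this
    · rw [abs_of_pos (sub_pos.2 h), abs_of_pos (sub_pos.2 (hT1 h))]
      exact hlow x y h
  · intro x y hxy
    rcases lt_or_gt_of_ne hxy with h | h
    · rw [abs_sub_comm x y, abs_sub_comm (T x), abs_of_pos (sub_pos.2 h), abs_of_pos (sub_pos.2 (hT1 h))]
      exact hup y x h
    · rw [abs_of_pos (sub_pos.2 h), abs_of_pos (sub_pos.2 (hT1 h))]
      exact hup x y h

end Onofri

namespace Onofri
open Set Filter Topology

variable {a C L : ℝ} {f g T m α : ℝ → ℝ}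

lemma Trans.image (h : Trans f g T m α L) : T '' {0}ᶜ = {0}ᶜ := by
  ext y
  constructor
  · rintro ⟨x, hx, rfl⟩ h0
    exact hx (h.inj (Eq.trans h0 h.zero.symm))
  · intro hy
    obtain ⟨x, rfl⟩ := h.surj y
    refine ⟨x, fun hx => hy ?_, rfl⟩
    rw [mem_singleton_iff] at hx ⊢
    rw [hx, h.zero]

lemma Trans.cov (h : Trans f g T m α L) (k : ℝ → ℝ) : ∫ x, f x * k x = ∫ x, g x * k (T x) := by
  have key := integral_image_eq_integral_abs_deriv_smul (s := {0}ᶜ) (f := T) (f' := fun x => Real.exp (m x))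
    (measurableSet_singleton (0:ℝ)).compl (fun x hx => (h.deriv x hx).hasDerivWithinAt) h.inj.injOn (fun x => f x * k x)
  rw [h.image, restrict_compl_singleton (μ := volume) (0:ℝ)] at key
  rw [key]
  refine integral_congr_ae ?_
  filter_upwards [ae_ne_zero] with x hx
  rw [abs_of_pos (Real.exp_pos _), ← h.dens x hx, smul_eq_mul, mul_assoc]

noncomputable def SS (a : ℝ) (f : ℝ → ℝ) (x : ℝ) : ℝ := Real.log (f x) + (1 - a) * Real.log |x|

lemma one_add_rpow_bound (ha : 0 < a) (ha1 : a ≤ 1) (x : ℝ) : 2 * Real.log (1 + |x| ^ a) ≤ Real.log 8 + Real.log (1 + x ^ 2) := by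
  have h1 : |x| ^ a ≤ 1 + |x| := by
    rcases le_total |x| 1 with h | h
    · have := Real.rpow_le_one (abs_nonneg x) h ha.le
      linarith [abs_nonneg x]
    · have := Real.rpow_le_rpow_of_exponent_le h ha1
      rw [Real.rpow_one] at this; linarith
  have h2 : 0 ≤ |x| ^ a := by positivity
  rw [← Real.log_mul (by norm_num) (by positivity), ← Real.log_rpow (by positivity)]
  refine Real.log_le_log (by positivity) ?_
  rw [Real.rpow_two, ← sq_abs x]
  have := abs_nonneg x
  nlinarith [sq_nonneg (|x| - 1)]

lemma log_ww {x : ℝ} (hx : x ≠ 0) : Real.log (ww a x) = (a - 1) * Real.log |x| - 2 * Real.log (1 + |x| ^ a) := by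
  have h := abs_pos.2 hx
  have : 0 < |x| ^ a := by positivity
  unfold ww
  rw [Real.log_div (by positivity) (by positivity), Real.log_rpow h, Real.log_pow]; norm_num

lemma Adm.SS_bound (ha : 0 < a) (ha1 : a ≤ 1) (hC : 0 < C) (h : Adm a C f) {x : ℝ} (hx : x ≠ 0) :
    |SS a f x| ≤ (|Real.log C| + Real.log 8) + Real.log (1 + x ^ 2) := by
  have hf := h.pos hC hx
  have hw := ww_pos (a := a) hx
  have l1 := Real.log_le_log hw (h.lower x hx)
  have l2 := Real.log_le_log hf (h.upper x hx)
  rw [Real.log_mul hC.ne' hf.ne'] at l1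
  rw [Real.log_mul hC.ne' hw.ne'] at l2
  rw [log_ww hx] at l1 l2
  have l3 := one_add_rpow_bound ha ha1 x
  have l4 : 0 ≤ Real.log (1 + |x| ^ a) := Real.log_nonneg (by linarith [(by positivity : 0 ≤ |x| ^ a)])
  have l5 := neg_abs_le (Real.log C)
  have l6 := le_abs_self (Real.log C)
  unfold SS
  rw [abs_le]
  constructor <;> linarith

lemma SS_measurable (hf : Measurable f) : Measurable (SS a f) := by
  unfold SS; fun_prop

lemma Adm.nonneg (hC : 0 < C) (h : Adm a C f) : ∀ᵐ x, 0 ≤ f x := by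
  filter_upwards [ae_ne_zero] with x hx using (h.pos hC hx).le

lemma Adm.mul_int (hC : 0 < C) (h : Adm a C f) {k : ℝ → ℝ} (hk : AEStronglyMeasurable k)
    (hi : Integrable (fun x => ww a x * k x)) : Integrable (fun x => f x * k x) := by
  refine (hi.norm.const_mul C).mono' (h.meas.aestronglyMeasurable.mul hk) ?_
  filter_upwards [ae_ne_zero] with x hx
  rw [norm_mul, norm_mul, Real.norm_of_nonneg (h.pos hC hx).le, Real.norm_of_nonneg (ww_nonneg a x), ← mul_assoc]
  exact mul_le_mul_of_nonneg_right (h.upper x hx) (norm_nonneg _)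

lemma Adm.log_int (ha : 0 < a) (ha1 : a ≤ 1) (hC : 0 < C) (h : Adm a C f) :
    Integrable (fun x => f x * Real.log (1 + x ^ 2)) :=
  h.mul_int hC (by fun_prop : Measurable _).aestronglyMeasurable (ww_log_integrable ha ha1)

lemma Adm.SS_int (ha : 0 < a) (ha1 : a ≤ 1) (hC : 0 < C) (h : Adm a C f) {g : ℝ → ℝ} (hg : Adm a C g) :
    Integrable (fun x => f x * SS a g x) := by
  have i : Integrable (fun x => (|Real.log C| + Real.log 8) * f x + f x * Real.log (1 + x ^ 2)) :=
    (h.int.const_mul _).add (h.log_int ha ha1 hC)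
  refine i.mono' (h.meas.mul (SS_measurable hg.meas)).aestronglyMeasurable ?_
  filter_upwards [ae_ne_zero] with x hx
  have hf := h.pos hC hx
  rw [norm_mul, Real.norm_of_nonneg hf.le, Real.norm_eq_abs]
  have := mul_le_mul_of_nonneg_left (hg.SS_bound ha ha1 hC hx) hf.le
  linarith

lemma ae_prod_ne : ∀ᵐ p : ℝ × ℝ, p.1 ≠ 0 ∧ p.2 ≠ 0 := by
  have h1 : ∀ᵐ p : ℝ × ℝ, p.1 ≠ 0 := Measure.quasiMeasurePreserving_fst.ae ae_ne_zero
  have h2 : ∀ᵐ p : ℝ × ℝ, p.2 ≠ 0 := Measure.quasiMeasurePreserving_snd.ae ae_ne_zero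
  exact h1.and h2

lemma Adm.log_two (ha : 0 < a) (ha1 : a ≤ 1) (hC : 0 < C) (h : Adm a C f) {g : ℝ → ℝ} (hg : Adm a C g) :
    Integrable (fun p : ℝ × ℝ => f p.1 * g p.2 * Real.log |p.1 - p.2|) := by
  have m1 : Measurable (fun p : ℝ × ℝ => f p.1) := h.meas.comp measurable_fst
  have m2 : Measurable (fun p : ℝ × ℝ => g p.2) := hg.meas.comp measurable_snd
  refine ((ww_log_two ha ha1).norm.const_mul (C * C)).mono' ((m1.mul m2).mul (by fun_prop)).aestronglyMeasurable ?_
  filter_upwards [ae_prod_ne] with p hp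
  have e1 := (h.pos hC hp.1).le
  have e2 := (hg.pos hC hp.2).le
  rw [norm_mul, norm_mul, norm_mul, norm_mul, Real.norm_of_nonneg e1, Real.norm_of_nonneg e2,
    Real.norm_of_nonneg (ww_nonneg a _), Real.norm_of_nonneg (ww_nonneg a _), ← mul_assoc]
  refine mul_le_mul_of_nonneg_right ?_ (norm_nonneg _)
  calc f p.1 * g p.2 ≤ (C * ww a p.1) * (C * ww a p.2) := mul_le_mul (h.upper _ hp.1) (hg.upper _ hp.2) e2 (e1.trans (h.upper _ hp.1))
    _ = _ := by ring

end Onofri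

namespace Onofri
open Set Filter Topology

variable {a C L θ : ℝ} {f g T m α : ℝ → ℝ}

lemma Trans.alpha_cont (h : Trans f g T m α L) : Continuous α := by
  have hL : 0 ≤ L := (abs_nonneg _).trans (h.mb 0)
  refine LipschitzWith.continuous (K := ⟨L, hL⟩) (LipschitzWith.of_dist_le_mul fun x y => ?_)
  rw [Real.dist_eq, Real.dist_eq]; exact h.αlip x y

lemma Trans.quot (h : Trans f g T m α L) (x y : ℝ) : |(α x - α y) / (x - y)| ≤ L := by
  have hL : 0 ≤ L := (abs_nonneg _).trans (h.mb 0)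
  rcases eq_or_ne x y with e | e
  · rw [e]; simpa using hL
  · rw [abs_div, div_le_iff₀ (abs_pos.2 (sub_ne_zero.2 e))]; exact h.αlip x y

lemma Trans.lower' (h : Trans f g T m α L) (x y : ℝ) :
    Real.log |x - y| + (α x - α y) / (x - y) ≤ Real.log |T x - T y| := by
  rcases eq_or_ne x y with e | e
  · rw [e]; simp
  · exact h.lower x y e

lemma Trans.diff_bound (h : Trans f g T m α L) (x y : ℝ) :
    ‖Real.log |T x - T y| - Real.log |x - y|‖ ≤ L := by
  have hL : 0 ≤ L := (abs_nonneg _).trans (h.mb 0)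
  rcases eq_or_ne x y with e | e
  · rw [e]; simpa using hL
  · have h1 := h.lower x y e
    have h2 := h.upper x y e
    have h3 := (abs_le.1 (h.quot x y)).1
    rw [Real.norm_eq_abs, abs_le]; constructor <;> linarith

lemma gg2_int (hg : Integrable g) : Integrable (fun p : ℝ × ℝ => g p.1 * g p.2) := hg.mul_prod hg

lemma Trans.two_int (ha : 0 < a) (ha1 : a ≤ 1) (hC : 0 < C) (hg : Adm a C g) (h : Trans f g T m α L) :
    Integrable (fun p : ℝ × ℝ => g p.1 * g p.2 * Real.log |T p.1 - T p.2|) := by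
  have hT := h.cont.measurable
  have m1 : Measurable (fun p : ℝ × ℝ => T p.1) := hT.comp measurable_fst
  have m2 : Measurable (fun p : ℝ × ℝ => T p.2) := hT.comp measurable_snd
  have i2 : Integrable (fun p : ℝ × ℝ => g p.1 * g p.2 * (Real.log |T p.1 - T p.2| - Real.log |p.1 - p.2|)) := by
    refine (gg2_int hg.int).mul_bdd (c := L) (by fun_prop : Measurable _).aestronglyMeasurable (Eventually.of_forall fun p => ?_)
    exact h.diff_bound _ _
  refine (i2.add (hg.log_two ha ha1 hC hg)).congr (Eventually.of_forall fun p => ?_)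
  simp only [Pi.add_apply]; ring

lemma Trans.two (ha : 0 < a) (ha1 : a ≤ 1) (hC : 0 < C) (hf : Adm a C f) (hg : Adm a C g) (h : Trans f g T m α L) :
    ∫ p : ℝ × ℝ, f p.1 * f p.2 * Real.log |p.1 - p.2| = ∫ p : ℝ × ℝ, g p.1 * g p.2 * Real.log |T p.1 - T p.2| := by
  have i1 := hf.log_two ha ha1 hC hf
  have i2 := h.two_int ha ha1 hC hg
  have e1 := integral_prod _ i1
  have e2 := integral_prod _ i2
  rw [← Measure.volume_eq_prod] at e1 e2
  rw [e1, e2]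
  simp only [mul_assoc, integral_const_mul]
  rw [h.cov]
  refine integral_congr_ae (Eventually.of_forall fun x => ?_)
  simp only
  rw [h.cov]

lemma Trans.one (ha : 0 < a) (ha1 : a ≤ 1) (hC : 0 < C) (hf : Adm a C f) (hg : Adm a C g) (h : Trans f g T m α L) :
    (∫ x, g x * SS a g x) - (∫ x, g x * m x) + (1 - a) * ∫ x, g x * (α x / x) ≤ ∫ x, f x * SS a f x := by
  have hL : 0 ≤ L := (abs_nonneg _).trans (h.mb 0)
  rw [h.cov]
  have hαm := h.alpha_cont.measurable
  have hTm := h.cont.measurable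
  have q : ∀ x, |α x / x| ≤ L := fun x => by have := h.quot x 0; simpa [h.αzero] using this
  have i1 := hg.SS_int ha ha1 hC hg
  have i2 : Integrable (fun x => g x * m x) := hg.int.mul_bdd h.mm.aestronglyMeasurable (Eventually.of_forall h.mb)
  have i3 : Integrable (fun x => g x * (α x / x)) :=
    hg.int.mul_bdd (by fun_prop : Measurable _).aestronglyMeasurable (Eventually.of_forall q)
  have i4' : Integrable (fun x => g x * (Real.log |T x| - Real.log |x|)) := by
    refine hg.int.mul_bdd (c := L) (by fun_prop : Measurable _).aestronglyMeasurable (Eventually.of_forall fun x => ?_)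
    have := h.diff_bound x 0
    simpa [h.zero] using this
  have e4 : ∀ x, x ≠ 0 → g x * SS a f (T x) = g x * SS a g x - g x * m x + (1 - a) * (g x * (Real.log |T x| - Real.log |x|)) := by
    intro x hx
    have hTx : T x ≠ 0 := fun h0 => hx (h.inj (h0.trans h.zero.symm))
    have : Real.log (g x) = m x + Real.log (f (T x)) := by
      rw [← h.dens x hx, Real.log_mul (Real.exp_pos _).ne' (hf.pos hC hTx).ne', Real.log_exp]
    unfold SS; rw [this]; ring
  have i5 : Integrable (fun x => g x * SS a g x - g x * m x) := i1.sub i2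
  have i6 : Integrable (fun x => g x * SS a g x - g x * m x + (1 - a) * (g x * (α x / x))) := i5.add (i3.const_mul _)
  have i7 : Integrable (fun x => g x * SS a g x - g x * m x + (1 - a) * (g x * (Real.log |T x| - Real.log |x|))) := i5.add (i4'.const_mul _)
  rw [← integral_const_mul, ← integral_sub i1 i2, ← integral_add i5 (i3.const_mul _)]
  refine integral_mono_ae i6 (i7.congr ?_) ?_
  · filter_upwards [ae_ne_zero] with x hx using (e4 x hx).symm
  · filter_upwards [ae_ne_zero] with x hx
    rw [e4 x hx]
    have h1 := h.lower' x 0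
    simp only [h.zero, h.αzero, sub_zero] at h1
    have h2 : α x / x ≤ Real.log |T x| - Real.log |x| := by linarith
    have h3 := mul_le_mul_of_nonneg_left (mul_le_mul_of_nonneg_left h2 (hg.pos hC hx).le) (sub_nonneg.2 ha1)
    linarith

lemma Trans.two_ge (ha : 0 < a) (ha1 : a ≤ 1) (hC : 0 < C) (hf : Adm a C f) (hg : Adm a C g) (h : Trans f g T m α L) :
    (∫ p : ℝ × ℝ, g p.1 * g p.2 * Real.log |p.1 - p.2|) + (∫ p : ℝ × ℝ, g p.1 * g p.2 * ((α p.1 - α p.2) / (p.1 - p.2)))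
      ≤ ∫ p : ℝ × ℝ, f p.1 * f p.2 * Real.log |p.1 - p.2| := by
  rw [h.two ha ha1 hC hf hg]
  have hαm := h.alpha_cont.measurable
  have m1 : Measurable (fun p : ℝ × ℝ => α p.1) := hαm.comp measurable_fst
  have m2 : Measurable (fun p : ℝ × ℝ => α p.2) := hαm.comp measurable_snd
  have i1 := hg.log_two ha ha1 hC hg
  have i2 : Integrable (fun p : ℝ × ℝ => g p.1 * g p.2 * ((α p.1 - α p.2) / (p.1 - p.2))) :=
    (gg2_int hg.int).mul_bdd (by fun_prop : Measurable _).aestronglyMeasurable (Eventually.of_forall fun p => h.quot _ _)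
  rw [← integral_add i1 i2]
  refine integral_mono_ae (i1.add i2) (h.two_int ha ha1 hC hg) ?_
  filter_upwards [ae_prod_ne] with p hp
  have := mul_le_mul_of_nonneg_left (h.lower' p.1 p.2) (mul_pos (hg.pos hC hp.1) (hg.pos hC hp.2)).le
  linarith

noncomputable def FF (a : ℝ) (f : ℝ → ℝ) : ℝ := (∫ x, f x * SS a f x) + a * ∫ p : ℝ × ℝ, f p.1 * f p.2 * Real.log |p.1 - p.2|

lemma FF_ge (ha : 0 < a) (ha1 : a ≤ 1) (h0 : 0 < θ) (h1 : θ < π * a) (hC : 0 < C) (hf : Adm a C f)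
    (hg : Adm a C (gg a θ)) (h : Trans f (gg a θ) T m α L) : FF a (gg a θ) ≤ FF a f := by
  have e1 := h.one ha ha1 hC hf hg
  have e2 := mul_le_mul_of_nonneg_left (h.two_ge ha ha1 hC hf hg) ha.le
  have e3 := identI ha ha1 h0 h1 α m L h.αlip h.αzero h.alpha_cont.measurable h.mm h.mb h.αderiv
  unfold FF
  linarith

lemma cross (ha : 0 < a) (ha1 : a ≤ 1) (h0 : 0 < θ) (h1 : θ < π * a) (hC : 0 < C) (hf : Adm a C f)
    (hg : Adm a C (gg a θ)) :
    ∫ p : ℝ × ℝ, f p.1 * gg a θ p.2 * Real.log |p.1 - p.2| = ∫ x, f x * (1 / (2 * a) * Real.log (qq a θ x)) := by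
  have e1 := integral_prod _ (hf.log_two ha ha1 hC hg)
  rw [← Measure.volume_eq_prod] at e1
  rw [e1]
  refine integral_congr_ae ?_
  filter_upwards [ae_ne_zero] with x hx
  simp only [mul_assoc, integral_const_mul]
  rw [potential ha ha1 h0 h1 x hx]

end Onofri

namespace Onofri
open Set Filter Topology

variable {a C L θ : ℝ} {f g T m α : ℝ → ℝ}

lemma Adm.mono {C' : ℝ} (hC : 0 < C) (h : Adm a C f) (hC' : C ≤ C') : Adm a C' f where
  meas := h.meas
  int := h.int
  cont := h.cont
  lower := fun x hx => (h.lower x hx).trans (mul_le_mul_of_nonneg_right hC' (h.pos hC hx).le)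
  upper := fun x hx => (h.upper x hx).trans (mul_le_mul_of_nonneg_right hC' (ww_pos hx).le)

lemma Adm.mul {K : ℝ} (hC : 0 < C) (h : Adm a C f) {u : ℝ → ℝ} (hu : Continuous u) (h0 : ∀ x, 0 < u x)
    (h1 : ∀ x, u x ≤ K) (h2 : ∀ x, 1 ≤ K * u x) : Adm a (C * K) (fun x => u x * f x) where
  meas := hu.measurable.mul h.meas
  int := h.int.bdd_mul (c := K) hu.aestronglyMeasurable (Eventually.of_forall fun x => by
    rw [Real.norm_of_nonneg (h0 x).le]; exact h1 x)
  cont := fun x hx => hu.continuousAt.mul (h.cont x hx)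
  lower := fun x hx => by
    have e1 := h.lower x hx
    have e2 := mul_le_mul_of_nonneg_right (h2 x) (mul_pos hC (h.pos hC hx)).le
    linarith
  upper := fun x hx => by
    have e1 := h.upper x hx
    calc u x * f x ≤ K * (C * ww a x) := mul_le_mul (h1 x) e1 (h.pos hC hx).le ((h0 x).le.trans (h1 x))
      _ = _ := by ring

lemma gh_lower (h0 : 0 < θ) (h1 : θ < π) {C : ℝ} (hC : π / sin θ ≤ C) {x : ℝ} (hx : 0 < x) :
    ww a x ≤ C * gh a θ x := by
  have hs := Real.sin_pos_of_pos_of_lt_pi h0 h1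
  have hq := qf_pos (a := a) h0.le h1 hx.le
  have hxa : 0 < x ^ a := by positivity
  have hx1 : 0 < x ^ (a - 1) := by positivity
  have hle : qf a θ x ≤ (1 + x ^ a) ^ 2 := by
    unfold qf; nlinarith [Real.cos_le_one θ]
  have hgh : 0 < gh a θ x := by unfold gh; have := Real.pi_pos; positivity
  calc ww a x = x ^ (a - 1) / (1 + x ^ a) ^ 2 := by unfold ww; rw [abs_of_pos hx]
    _ ≤ x ^ (a - 1) / qf a θ x := by gcongr
    _ = π / sin θ * gh a θ x := by unfold gh; have := Real.pi_pos; field_simp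
    _ ≤ _ := mul_le_mul_of_nonneg_right hC hgh.le

lemma gg_adm (ha : 0 < a) (ha1 : a ≤ 1) (h0 : 0 < θ) (h1 : θ < π * a) : ∃ C, 1 ≤ C ∧ Adm a C (gg a θ) := by
  have hpa : π * a ≤ π := by nlinarith [Real.pi_pos]
  have h1' : θ < π := by linarith
  have k0 : 0 < π * a - θ := by linarith
  have k1 : π * a - θ < π := by linarith
  refine ⟨max (max 1 (1 / c0 a θ)) (max (π / sin θ) (π / sin (π * a - θ))), (le_max_left _ _).trans (le_max_left _ _), ?_⟩
  refine ⟨gg_measurable a θ, gg_integrable ha ha1 h0 h1, fun x hx => ?_, fun x hx => ?_, fun x hx => ?_⟩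
  · rcases lt_or_gt_of_ne hx with h | h
    · have hc := (gh_hasDerivAt (a := a) k0 k1 (neg_pos.2 h)).continuousAt
      have hc2 : ContinuousAt (fun y => gh a (π * a - θ) (-y)) x := ContinuousAt.comp (g := gh a (π * a - θ)) (f := fun y => -y) hc continuous_neg.continuousAt
      refine hc2.congr ?_
      filter_upwards [Iio_mem_nhds h] with y hy
      have hy : y < 0 := hy
      unfold gg; rw [if_neg (not_lt.2 hy.le)]
    · have hc := (gh_hasDerivAt (a := a) h0 h1' h).continuousAt
      refine hc.congr ?_
      filter_upwards [Ioi_mem_nhds h] with y hy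
      exact (gg_eq_pos hy).symm
  · rcases lt_or_gt_of_ne hx with h | h
    · have := gh_lower (a := a) k0 k1 ((le_max_right (π / sin θ) _).trans (le_max_right (max 1 (1 / c0 a θ)) _)) (neg_pos.2 h)
      unfold gg; rw [if_neg (not_lt.2 h.le), ← ww_neg]; exact this
    · have := gh_lower (a := a) h0 h1' ((le_max_left _ (π / sin (π * a - θ))).trans (le_max_right (max 1 (1 / c0 a θ)) _)) h
      unfold gg; rw [if_pos h]; exact this
  · exact (gg_le ha1 h0 h1 x).2.trans (mul_le_mul_of_nonneg_right ((le_max_right _ _).trans (le_max_left _ _)) (ww_nonneg _ _))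

lemma FF_gg (ha : 0 < a) (ha1 : a ≤ 1) (h0 : 0 < θ) (h1 : θ < π * a) :
    FF a (gg a θ) = (Lam θ + Lam (π * a - θ)) / (π * a) - Real.log π := by
  obtain ⟨C, hC, hA⟩ := gg_adm ha ha1 h0 h1
  have hC0 : 0 < C := by linarith
  obtain ⟨i, e⟩ := ee_int ha ha1 h0 h1
  rw [← e]
  unfold FF
  rw [cross ha ha1 h0 h1 hC0 hA hA, ← integral_const_mul]
  have i1 := hA.SS_int ha ha1 hC0 hA
  have eq : ∀ x, a * (gg a θ x * (1 / (2 * a) * Real.log (qq a θ x))) = gg a θ x * ee a θ x - gg a θ x * SS a (gg a θ) x := by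
    intro x; unfold ee SS; field_simp; ring
  have i2 : Integrable (fun x => gg a θ x * ee a θ x - gg a θ x * SS a (gg a θ) x) := i.sub i1
  simp only [eq]
  rw [integral_sub i i1]; ring

lemma gg_int_pos (ha : 0 < a) (ha1 : a ≤ 1) (h0 : 0 < θ) (h1 : θ < π * a) :
    ∫ x in Ioi (0:ℝ), gg a θ x = θ / (π * a) := by
  have hpa : π * a ≤ π := by nlinarith [Real.pi_pos]
  have := (gh_int_Ioi ha h0 (by linarith : θ < π) (le_refl (0:ℝ))).2
  rw [psi_zero ha h0 (by linarith)] at this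
  rw [← this]
  refine setIntegral_congr_fun measurableSet_Ioi fun x hx => ?_
  exact gg_eq_pos hx

end Onofri

namespace Onofri
open Set Filter Topology

variable {a C L θ : ℝ} {f g T m α : ℝ → ℝ}

lemma Adm.half_pos (ha : 0 < a) (hC : 0 < C) (hf : Adm a C f) : 0 < ∫ x in Ioi (0:ℝ), f x := by
  have h1 := ww_tail ha (le_refl (0:ℝ))
  have h2 : ∫ x in Ioi (0:ℝ), ww a x ≤ ∫ x in Ioi (0:ℝ), C * f x :=
    setIntegral_mono_on (ww_integrable ha).integrableOn (hf.int.const_mul C).integrableOn measurableSet_Ioi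
      fun x hx => hf.lower x (ne_of_gt hx)
  rw [h1, Real.zero_rpow ha.ne', integral_const_mul] at h2
  have h3 : 0 < 1 / a * (1 / (1 + 0)) := by positivity
  exact pos_of_mul_pos_right (h3.trans_le h2) hC.le

lemma split_total (hf : Integrable f) : ∫ x, f x = (∫ x in Ioi (0:ℝ), f x) + ∫ x in Iic (0:ℝ), f x := by
  rw [← integral_add_compl measurableSet_Ioi hf, compl_Ioi]

lemma FF_min (ha : 0 < a) (ha1 : a ≤ 1) (hC : 0 < C) (hf : Adm a C f) (h1 : ∫ x, f x = 1) :
    FF a (gg a (π * a / 2)) ≤ FF a f := by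
  have hp := Real.pi_pos
  have p1 := hf.half_pos ha hC
  have p2 := hf.neg.half_pos ha hC
  rw [tail_neg] at p2
  have hs := split_total hf.int
  set θ := π * a * ∫ x in Ioi (0:ℝ), f x with hθ
  have hpa : 0 < π * a := by positivity
  have t0 : 0 < θ := by positivity
  have t1 : θ < π * a := by
    rw [hθ]; nlinarith
  obtain ⟨C1, hC1, hA⟩ := gg_adm ha ha1 t0 t1
  have hM : C1 ≤ max C C1 := le_max_right _ _
  have hf' := hf.mono hC (le_max_left C C1)
  have hA' := hA.mono (by linarith) hM
  have g1 := gg_int_pos ha ha1 t0 t1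
  have g2 := split_total hA.int
  rw [gg_integral ha ha1 t0 t1] at g2
  have g3 : θ / (π * a) = ∫ x in Ioi (0:ℝ), f x := by rw [hθ]; field_simp
  have e1 : ∫ x in Ioi (0:ℝ), f x = ∫ x in Ioi (0:ℝ), gg a θ x := by rw [g1, g3]
  obtain ⟨T, m, α, L, hT⟩ := exists_trans ha (hC1.trans hM) hf' hA' e1 (by linarith)
  refine le_trans ?_ (FF_ge ha ha1 t0 t1 (by linarith) hf' hA' hT)
  rw [FF_gg ha ha1 (by linarith) (by linarith), FF_gg ha ha1 t0 t1]
  have := Lam_ineq ha ha1 t0 t1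
  gcongr

lemma SS_g0 (ha : 0 < a) (ha1 : a ≤ 1) {x : ℝ} (hx : x ≠ 0) :
    SS a (gg a (π * a / 2)) x = Real.log (Real.sin (π * a / 2) / π) - Real.log (qq a (π * a / 2) x) := by
  have hp := Real.pi_pos
  have hpa : π * a ≤ π := by nlinarith
  have h0 : 0 < π * a / 2 := by positivity
  have hq := qq_pos ha1 h0 (by linarith : π * a / 2 < π * a) (x := x)
  have hs := Real.sin_pos_of_pos_of_lt_pi h0 (by linarith)
  have e : gg a (π * a / 2) x = Real.sin (π * a / 2) / π * (|x| ^ (a - 1) / qq a (π * a / 2) x) := by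
    have e2 : π * a - π * a / 2 = π * a / 2 := by ring
    unfold gg qq gh
    rw [e2]
    split_ifs with h
    · rw [abs_of_pos h]
    · rw [abs_of_nonpos (not_lt.1 h)]
  have hx' := abs_pos.2 hx
  unfold SS
  rw [e, Real.log_mul (by positivity) (by positivity), Real.log_div (x := |x| ^ (a - 1)) (by positivity) hq.ne', Real.log_rpow hx']
  ring

lemma main1 (ha : 0 < a) (ha1 : a ≤ 1) (v : ℝ → ℝ) (hv : ContDiff ℝ (⊤ : ℕ∞) v) (hvs : HasCompactSupport v) :
    Real.log (∫ x, Real.exp (v x) * gg a (π * a / 2) x) ≤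
      (1 / (8 * π ^ 2 * a)) * (∫ x, ∫ y, (v x - v y) ^ 2 / (x - y) ^ 2) + ∫ x, v x * gg a (π * a / 2) x := by
  have hp := Real.pi_pos
  have h0 : 0 < π * a / 2 := by positivity
  have h1 : π * a / 2 < π * a := by linarith
  obtain ⟨C1, hC1, hA1⟩ := gg_adm ha ha1 h0 h1
  have hC10 : 0 < C1 := by linarith
  have e1 := gg_integral ha ha1 h0 h1
  have hFF := fun {C f} => FF_min (C := C) (f := f) ha ha1
  have hSS := fun {x} => SS_g0 (x := x) ha ha1
  have hcr := fun {C f} => cross (C := C) (f := f) ha ha1 h0 h1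
  generalize hg0 : gg a (π * a / 2) = g0 at *
  generalize hq0 : qq a (π * a / 2) = q0 at *
  generalize hc : Real.log (Real.sin (π * a / 2) / π) = c at *
  obtain ⟨M, hM⟩ := hv.continuous.bounded_above_of_compact_support hvs
  have hM' : ∀ x, |v x| ≤ M := hM
  have hM0 : 0 ≤ M := (abs_nonneg _).trans (hM' 0)
  have hevA := hA1.mul (K := Real.exp M) hC10 (u := fun x => Real.exp (v x)) (Real.continuous_exp.comp hv.continuous)
    (fun x => Real.exp_pos _) (fun x => Real.exp_le_exp.2 (le_of_abs_le (hM' x)))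
    (fun x => by rw [← Real.exp_add]; exact Real.one_le_exp (by linarith [neg_le_of_abs_le (hM' x)]))
  set Z := ∫ x, Real.exp (v x) * g0 x with hZ
  have hC2 : 0 < C1 * Real.exp M := by positivity
  have hZ0 : 0 < Z := by
    rw [hZ, split_total hevA.int]
    have p1 := hevA.half_pos ha hC2
    have p2 := hevA.neg.half_pos ha hC2
    rw [tail_neg (f := fun x => Real.exp (v x) * g0 x)] at p2
    linarith
  have hfA := hevA.mul (K := max Z (1 / Z)) hC2 (u := fun x => 1 / Z) continuous_const (fun x => by positivity)
    (fun x => le_max_right _ _) (fun x => by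
      have : Z * (1 / Z) ≤ max Z (1 / Z) * (1 / Z) := mul_le_mul_of_nonneg_right (le_max_left _ _) (by positivity)
      rwa [mul_one_div_cancel hZ0.ne'] at this)
  have hC3 : 0 < C1 * Real.exp M * max Z (1 / Z) := mul_pos hC2 (hZ0.trans_le (le_max_left _ _))
  set f := fun x => 1 / Z * (Real.exp (v x) * g0 x) with hf
  have hf1 : ∫ x, f x = 1 := by
    rw [hf, integral_const_mul, ← hZ]; field_simp
  generalize C1 * Real.exp M * max Z (1 / Z) = C3 at *
  set C := max C1 C3
  have hC : 0 < C := hC10.trans_le (le_max_left _ _)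
  have hA := hA1.mono hC10 (le_max_left C1 C3)
  have hfA := hfA.mono hC3 (le_max_right C1 C3)
  have hmin := hFF hC hfA hf1
  have vi : ∀ {k : ℝ → ℝ}, Integrable k → Integrable (fun x => v x * k x) := fun hk =>
    hk.bdd_mul hv.continuous.aestronglyMeasurable (Eventually.of_forall hM)
  have qi : ∀ {k : ℝ → ℝ}, Adm a C k → Integrable (fun x => k x * Real.log (q0 x)) := by
    intro k hk
    have i : Integrable (fun x => c * k x - k x * SS a g0 x) := (hk.int.const_mul c).sub (hk.SS_int ha ha1 hC hA)
    refine i.congr ?_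
    filter_upwards [ae_ne_zero] with x hx
    rw [hSS hx]; ring
  have Sg : ∫ x, g0 x * SS a g0 x = c - ∫ x, g0 x * Real.log (q0 x) := by
    have : ∫ x, g0 x * SS a g0 x = ∫ x, (c * g0 x - g0 x * Real.log (q0 x)) := by
      refine integral_congr_ae ?_
      filter_upwards [ae_ne_zero] with x hx
      rw [hSS hx]; ring
    rw [this, integral_sub (hA.int.const_mul c) (qi hA), integral_const_mul, e1, mul_one]
  have Sf : ∫ x, f x * SS a f x = (∫ x, v x * f x) + (c - Real.log Z) - ∫ x, f x * Real.log (q0 x) := by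
    have i1 := vi hfA.int
    have i2 : Integrable (fun x => v x * f x + (c - Real.log Z) * f x) := i1.add (hfA.int.const_mul _)
    have : ∫ x, f x * SS a f x = ∫ x, (v x * f x + (c - Real.log Z) * f x - f x * Real.log (q0 x)) := by
      refine integral_congr_ae ?_
      filter_upwards [ae_ne_zero] with x hx
      have hs := hSS hx
      have hgx := hA.pos hC hx
      unfold SS at hs ⊢
      have : Real.log (f x) = v x + Real.log (g0 x) - Real.log Z := by
        rw [hf]; simp only
        rw [Real.log_mul (by positivity) (by positivity), Real.log_mul (by positivity) hgx.ne', Real.log_exp, one_div, Real.log_inv]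
        ring
      rw [this]
      linear_combination f x * hs
    rw [this, integral_sub i2 (qi hfA), integral_add i1 (hfA.int.const_mul _), integral_const_mul, hf1, mul_one]
  have cr : ∀ {k : ℝ → ℝ}, Adm a C k → ∫ p : ℝ × ℝ, k p.1 * g0 p.2 * Real.log |p.1 - p.2| = 1 / (2 * a) * ∫ x, k x * Real.log (q0 x) := by
    intro k hk
    rw [hcr hC hk hA, ← integral_const_mul]
    exact integral_congr_ae (Eventually.of_forall fun x => by simp only; ring)
  have crs : ∫ p : ℝ × ℝ, g0 p.1 * f p.2 * Real.log |p.1 - p.2| = 1 / (2 * a) * ∫ x, f x * Real.log (q0 x) := by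
    rw [← cr hfA]
    have := integral_prod_swap (μ := (volume : Measure ℝ)) (ν := (volume : Measure ℝ)) (fun p : ℝ × ℝ => f p.1 * g0 p.2 * Real.log |p.1 - p.2|)
    rw [← Measure.volume_eq_prod] at this
    rw [← this]
    refine integral_congr_ae (Eventually.of_forall fun p => ?_)
    simp only [Prod.fst_swap, Prod.snd_swap]
    rw [abs_sub_comm]; ring
  have jff := hfA.log_two ha ha1 hC hfA
  have jfg := hfA.log_two ha ha1 hC hA
  have jgf := hA.log_two ha ha1 hC hfA
  have jgg := hA.log_two ha ha1 hC hA
  have j1 : Integrable (fun p : ℝ × ℝ => f p.1 * f p.2 * Real.log |p.1 - p.2| - f p.1 * g0 p.2 * Real.log |p.1 - p.2|) := jff.sub jfg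
  have j2 : Integrable (fun p : ℝ × ℝ => f p.1 * f p.2 * Real.log |p.1 - p.2| - f p.1 * g0 p.2 * Real.log |p.1 - p.2|
    - g0 p.1 * f p.2 * Real.log |p.1 - p.2|) := j1.sub jgf
  have js : ∀ p : ℝ × ℝ, (f p.1 - g0 p.1) * (f p.2 - g0 p.2) * Real.log |p.1 - p.2| =
    f p.1 * f p.2 * Real.log |p.1 - p.2| - f p.1 * g0 p.2 * Real.log |p.1 - p.2|
    - g0 p.1 * f p.2 * Real.log |p.1 - p.2| + g0 p.1 * g0 p.2 * Real.log |p.1 - p.2| := fun p => by ring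
  have jint : Integrable (fun p : ℝ × ℝ => (f p.1 - g0 p.1) * (f p.2 - g0 p.2) * Real.log |p.1 - p.2|) := by
    simp only [js]; exact j2.add jgg
  have jval : ∫ p : ℝ × ℝ, (f p.1 - g0 p.1) * (f p.2 - g0 p.2) * Real.log |p.1 - p.2| =
      (∫ p : ℝ × ℝ, f p.1 * f p.2 * Real.log |p.1 - p.2|) - 1 / a * (∫ x, f x * Real.log (q0 x)) + 1 / (2 * a) * ∫ x, g0 x * Real.log (q0 x) := by
    simp only [js]
    rw [integral_add j2 jgg, integral_sub j1 jgf, integral_sub jff jfg, cr hfA, crs, cr hA]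
    field_simp; ring
  have hi : Integrable (fun x => f x - g0 x) := hfA.int.sub hA.int
  have fa := factA a ha v hv hvs (fun x => f x - g0 x) hi (by rw [integral_sub hfA.int hA.int, hf1, e1, sub_self])
    (by
      have : Integrable (fun x => f x * Real.log (1 + x ^ 2) - g0 x * Real.log (1 + x ^ 2)) := (hfA.log_int ha ha1 hC).sub (hA.log_int ha ha1 hC)
      refine this.congr (Eventually.of_forall fun x => ?_)
      simp only; ring) jint
  have hvs' : ∫ x, v x * (f x - g0 x) = (∫ x, v x * f x) - ∫ x, v x * g0 x := by
    rw [← integral_sub (vi hfA.int) (vi hA.int)]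
    exact integral_congr_ae (Eventually.of_forall fun x => by simp only; ring)
  rw [hvs', jval] at fa
  unfold FF at hmin
  rw [Sg, Sf, cr hA] at hmin
  have ea : ∀ y z w : ℝ, a * (y - 1 / a * z + 1 / (2 * a) * w) = a * y - z + 1 / 2 * w := by intros; field_simp
  have eb : ∀ w : ℝ, a * (1 / (2 * a) * w) = 1 / 2 * w := by intros; field_simp
  rw [ea] at fa
  rw [eb] at hmin
  linarith

end Onofri

namespace Onofri
open Set Filter Topology

lemma scale_int {l : ℝ} (hl : 0 < l) (F : ℝ → ℝ) : ∫ x, F x = ∫ t, l * F (l * t) := by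
  rw [integral_const_mul, Measure.integral_comp_mul_left, abs_of_pos (inv_pos.2 hl), smul_eq_mul, ← mul_assoc,
    mul_inv_cancel₀ hl.ne', one_mul]

lemma scale_D {l : ℝ} (hl : 0 < l) (v : ℝ → ℝ) :
    ∫ x, ∫ y, (v x - v y) ^ 2 / (x - y) ^ 2 = ∫ x, ∫ y, (v (l * x) - v (l * y)) ^ 2 / (x - y) ^ 2 := by
  rw [scale_int hl]
  refine integral_congr_ae (Eventually.of_forall fun x => ?_)
  simp only
  rw [scale_int hl, ← integral_const_mul]
  refine integral_congr_ae (Eventually.of_forall fun y => ?_)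
  simp only
  rw [← mul_sub, mul_pow]
  rcases eq_or_ne (x - y) 0 with h | h
  · rw [h]; simp
  · field_simp

lemma dens_scale {b ρ l x : ℝ} (hb : b ∈ Set.Ico (0 : ℝ) 1) (hρ : 0 < ρ) (hl : 0 < l) (hla : l ^ (1 - b) = ρ) (hx : x ≠ 0) :
    l * (Real.exp (Real.log (2 * (1 - b) * ρ * Real.cos (π * b / 2) /
        (|l * x| ^ (2 * (1 - b)) + 2 * ρ * |l * x| ^ (1 - b) * Real.sin (π * b / 2) + ρ ^ 2))) * |l * x| ^ (-b)) =
      2 * π * (1 - b) * gg (1 - b) (π * (1 - b) / 2) x := by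
  have hp := Real.pi_pos
  have hx' := abs_pos.2 hx
  obtain ⟨hb0, hb1⟩ := hb
  have h1b : 0 < 1 - b := by linarith
  have ec : Real.cos (π * b / 2) = Real.sin (π * (1 - b) / 2) := by
    rw [← Real.cos_pi_div_two_sub]; congr 1; ring
  have es : Real.sin (π * b / 2) = Real.cos (π * (1 - b) / 2) := by
    rw [← Real.sin_pi_div_two_sub]; congr 1; ring
  have hpi : π * (1 - b) ≤ π := by nlinarith
  have hs : 0 < Real.sin (π * (1 - b) / 2) := Real.sin_pos_of_pos_of_lt_pi (by positivity) (by linarith)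
  have hc : 0 ≤ Real.cos (π * (1 - b) / 2) := Real.cos_nonneg_of_mem_Icc ⟨by nlinarith, by nlinarith⟩
  have eg : gg (1 - b) (π * (1 - b) / 2) x = Real.sin (π * (1 - b) / 2) / π *
      (|x| ^ (-b) / ((|x| ^ (1 - b)) ^ 2 + 2 * |x| ^ (1 - b) * Real.cos (π * (1 - b) / 2) + 1)) := by
    have e2 : π * (1 - b) - π * (1 - b) / 2 = π * (1 - b) / 2 := by ring
    have e3 : 1 - b - 1 = -b := by ring
    unfold gg gh qf
    rw [e2, e3]
    split_ifs with h
    · rw [abs_of_pos h]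
    · rw [abs_of_nonpos (not_lt.1 h)]
  rw [eg, ec, es, abs_mul, abs_of_pos hl, mul_comm 2 (1 - b), Real.rpow_mul (by positivity),
    Real.mul_rpow hl.le hx'.le, Real.mul_rpow hl.le hx'.le, hla, Real.rpow_two]
  have hy : 0 < |x| ^ (1 - b) := by positivity
  have hl2 : l * l ^ (-b) = ρ := by
    rw [← hla, sub_eq_add_neg, Real.rpow_add hl, Real.rpow_one]
  generalize |x| ^ (1 - b) = y at *
  generalize Real.sin (π * (1 - b) / 2) = s at *
  generalize Real.cos (π * (1 - b) / 2) = c at *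
  have hd : 0 < y ^ 2 + 2 * y * c + 1 := by positivity
  have hd' : (ρ * y) ^ 2 + 2 * ρ * (ρ * y) * c + ρ ^ 2 = ρ ^ 2 * (y ^ 2 + 2 * y * c + 1) := by ring
  rw [hd', Real.exp_log (by positivity)]
  generalize y ^ 2 + 2 * y * c + 1 = d at *
  generalize |x| ^ (-b) = z
  have : l * ((1 - b) * 2 * ρ * s / (ρ ^ 2 * d) * (l ^ (-b) * z)) = (l * l ^ (-b)) * ((1 - b) * 2 * ρ * s / (ρ ^ 2 * d) * z) := by ring
  rw [this, hl2]
  field_simp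

end Onofri

theorem stmt_0 (b ρ : ℝ) (hb : b ∈ Set.Ico (0 : ℝ) 1) (hρ : 0 < ρ) (η : ℝ → ℝ)
    (hη : ∀ x : ℝ, η x = Real.log (2 * (1 - b) * ρ * Real.cos (π * b / 2) /
        (|x| ^ (2 * (1 - b)) + 2 * ρ * |x| ^ (1 - b) * Real.sin (π * b / 2) + ρ ^ 2)))
    (κ : ℝ) (hκ : κ = 2 * π * (1 - b))
    (v : ℝ → ℝ) (hv : ContDiff ℝ (⊤ : ℕ∞) v) (hvs : HasCompactSupport v) :
    Real.log ((1 / κ) * ∫ x : ℝ, Real.exp (v x) * Real.exp (η x) * |x| ^ (-b)) ≤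
      (1 / (4 * π * κ)) * (∫ x : ℝ, ∫ y : ℝ, (v x - v y) ^ 2 / (x - y) ^ 2)
        + (1 / κ) * ∫ x : ℝ, v x * Real.exp (η x) * |x| ^ (-b) := by
  have hp := Real.pi_pos
  have h1b : 0 < 1 - b := by linarith [hb.2]
  have hκ0 : 0 < κ := by rw [hκ]; positivity
  set l := ρ ^ (1 / (1 - b)) with hl
  have hl0 : 0 < l := by positivity
  have hla : l ^ (1 - b) = ρ := by
    rw [hl, ← Real.rpow_mul hρ.le, one_div_mul_cancel h1b.ne', Real.rpow_one]
  have key : ∀ k : ℝ → ℝ, (1 / κ) * ∫ x : ℝ, k x * Real.exp (η x) * |x| ^ (-b) =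
      ∫ x, k (l * x) * Onofri.gg (1 - b) (π * (1 - b) / 2) x := by
    intro k
    rw [Onofri.scale_int hl0, ← integral_const_mul]
    refine integral_congr_ae ?_
    filter_upwards [Onofri.ae_ne_zero] with x hx
    have h := Onofri.dens_scale hb hρ hl0 hla hx
    rw [← hη, ← hκ] at h
    have e : 1 / κ * (l * (k (l * x) * Real.exp (η (l * x)) * |l * x| ^ (-b))) =
      1 / κ * k (l * x) * (l * (Real.exp (η (l * x)) * |l * x| ^ (-b))) := by ring
    rw [e, h]; field_simp
  have m := Onofri.main1 h1b (by linarith [hb.1]) (fun x => v (l * x))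
    (hv.comp (contDiff_const.mul contDiff_id))
    (hvs.comp_homeomorph (Homeomorph.mulLeft₀ l hl0.ne'))
  rw [key (fun x => Real.exp (v x)), key v, Onofri.scale_D hl0 v]
  have e : 1 / (4 * π * κ) = 1 / (8 * π ^ 2 * (1 - b)) := by rw [hκ]; congr 1; ring
  rw [e]
  exact m
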